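/- Let p ≥ 2, α = p−1 and θ ≥ 0 with k₀ = p−1, and let 0 < σ₁ < σ₂ ≤ μ_{α,θ}. If TMC(σ₁,α,θ) is attained, then ((p−1)!/σ₂^{p−1}) TMC(σ₂,α,θ) > ((p−1)!/σ₁^{p−1}) TMC(σ₁,α,θ), and TMC(σ₂,α,θ) is also attained. -/

import Mathlib

open MeasureTheory Real Filter ENNReal

/-- The fractional-dimension spherical volume constant `ω_θ = 2π^((θ+1)/2)/Γ((θ+1)/2)`. -/
noncomputable def omegaW (θ : ℝ) : ℝ := 2 * Real.pi ^ ((θ + 1) / 2) / Real.Gamma ((θ + 1) / 2)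

/-- Weighted integral `∫₀^∞ f dλ_θ = ω_θ ∫₀^∞ f(r) r^θ dr` (for nonnegative integrands,
valued in `ℝ≥0∞`). -/
noncomputable def wInt (θ : ℝ) (f : ℝ → ℝ) : ℝ≥0∞ :=
  ENNReal.ofReal (omegaW θ) *
    ∫⁻ r in Set.Ioi (0 : ℝ), ENNReal.ofReal (f r) * ENNReal.ofReal (r ^ θ)

/-- The weighted Lebesgue norm `‖u‖_{L^q_θ}` (valued in `ℝ≥0∞`). -/
noncomputable def wNorm (θ q : ℝ) (u : ℝ → ℝ) : ℝ≥0∞ :=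
  (wInt θ fun r => |u r| ^ q) ^ (1 / q)

/-- Membership in the weighted Sobolev space `X = X^{1,p}_∞(α,θ)`:
`u` is locally absolutely continuous on `(0,∞)` with a.e. derivative `u'`
(expressed through the fundamental theorem of calculus on compact subintervals),
`u(r) → 0` as `r → ∞`, `‖u‖_{L^p_θ} < ∞` and `‖u'‖_{L^p_α} < ∞`. -/
structure MemX (p α θ : ℝ) (u u' : ℝ → ℝ) : Prop where
  ftc_int : ∀ a b : ℝ, 0 < a → a ≤ b → IntervalIntegrable u' MeasureTheory.volume a b
  ftc : ∀ a b : ℝ, 0 < a → a ≤ b → u b - u a = ∫ t in a..b, u' t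
  lim_zero : Filter.Tendsto u Filter.atTop (nhds 0)
  fin_u : wNorm θ p u < ⊤
  fin_u' : wNorm α p u' < ⊤

/-- Full norm on `X`: `‖u‖ = (‖u‖_{L^p_θ}^p + ‖u'‖_{L^p_α}^p)^{1/p}`. -/
noncomputable def Xnorm (p α θ : ℝ) (u u' : ℝ → ℝ) : ℝ≥0∞ :=
  ((wNorm θ p u) ^ p + (wNorm α p u') ^ p) ^ (1 / p)

/-- The truncated exponential `φ_p(t) = Σ_{j ∈ ℕ, j ≥ p-1} t^j / j!`. -/
noncomputable def phiP (p t : ℝ) : ℝ :=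
  ∑' j : ℕ, if p - 1 ≤ (j : ℝ) then t ^ j / (Nat.factorial j : ℝ) else 0

/-- The critical constant `μ_{α,θ} = (θ+1) ω_α^{1/α}`. -/
noncomputable def muC (α θ : ℝ) : ℝ := (θ + 1) * (omegaW α) ^ (1 / α)

/-- The Trudinger–Moser functional `∫₀^∞ φ_p(μ |u|^{p/(p-1)}) dλ_θ`. -/
noncomputable def TMfunc (p θ μ : ℝ) (u : ℝ → ℝ) : ℝ≥0∞ :=
  wInt θ fun r => phiP p (μ * |u r| ^ (p / (p - 1)))

/-- The subcritical Trudinger–Moser supremum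
`TMSC(μ,α,θ) = sup { ‖u‖_{L^p_θ}^{-p} ∫₀^∞ φ_p(μ|u|^{p/(p-1)}) dλ_θ : u ∈ X, u ≠ 0, ‖u'‖_{L^p_α} ≤ 1 }`. -/
noncomputable def TMSC (p α θ μ : ℝ) : ℝ≥0∞ :=
  ⨆ (u : ℝ → ℝ) (u' : ℝ → ℝ) (_ : MemX p α θ u u') (_ : u ≠ 0)
    (_ : wNorm α p u' ≤ 1), (wNorm θ p u) ^ (-p) * TMfunc p θ μ u

/-- The critical Trudinger–Moser supremum
`TMC(σ,α,θ) = sup { ∫₀^∞ φ_p(σ|u|^{p/(p-1)}) dλ_θ : u ∈ X, ‖u‖ ≤ 1 }`. -/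
noncomputable def TMC (p α θ σ : ℝ) : ℝ≥0∞ :=
  ⨆ (u : ℝ → ℝ) (u' : ℝ → ℝ) (_ : MemX p α θ u u') (_ : Xnorm p α θ u u' ≤ 1),
    TMfunc p θ σ u

/-- `k₀ = min { j ∈ ℕ : j ≥ p - 1 }`. -/
noncomputable def k0 (p : ℝ) : ℕ := sInf {j : ℕ | p - 1 ≤ (j : ℝ)}

/-- `TMC(σ,α,θ)` is attained by some `u ∈ X` with `‖u‖ ≤ 1`. -/
def TMCAttained (p α θ σ : ℝ) : Prop :=
  ∃ u u' : ℝ → ℝ, MemX p α θ u u' ∧ Xnorm p α θ u u' ≤ 1 ∧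
    TMC p α θ σ = TMfunc p θ σ u

/-- `σ_* = inf { σ ∈ (0, μ_{α,θ}) : TMC(σ,α,θ) is attained }`. -/
noncomputable def sigmaStar (p α θ : ℝ) : ℝ :=
  sInf {σ : ℝ | σ ∈ Set.Ioo 0 (muC α θ) ∧ TMCAttained p α θ σ}

/-- The exponential series with its first `n` terms removed. -/
noncomputable def expTail (n : ℕ) (x : ℝ) : ℝ :=
  Real.exp x - ∑ j ∈ Finset.range n, x ^ j / (j.factorial : ℝ)

theorem expTail_succ (n : ℕ) (x : ℝ) :
    expTail n x = x ^ n / (n.factorial : ℝ) + expTail (n + 1) x := by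
  simp only [expTail, Finset.sum_range_succ]; ring

theorem hasSum_expTail (n : ℕ) (x : ℝ) :
    HasSum (fun j : ℕ => x ^ (j + n) / ((j + n).factorial : ℝ)) (expTail n x) := by
  have h := NormedSpace.expSeries_div_hasSum_exp (𝔸 := ℝ) x
  rw [← Real.exp_eq_exp_ℝ] at h
  exact (hasSum_nat_add_iff' n).2 h

theorem continuous_expTail (n : ℕ) : Continuous (expTail n) := by
  unfold expTail; fun_prop

theorem expTail_nonneg (n : ℕ) {x : ℝ} (hx : 0 ≤ x) : 0 ≤ expTail n x :=
  (hasSum_expTail n x).nonneg fun j => by positivity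

theorem expTail_le_exp (n : ℕ) {x : ℝ} (hx : 0 ≤ x) : expTail n x ≤ Real.exp x := by
  have : 0 ≤ ∑ j ∈ Finset.range n, x ^ j / (j.factorial : ℝ) :=
    Finset.sum_nonneg fun j _ => by positivity
  unfold expTail; linarith

theorem pow_div_le_expTail (n : ℕ) {x : ℝ} (hx : 0 ≤ x) :
    x ^ n / (n.factorial : ℝ) ≤ expTail n x := by
  rw [expTail_succ]; linarith [expTail_nonneg (n + 1) hx]

theorem expTail_mono (n : ℕ) {x y : ℝ} (hx : 0 ≤ x) (hxy : x ≤ y) :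
    expTail n x ≤ expTail n y :=
  hasSum_le (fun j => by gcongr) (hasSum_expTail n x) (hasSum_expTail n y)

theorem expTail_mul_le (n : ℕ) {c x : ℝ} (hc : 0 ≤ c) (hc1 : c ≤ 1) (hx : 0 ≤ x) :
    expTail n (c * x) ≤ c ^ n * expTail n x := by
  refine hasSum_le (fun j => ?_) (hasSum_expTail n (c * x)) ((hasSum_expTail n x).mul_left (c ^ n))
  rw [mul_pow, mul_div_assoc]
  have : c ^ (j + n) ≤ c ^ n := pow_le_pow_of_le_one hc hc1 (by omega)
  gcongr

theorem expTail_pos (n : ℕ) {x : ℝ} (hx : 0 < x) : 0 < expTail n x :=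
  lt_of_lt_of_le (by positivity) (pow_div_le_expTail n hx.le)

theorem expTail_mul_lt (n : ℕ) {c x : ℝ} (hc : 0 < c) (hc1 : c < 1) (hx : 0 < x) :
    expTail n (c * x) < c ^ n * expTail n x := by
  rw [expTail_succ n (c * x), expTail_succ n x]
  have h1 := expTail_mul_le (n + 1) hc.le hc1.le hx.le
  have h2 := expTail_pos (n + 1) hx
  have h3 : c ^ (n + 1) < c ^ n := pow_lt_pow_right_of_lt_one₀ hc hc1 (by omega)
  have h4 := mul_lt_mul_of_pos_right h3 h2
  have h5 : (c * x) ^ n / (n.factorial : ℝ) = c ^ n * (x ^ n / (n.factorial : ℝ)) := by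
    rw [mul_pow]; ring
  rw [h5]; linarith

theorem expTail_le_pow_mul_exp (n : ℕ) {x : ℝ} (hx : 0 ≤ x) :
    expTail n x ≤ x ^ n * Real.exp x := by
  have h := NormedSpace.expSeries_div_hasSum_exp (𝔸 := ℝ) x
  rw [← Real.exp_eq_exp_ℝ] at h
  refine hasSum_le (fun j => ?_) (hasSum_expTail n x) (h.mul_left (x ^ n))
  have h1 : (j.factorial : ℝ) ≤ ((j + n).factorial : ℝ) := by
    exact_mod_cast Nat.factorial_le (by omega)
  have h2 : (0 : ℝ) < (j.factorial : ℝ) := by positivity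
  calc x ^ (j + n) / ((j + n).factorial : ℝ) ≤ x ^ (j + n) / (j.factorial : ℝ) := by gcongr
    _ = _ := by rw [pow_add]; ring

theorem phiP_eq_expTail (n : ℕ) (x : ℝ) : phiP ((n : ℝ) + 1) x = expTail n x := by
  have h := NormedSpace.expSeries_div_hasSum_exp (𝔸 := ℝ) x
  rw [← Real.exp_eq_exp_ℝ] at h
  unfold phiP
  have e : (fun j : ℕ => if (n : ℝ) + 1 - 1 ≤ (j : ℝ) then x ^ j / (j.factorial : ℝ) else 0)
      = fun j : ℕ => x ^ j / (j.factorial : ℝ) -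
        if j ∈ Finset.range n then x ^ j / (j.factorial : ℝ) else 0 := by
    funext j
    by_cases hj : n ≤ j
    · simp [hj, not_lt.2 hj]
    · simp [hj, not_le.1 hj]
  rw [e]
  refine (h.sub ?_).tsum_eq
  have := hasSum_sum_of_ne_finset_zero (s := Finset.range n)
    (f := fun j : ℕ => if j ∈ Finset.range n then x ^ j / (j.factorial : ℝ) else 0)
    (L := SummationFilter.unconditional ℕ) (fun b hb => by simp only [hb, if_false])
  rwa [Finset.sum_congr rfl (fun j hj => by rw [if_pos hj])] at this

/-- The exponent conjugate to `n + 1`. -/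
noncomputable def cexp (n : ℕ) : ℝ := 1 + (n : ℝ)⁻¹

theorem cexp_pos (n : ℕ) : 0 < cexp n := by unfold cexp; positivity

theorem one_le_cexp (n : ℕ) : 1 ≤ cexp n := by
  unfold cexp; linarith [inv_nonneg.2 (Nat.cast_nonneg (α := ℝ) n)]

theorem cexp_le_two {n : ℕ} (hn : 1 ≤ n) : cexp n ≤ 2 := by
  have : ((n : ℝ))⁻¹ ≤ 1 := inv_le_one_of_one_le₀ (by exact_mod_cast hn)
  unfold cexp; linarith

theorem rpow_cexp_pow {n : ℕ} (hn : 1 ≤ n) {x : ℝ} (hx : 0 ≤ x) :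
    (x ^ cexp n) ^ n = x ^ (n + 1) := by
  have hn' : (n : ℝ) ≠ 0 := by positivity
  rw [← Real.rpow_natCast, ← Real.rpow_mul hx, ← Real.rpow_natCast]
  congr 1; unfold cexp; push_cast; field_simp

theorem pow_rpow_cexp {n : ℕ} (hn : 1 ≤ n) {x : ℝ} (hx : 0 ≤ x) :
    (x ^ n) ^ cexp n = x ^ (n + 1) := by
  have hn' : (n : ℝ) ≠ 0 := by positivity
  rw [← Real.rpow_natCast x n, ← Real.rpow_mul hx, ← Real.rpow_natCast]
  congr 1; unfold cexp; push_cast; field_simp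

/-- Passing between bounds on `x ^ (n + 1)` and on `x ^ cexp n`. -/
theorem rpow_cexp_le_of_pow_le {n : ℕ} (hn : 1 ≤ n) {x y : ℝ} (hx : 0 ≤ x) (hy : 0 ≤ y)
    (h : x ^ (n + 1) ≤ y ^ n) : x ^ cexp n ≤ y := by
  rw [← rpow_cexp_pow hn hx] at h
  exact (pow_le_pow_iff_left₀ (by positivity) hy (by omega)).1 h

/-- Young's inequality with exponents `n + 1` and `(n + 1) / n`. -/
theorem young_pow (n : ℕ) {a b : ℝ} (ha : 0 ≤ a) (hb : 0 ≤ b) :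
    (n + 1) * (a * b ^ n) ≤ a ^ (n + 1) + n * b ^ (n + 1) := by
  rcases hb.eq_or_lt with rfl | hb
  · rcases Nat.eq_zero_or_pos n with rfl | hn
    · simp
    · rw [zero_pow (by omega : n ≠ 0), zero_pow (by omega : n + 1 ≠ 0)]
      simp only [mul_zero, add_zero]; positivity
  have h := one_add_mul_sub_le_pow (a := a / b) (n := n + 1) (by
    have : 0 ≤ a / b := by positivity
    linarith)
  have h2 := mul_le_mul_of_nonneg_right h (pow_pos hb (n + 1)).le
  rw [div_pow, div_mul_cancel₀ _ (by positivity)] at h2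
  have h3 : (1 + ((n + 1 : ℕ) : ℝ) * (a / b - 1)) * b ^ (n + 1)
      = (n + 1) * (a * b ^ n) - n * b ^ (n + 1) := by
    field_simp; push_cast; ring
  linarith

/-- Convexity of `t ↦ t ^ (n + 1)` on two pieces, in perspective form. -/
theorem add_pow_le_perspective (n : ℕ) {x y a h : ℝ} (hx : 0 ≤ x) (hy : 0 ≤ y) (ha : 0 < a)
    (hh : 0 ≤ h) {e : ℝ} (hye : y ^ (n + 1) ≤ e * h ^ n) (hz : h = 0 → 0 ≤ e) :
    (x + y) ^ (n + 1) ≤ (x ^ (n + 1) / a ^ n + e) * (a + h) ^ n := by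
  have hah : 0 < a + h := by positivity
  set z := (x + y) / (a + h) with hzdef
  have hz0 : 0 ≤ z := by positivity
  have key : ∀ X k : ℝ, 0 ≤ X → 0 < k → (n + 1) * (X * z ^ n) - n * z ^ (n + 1) * k ≤
      X ^ (n + 1) / k ^ n := by
    intro X k hX hk
    have := young_pow n hX (mul_nonneg hz0 hk.le)
    rw [le_div_iff₀ (by positivity)]
    have e1 : ((n + 1) * (X * z ^ n) - n * z ^ (n + 1) * k) * k ^ n =
      (n + 1) * (X * (z * k) ^ n) - n * (z * k) ^ (n + 1) := by
      rw [mul_pow, mul_pow]; ring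
    rw [e1]; linarith
  have k1 := key x a hx ha
  have k2 : (n + 1) * (y * z ^ n) - n * z ^ (n + 1) * h ≤ e := by
    rcases hh.eq_or_lt with rfl | hh
    · have he := hz rfl
      rcases Nat.eq_zero_or_pos n with rfl | hn
      · simp at hye ⊢; linarith
      · rw [zero_pow (by omega : n ≠ 0), mul_zero] at hye
        have : y = 0 := by
          by_contra hne
          have : 0 < y := lt_of_le_of_ne hy (Ne.symm hne)
          have : 0 < y ^ (n + 1) := by positivity
          linarith
        rw [this]; simpa using he
    · refine (key y h hy hh).trans ?_
      rw [div_le_iff₀ (by positivity)]; exact hye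
  have k3 : z ^ (n + 1) * (a + h) ≤ x ^ (n + 1) / a ^ n + e := by
    have : (n + 1) * ((x + y) * z ^ n) - n * z ^ (n + 1) * (a + h) = z ^ (n + 1) * (a + h) := by
      have : x + y = z * (a + h) := by rw [hzdef]; field_simp
      rw [this]; ring
    nlinarith [k1, k2]
  calc (x + y) ^ (n + 1) = z ^ (n + 1) * (a + h) * (a + h) ^ n := by
        have : x + y = z * (a + h) := by rw [hzdef]; field_simp
        rw [this, mul_pow]; ring
    _ ≤ _ := by gcongr

/-- `w` is a locally absolutely continuous function on the line with derivative `g`. -/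
structure IsPrim (w g : ℝ → ℝ) : Prop where
  int : ∀ a b : ℝ, IntervalIntegrable g volume a b
  ftc : ∀ a b : ℝ, w b - w a = ∫ t in a..b, g t

/-- The energy of the derivative on `S`. -/
noncomputable def dirE (n : ℕ) (g : ℝ → ℝ) (S : Set ℝ) : ℝ≥0∞ :=
  ∫⁻ t in S, ENNReal.ofReal (|g t| ^ (n + 1))

/-- The weighted `L^(n+1)` energy on `S`. -/
noncomputable def potE (n : ℕ) (w : ℝ → ℝ) (S : Set ℝ) : ℝ≥0∞ :=
  ∫⁻ t in S, ENNReal.ofReal (|w t| ^ (n + 1) * Real.exp (-t))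

/-- The Trudinger–Moser functional on `S` in logarithmic coordinates. -/
noncomputable def mosF (n : ℕ) (β : ℝ) (w : ℝ → ℝ) (S : Set ℝ) : ℝ≥0∞ :=
  ∫⁻ t in S, ENNReal.ofReal (expTail n (β * |w t| ^ cexp n) * Real.exp (-t))

theorem dirE_mono (n : ℕ) (g : ℝ → ℝ) {S T : Set ℝ} (h : S ⊆ T) : dirE n g S ≤ dirE n g T :=
  lintegral_mono_set h

theorem potE_mono (n : ℕ) (g : ℝ → ℝ) {S T : Set ℝ} (h : S ⊆ T) : potE n g S ≤ potE n g T :=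
  lintegral_mono_set h

namespace IsPrim

variable {w g : ℝ → ℝ}

theorem continuous (h : IsPrim w g) : Continuous w := by
  have h1 := intervalIntegral.continuous_primitive h.int 0
  have : w = fun b => w 0 + ∫ t in (0 : ℝ)..b, g t := by
    funext b; rw [← h.ftc]; ring
  rw [this]; exact continuous_const.add h1

theorem locallyIntegrable (h : IsPrim w g) : LocallyIntegrable g volume := by
  rw [MeasureTheory.locallyIntegrable_iff]
  intro k hk
  obtain ⟨a, ha⟩ := hk.bddBelow
  obtain ⟨b, hb⟩ := hk.bddAbove
  have h1 : IntegrableOn g (Set.Ioc (a - 1) b) := (h.int (a - 1) b).1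
  exact h1.mono_set fun x hx => ⟨by linarith [ha hx], hb hx⟩

theorem aestronglyMeasurable (h : IsPrim w g) : AEStronglyMeasurable g volume :=
  h.locallyIntegrable.aestronglyMeasurable

theorem const_mul (h : IsPrim w g) (c : ℝ) :
    IsPrim (fun t => c * w t) (fun t => c * g t) :=
  ⟨fun a b => (h.int a b).const_mul c, fun a b => by
    rw [intervalIntegral.integral_const_mul, ← h.ftc]; ring⟩

theorem comp_add (h : IsPrim w g) (c : ℝ) :
    IsPrim (fun t => w (t + c)) (fun t => g (t + c)) :=
  ⟨fun a b => by simpa using (h.int (a + c) (b + c)).comp_add_right c, fun a b => by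
    rw [intervalIntegral.integral_comp_add_right, ← h.ftc]⟩

theorem abs_sub_le (h : IsPrim w g) {a b : ℝ} (hab : a ≤ b) :
    |w b - w a| ≤ ∫ t in a..b, |g t| := by
  rw [h.ftc]; exact intervalIntegral.abs_integral_le_integral_abs hab

end IsPrim

theorem integrableOn_abs_pow (n : ℕ) {g : ℝ → ℝ} {S : Set ℝ}
    (hg : AEStronglyMeasurable g (volume.restrict S)) (h : dirE n g S ≠ ⊤) :
    IntegrableOn (fun t => |g t| ^ (n + 1)) S := by
  refine ⟨(hg.norm).pow _, ?_⟩
  rw [hasFiniteIntegral_iff_ofReal (Eventually.of_forall fun t => by positivity)]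
  exact lt_top_iff_ne_top.2 h

theorem integral_abs_pow_le (n : ℕ) {g : ℝ → ℝ} {S : Set ℝ} {e : ℝ} (he : 0 ≤ e)
    (h : dirE n g S ≤ ENNReal.ofReal e) : ∫ t in S, |g t| ^ (n + 1) ≤ e := by
  by_cases hi : Integrable (fun t => |g t| ^ (n + 1)) (volume.restrict S)
  · rw [← ENNReal.ofReal_le_ofReal_iff he, ofReal_integral_eq_lintegral_ofReal hi
      (Eventually.of_forall fun t => by positivity)]
    exact h
  · rw [integral_undef hi]; exact he

/-- Hölder's inequality for the increments, in energy form. -/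
theorem integral_abs_pow_le_energy (n : ℕ) {g : ℝ → ℝ} {a b e : ℝ} (hab : a ≤ b)
    (hg : IntervalIntegrable g volume a b) (he : 0 ≤ e)
    (h : dirE n g (Set.Ioc a b) ≤ ENNReal.ofReal e) :
    (∫ t in a..b, |g t|) ^ (n + 1) ≤ e * (b - a) ^ n := by
  rcases hab.eq_or_lt with rfl | hab
  · simp only [intervalIntegral.integral_same, sub_self, ne_eq, Nat.succ_ne_zero, not_false_eq_true,
      zero_pow]
    positivity
  have hL : 0 < b - a := by linarith
  set A := ∫ t in a..b, |g t| with hA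
  have hA0 : 0 ≤ A := intervalIntegral.integral_nonneg hab.le fun t _ => abs_nonneg _
  set z := A / (b - a) with hz
  have hz0 : 0 ≤ z := by positivity
  have hgi : IntegrableOn g (Set.Ioc a b) := hg.1
  have hp := integrableOn_abs_pow n hgi.aestronglyMeasurable (ne_top_of_le_ne_top (by simp) h)
  have hpi : IntervalIntegrable (fun t => |g t| ^ (n + 1)) volume a b :=
    (intervalIntegrable_iff_integrableOn_Ioc_of_le hab.le).2 hp
  have h1 : ∫ t in a..b, |g t| ^ (n + 1) ≤ e := by
    rw [intervalIntegral.integral_of_le hab.le]; exact integral_abs_pow_le n he h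
  have h2 : ∫ t in a..b, (n + 1) * (|g t| * z ^ n) ≤
      ∫ t in a..b, (|g t| ^ (n + 1) + n * z ^ (n + 1)) :=
    intervalIntegral.integral_mono_on hab.le ((hg.abs.mul_const _).const_mul _)
      (hpi.add (by simp)) fun t _ => young_pow n (abs_nonneg _) hz0
  rw [intervalIntegral.integral_add hpi (by simp), intervalIntegral.integral_const_mul,
    intervalIntegral.integral_mul_const, intervalIntegral.integral_const, smul_eq_mul, ← hA] at h2
  have hAz : A = z * (b - a) := by rw [hz]; field_simp
  have h3 : A * z ^ n ≤ e := by
    have : (b - a) * (n * z ^ (n + 1)) = n * (A * z ^ n) := by rw [hAz]; ring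
    rw [this] at h2; linarith
  calc A ^ (n + 1) = A * z ^ n * (b - a) ^ n := by
        conv_lhs => rw [pow_succ, hAz, mul_pow]
        rw [hAz]; ring
    _ ≤ _ := by gcongr

theorem IsPrim.abs_sub_pow_le {w g : ℝ → ℝ} (hw : IsPrim w g) (n : ℕ) {a b e : ℝ} (hab : a ≤ b)
    (he : 0 ≤ e) (h : dirE n g (Set.Ioc a b) ≤ ENNReal.ofReal e) :
    |w b - w a| ^ (n + 1) ≤ e * (b - a) ^ n :=
  (pow_le_pow_left₀ (abs_nonneg _) (hw.abs_sub_le hab) _).trans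
    (integral_abs_pow_le_energy n hab (hw.int a b) he h)

/-- A value of `w` at `t` is controlled by the energies to the left of `t`. -/
theorem IsPrim.radial {w g : ℝ → ℝ} (hw : IsPrim w g) (n : ℕ) {t h K : ℝ} {N : ℝ≥0∞}
    (hK : 0 ≤ K) (hD : dirE n g (Set.Iio t) ≤ ENNReal.ofReal K) (hN : potE n w (Set.Iio t) ≤ N)
    (hKh : K * h ^ n ≤ (|w t| / 2) ^ (n + 1)) :
    ENNReal.ofReal ((|w t| / 2) ^ (n + 1) * Real.exp (-t) * h) ≤ N := by
  have h1 : ∀ s ∈ Set.Ioo (t - h) t, ENNReal.ofReal ((|w t| / 2) ^ (n + 1) * Real.exp (-t)) ≤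
      ENNReal.ofReal (|w s| ^ (n + 1) * Real.exp (-s)) := by
    intro s hs
    have hd : dirE n g (Set.Ioc s t) ≤ ENNReal.ofReal K := by
      refine le_trans (le_of_eq ?_) ((dirE_mono n g (Set.Ioo_subset_Iio_self (a := s))).trans hD)
      exact setLIntegral_congr Ioo_ae_eq_Ioc.symm
    have h2 := hw.abs_sub_pow_le n hs.2.le hK hd
    have h3 : K * (t - s) ^ n ≤ K * h ^ n := by
      have : 0 ≤ t - s := by linarith [hs.2]
      gcongr; linarith [hs.1]
    have h4 : |w t - w s| ≤ |w t| / 2 :=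
      (pow_le_pow_iff_left₀ (abs_nonneg _) (by positivity) (Nat.succ_ne_zero n)).1
        ((h2.trans h3).trans hKh)
    have h5 : |w t| / 2 ≤ |w s| := by
      have := abs_sub_abs_le_abs_sub (w t) (w s); linarith
    have h6 := hs.2.le
    gcongr
  calc ENNReal.ofReal ((|w t| / 2) ^ (n + 1) * Real.exp (-t) * h)
      = ∫⁻ s in Set.Ioo (t - h) t, ENNReal.ofReal ((|w t| / 2) ^ (n + 1) * Real.exp (-t)) := by
        rw [setLIntegral_const, Real.volume_Ioo, ← ENNReal.ofReal_mul (by positivity)]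
        congr 1; ring
    _ ≤ potE n w (Set.Ioo (t - h) t) := setLIntegral_mono' measurableSet_Ioo h1
    _ ≤ N := (potE_mono n w Set.Ioo_subset_Iio_self).trans hN

/-- Uniform decay at `-∞` under unit energies. -/
theorem IsPrim.abs_le_of_exp_lt {w g : ℝ → ℝ} (hw : IsPrim w g) {n : ℕ} (hn : 1 ≤ n) {t δ : ℝ}
    (hD : dirE n g (Set.Iio t) ≤ 1) (hN : potE n w (Set.Iio t) ≤ 1) (hδ : 0 < δ) (hδ1 : δ ≤ 1)
    (ht : Real.exp t < δ ^ (n + 3)) : |w t| ≤ 2 * δ := by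
  by_contra! hlt
  have h1 : δ ^ (n + 1) ≤ (|w t| / 2) ^ (n + 1) := by
    gcongr; linarith
  have h2 := hw.radial n (h := δ ^ 2) (K := 1) (N := 1) zero_le_one
    (by simpa using hD) hN (by
      rw [one_mul, ← pow_mul]
      exact (pow_le_pow_of_le_one hδ.le hδ1 (by omega)).trans h1)
  rw [ENNReal.ofReal_le_one] at h2
  have h3 : δ ^ (n + 1) * Real.exp (-t) * δ ^ 2 ≤ 1 := le_trans (by gcongr) h2
  have h4 : δ ^ (n + 3) * Real.exp (-t) ≤ 1 := by
    rw [show n + 3 = n + 1 + 2 by ring, pow_add]; linarith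
  rw [Real.exp_neg, ← div_eq_mul_inv, div_le_one (Real.exp_pos t)] at h4
  linarith

/-- Uniform bound under unit energies. -/
theorem IsPrim.abs_le_exp {w g : ℝ → ℝ} (hw : IsPrim w g) (n : ℕ) {t : ℝ}
    (hD : dirE n g (Set.Iio t) ≤ 1) (hN : potE n w (Set.Iio t) ≤ 1) :
    |w t| ≤ 2 + 2 * Real.exp t := by
  by_contra! hlt
  have h0 := Real.exp_pos t
  have h2 := hw.radial n (h := 1) (K := 1) (N := 1) zero_le_one
    (by simpa using hD) hN (by
      rw [one_pow, one_mul]; exact one_le_pow₀ (by linarith))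
  rw [ENNReal.ofReal_le_one, mul_one, Real.exp_neg, ← div_eq_mul_inv, div_le_one h0] at h2
  have h3 : |w t| / 2 ≤ (|w t| / 2) ^ (n + 1) := le_self_pow₀ (by linarith) (by omega)
  linarith

theorem exists_root (m : ℕ) (hm : m ≠ 0) {x : ℝ} (hx : 0 ≤ x) : ∃ y : ℝ, 0 ≤ y ∧ y ^ m = x :=
  ⟨x ^ ((m : ℝ)⁻¹), by positivity, Real.rpow_inv_natCast_pow hx hm⟩

theorem rpow_cexp_lt_self {n : ℕ} (hn : 1 ≤ n) {s : ℝ} (h0 : 0 < s) (h1 : s < 1) :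
    s ^ cexp n < s := by
  conv_rhs => rw [← Real.rpow_one s]
  apply Real.rpow_lt_rpow_of_exponent_gt h0 h1
  have : 0 < ((n : ℝ))⁻¹ := by positivity
  unfold cexp; linarith

theorem rpow_cexp_eq_mul (n : ℕ) {s : ℝ} (h0 : 0 < s) : s ^ cexp n = s * s ^ ((n : ℝ)⁻¹) := by
  unfold cexp; rw [Real.rpow_add h0, Real.rpow_one]

theorem one_sub_rpow_inv_ge {n : ℕ} (hn : 1 ≤ n) {s : ℝ} (h0 : 0 ≤ s) :
    (1 - s) / n ≤ 1 - s ^ ((n : ℝ)⁻¹) := by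
  set y := s ^ ((n : ℝ)⁻¹) with hy
  have hy0 : 0 ≤ y := by positivity
  have hyn : y ^ n = s := Real.rpow_inv_natCast_pow h0 (by omega)
  have hb := one_add_mul_sub_le_pow (a := y) (n := n) (by linarith)
  rw [hyn] at hb
  rw [div_le_iff₀ (by positivity)]; nlinarith

theorem self_sub_rpow_cexp_ge {n : ℕ} (hn : 1 ≤ n) {s : ℝ} (h0 : 0 < s) :
    s * ((1 - s) / n) ≤ s - s ^ cexp n := by
  rw [rpow_cexp_eq_mul n h0]
  nlinarith [one_sub_rpow_inv_ge hn h0.le]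

theorem integrableOn_log_profile {n : ℕ} (hn : 1 ≤ n) {c : ℝ} (hc : 1 ≤ c) :
    IntegrableOn (fun s : ℝ => Real.log (s - s ^ cexp n / c)) (Set.Ioo 0 1) := by
  have h1 : IntegrableOn (fun s : ℝ => Real.log s) (Set.Ioo 0 1) :=
    ((intervalIntegrable_iff_integrableOn_Ioo_of_le zero_le_one).1
      intervalIntegral.intervalIntegrable_log')
  have h2 : IntegrableOn (fun s : ℝ => Real.log (1 - s)) (Set.Ioo 0 1) := by
    have := (intervalIntegral.intervalIntegrable_log' (a := 0) (b := 1)).comp_sub_left 1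
    simp only [sub_zero, sub_self] at this
    exact (intervalIntegrable_iff_integrableOn_Ioo_of_le zero_le_one).1 this.symm
  have h3 : IntegrableOn (fun s : ℝ => Real.log n - Real.log s - Real.log (1 - s))
      (Set.Ioo 0 1) :=
    ((integrableOn_const (by simp)).sub h1).sub h2
  refine h3.mono' (Real.measurable_log.comp (measurable_id.sub
    ((measurable_id.pow_const _).div_const _))).aestronglyMeasurable ?_
  filter_upwards [self_mem_ae_restrict measurableSet_Ioo] with s hs
  have hq : 0 ≤ s ^ cexp n := Real.rpow_nonneg hs.1.le _
  have hqc : s ^ cexp n / c ≤ s ^ cexp n := div_le_self hq hc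
  have hqc0 : 0 ≤ s ^ cexp n / c := by positivity
  have hge := self_sub_rpow_cexp_ge hn hs.1
  have hn' : (0 : ℝ) < n := by positivity
  have h1s : 0 < 1 - s := by linarith [hs.2]
  have hs0 := hs.1
  have hpos : 0 < s * ((1 - s) / n) := by positivity
  have hneg : Real.log (s - s ^ cexp n / c) ≤ 0 :=
    Real.log_nonpos (by linarith) (by linarith [hs.2])
  rw [Real.norm_eq_abs, abs_of_nonpos hneg]
  have h4 : Real.log (s * ((1 - s) / n)) ≤ Real.log (s - s ^ cexp n / c) :=
    Real.log_le_log hpos (by linarith)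
  rw [Real.log_mul hs0.ne' (by positivity), Real.log_div h1s.ne' hn'.ne'] at h4
  linarith

/-- The Carleson–Chang level: concentrating sequences have exponential integral at most
`exp (hCC n)`. -/
noncomputable def hCC (n : ℕ) : ℝ :=
  -∫ s in Set.Ioo (0 : ℝ) 1, (Real.log (s - s ^ cexp n) + 1)

theorem integrableOn_hCC {n : ℕ} (hn : 1 ≤ n) :
    IntegrableOn (fun s : ℝ => Real.log (s - s ^ cexp n) + 1) (Set.Ioo 0 1) := by
  have := integrableOn_log_profile hn le_rfl
  simp only [div_one] at this
  exact this.add (integrableOn_const (by simp))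

/-- The tail mass `m t = ∫ t..R ρ` of a positive density of total mass one. -/
theorem tailMass_props {ρ : ℝ → ℝ} (hρ : Continuous ρ) (hpos : ∀ t, 0 < ρ t) {b R : ℝ}
    (h1 : ∫ t in b..R, ρ t = 1) :
    (∀ t, HasDerivAt (fun t => ∫ s in t..R, ρ s) (-ρ t) t) ∧
    StrictAnti (fun t => ∫ s in t..R, ρ s) ∧
    (fun t => ∫ s in t..R, ρ s) '' Set.Ioo b R = Set.Ioo 0 1 := by
  have hd : ∀ t, HasDerivAt (fun t => ∫ s in t..R, ρ s) (-ρ t) t := fun t =>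
    intervalIntegral.integral_hasDerivAt_left (hρ.intervalIntegrable _ _)
      (hρ.stronglyMeasurableAtFilter _ _) hρ.continuousAt
  have ha : StrictAnti (fun t => ∫ s in t..R, ρ s) :=
    strictAnti_of_hasDerivAt_neg hd fun t => by linarith [hpos t]
  refine ⟨hd, ha, ?_⟩
  have hbR : b < R := by
    by_contra! hle
    have := intervalIntegral.integral_nonneg (μ := volume) hle fun t _ => (hpos t).le
    rw [intervalIntegral.integral_symm] at this; linarith
  have hc : Continuous (fun t => ∫ s in t..R, ρ s) :=
    continuous_iff_continuousAt.2 fun t => (hd t).continuousAt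
  apply Set.Subset.antisymm
  · rintro _ ⟨t, ht, rfl⟩
    have e1 := ha ht.1
    have e2 := ha ht.2
    simp only [h1, intervalIntegral.integral_same] at e1 e2
    exact ⟨e2, e1⟩
  · have := intermediate_value_Ioo' hbR.le hc.continuousOn
    simpa only [h1, intervalIntegral.integral_same] using this

/-- The transport form of the sharp one-dimensional entropy inequality. -/
theorem neg_hCC_le_integral {n : ℕ} (hn : 1 ≤ n) {ρ : ℝ → ℝ} (hρ : Continuous ρ)
    (hpos : ∀ t, 0 < ρ t) {b R : ℝ} (hbR : b ≤ R) (h1 : ∫ t in b..R, ρ t = 1) :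
    -hCC n ≤ ∫ t in b..R, (ρ t * Real.log (ρ t) + (∫ s in t..R, ρ s) -
      (∫ s in t..R, ρ s) ^ cexp n) := by
  obtain ⟨hd, ha, him⟩ := tailMass_props hρ hpos h1
  set m := fun t => ∫ s in t..R, ρ s with hm
  have hc : Continuous m := continuous_iff_continuousAt.2 fun t => (hd t).continuousAt
  have e1 := integral_image_eq_integral_abs_deriv_smul measurableSet_Ioo
    (fun t _ => (hd t).hasDerivWithinAt) (ha.injective.injOn (s := Set.Ioo b R))
    (fun s : ℝ => Real.log (s - s ^ cexp n) + 1)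
  have i1 := (integrableOn_image_iff_integrableOn_abs_deriv_smul measurableSet_Ioo
    (fun t _ => (hd t).hasDerivWithinAt) (ha.injective.injOn (s := Set.Ioo b R))
    (fun s : ℝ => Real.log (s - s ^ cexp n) + 1)).1 (by
      rw [him]; exact integrableOn_hCC hn)
  change ∫ x in m '' _, _ = _ at e1
  rw [him] at e1
  rw [hCC, neg_neg, e1, intervalIntegral.integral_of_le hbR, ← integral_Ioc_eq_integral_Ioo]
  have hq : Continuous (fun t => m t ^ cexp n) :=
    hc.rpow_const fun t => Or.inr (cexp_pos n).le
  have hl : Continuous (fun t => ρ t * Real.log (ρ t)) :=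
    hρ.mul (hρ.log fun t => (hpos t).ne')
  refine setIntegral_mono_on_ae ?_ ?_ measurableSet_Ioc ?_
  · exact i1.congr_set_ae Ioo_ae_eq_Ioc.symm
  · exact ((hl.add hc).sub hq).integrableOn_Ioc
  have hne : ∀ᵐ t : ℝ, t ≠ R := by simp [ae_iff]
  filter_upwards [hne] with t htR ht
  have hmem : m t ∈ Set.Ioo (0 : ℝ) 1 := by
    rw [← him]; exact ⟨t, ⟨ht.1, lt_of_le_of_ne ht.2 htR⟩, rfl⟩
  have hx0 : 0 < m t - m t ^ cexp n := by linarith [rpow_cexp_lt_self hn hmem.1 hmem.2]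
  set x0 := m t - m t ^ cexp n with hx0d
  have hp := hpos t
  have key : Real.log (x0 / ρ t) ≤ x0 / ρ t - 1 := Real.log_le_sub_one_of_pos (by positivity)
  rw [Real.log_div hx0.ne' hp.ne'] at key
  have k2 := mul_le_mul_of_nonneg_left key hp.le
  have k3 : ρ t * (x0 / ρ t - 1) = x0 - ρ t := by field_simp
  rw [k3] at k2
  rw [abs_neg, abs_of_pos hp, smul_eq_mul, add_sub_assoc]
  nlinarith

/-- A quadratic upper bound for `y ↦ y ^ q` around `x`. -/
theorem rpow_le_quadratic {q x y : ℝ} (h1 : 1 ≤ q) (h2 : q ≤ 2) (hx : 0 < x) (hy : 0 ≤ y) :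
    y ^ q ≤ x ^ q + q * x ^ (q - 1) * (y - x) + x ^ (q - 2) * (y - x) ^ 2 := by
  have hz : -1 ≤ y / x - 1 := by
    have : 0 ≤ y / x := by positivity
    linarith
  have hb := rpow_one_add_le_one_add_mul_self hz (p := q - 1) (by linarith) (by linarith)
  rw [add_sub_cancel, Real.div_rpow hy hx.le, div_le_iff₀ (by positivity)] at hb
  have e1 : y ^ q = y * y ^ (q - 1) := by
    rcases hy.eq_or_lt with rfl | hy
    · rw [Real.zero_rpow (by linarith), zero_mul]
    · rw [Real.rpow_sub_one hy.ne']; field_simp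
  have e2 : x ^ q = x ^ (q - 2) * x ^ 2 := by
    rw [← Real.rpow_natCast x 2, ← Real.rpow_add hx]; norm_num
  have e3 : x ^ (q - 1) = x ^ (q - 2) * x := by
    rw [← Real.rpow_add_one hx.ne']; congr 1; ring
  have hc : 0 ≤ x ^ (q - 2) := by positivity
  have h4 : y * y ^ (q - 1) ≤ y * ((1 + (q - 1) * (y / x - 1)) * x ^ (q - 1)) :=
    mul_le_mul_of_nonneg_left hb hy
  have h5 : y * ((1 + (q - 1) * (y / x - 1)) * x ^ (q - 1)) =
      x ^ (q - 2) * (y * (x + (q - 1) * (y - x))) := by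
    rw [e3]; field_simp
  have h6 : y * (x + (q - 1) * (y - x)) ≤ x ^ 2 + q * x * (y - x) + (y - x) ^ 2 := by
    nlinarith [sq_nonneg (y - x)]
  rw [e1, e2, e3]
  nlinarith [mul_le_mul_of_nonneg_left h6 hc]

/-- A tangent-line lower bound for `y ↦ y ^ q` at `x`. -/
theorem tangent_le_rpow {q x y : ℝ} (h1 : 1 ≤ q) (hx : 0 < x) (hy : 0 ≤ y) :
    x ^ q + q * x ^ (q - 1) * (y - x) ≤ y ^ q := by
  have hz : -1 ≤ y / x - 1 := by
    have : 0 ≤ y / x := by positivity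
    linarith
  have hb := one_add_mul_self_le_rpow_one_add hz h1
  rw [add_sub_cancel, Real.div_rpow hy hx.le, le_div_iff₀ (by positivity)] at hb
  refine le_trans (le_of_eq ?_) hb
  rw [Real.rpow_sub_one hx.ne']; field_simp

theorem IsPrim.ae_hasDerivAt {w g : ℝ → ℝ} (h : IsPrim w g) : ∀ᵐ t, HasDerivAt w (g t) t := by
  filter_upwards [LocallyIntegrable.ae_hasDerivAt_integral h.locallyIntegrable] with t ht
  have : w = fun b => w 0 + ∫ t in (0 : ℝ)..b, g t := by
    funext b; rw [← h.ftc]; ring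
  rw [this]; exact (ht 0).const_add (w 0)

theorem IsPrim.absolutelyContinuous {w g : ℝ → ℝ} (h : IsPrim w g) (a b : ℝ) :
    AbsolutelyContinuousOnInterval w a b := by
  have : w = fun x => w a + ∫ t in a..x, g t := by
    funext b; rw [← h.ftc]; ring
  rw [this]
  refine AbsolutelyContinuousOnInterval.add
    (LipschitzOnWith.absolutelyContinuousOnInterval (K := 0) (by simp [LipschitzOnWith])) ?_
  exact (h.int a b).absolutelyContinuousOnInterval_intervalIntegral (by simp)

/-- Integration by parts. -/
theorem IsPrim.integral_mul {v g m r : ℝ → ℝ} (hv : IsPrim v g) (hm : IsPrim m r) (a b : ℝ) :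
    ∫ t in a..b, v t * r t = v b * m b - v a * m a - ∫ t in a..b, g t * m t := by
  have h := AbsolutelyContinuousOnInterval.integral_mul_deriv_eq_deriv_mul
    (hv.absolutelyContinuous a b) (hm.absolutelyContinuous a b)
  have e1 : ∫ t in a..b, v t * deriv m t = ∫ t in a..b, v t * r t :=
    intervalIntegral.integral_congr_ae (by
      filter_upwards [hm.ae_hasDerivAt] with t ht _; rw [ht.deriv])
  have e2 : ∫ t in a..b, deriv v t * m t = ∫ t in a..b, g t * m t :=
    intervalIntegral.integral_congr_ae (by
      filter_upwards [hv.ae_hasDerivAt] with t ht _; rw [ht.deriv])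
  rw [← e1, ← e2, h]

theorem isPrim_of_hasDerivAt {m r : ℝ → ℝ} (hr : Continuous r) (h : ∀ t, HasDerivAt m (r t) t) :
    IsPrim m r :=
  ⟨fun _ _ => hr.intervalIntegrable _ _, fun a b =>
    (intervalIntegral.integral_eq_sub_of_hasDerivAt (fun t _ => h t)
      (hr.intervalIntegrable a b)).symm⟩

/-- Monotone profiles on the half line with unit energy. -/
structure UnitProfile (n : ℕ) (v g : ℝ → ℝ) : Prop where
  one_le : 1 ≤ n
  prim : IsPrim v g
  nonneg : ∀ t, 0 ≤ g t
  zero : v 0 = 0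
  energy : dirE n g (Set.Ioi 0) ≤ 1

/-- The deficit `t - v ^ q`. -/
noncomputable def deficit (n : ℕ) (v : ℝ → ℝ) (t : ℝ) : ℝ := t - |v t| ^ cexp n

namespace UnitProfile

variable {n : ℕ} {v g : ℝ → ℝ}

theorem mono (h : UnitProfile n v g) : Monotone v := fun a b hab => by
  have := intervalIntegral.integral_nonneg (μ := volume) hab fun t _ => h.nonneg t
  rw [← h.prim.ftc] at this; linarith

theorem nonneg_of_nonneg (h : UnitProfile n v g) {t : ℝ} (ht : 0 ≤ t) : 0 ≤ v t := by
  rw [← h.zero]; exact h.mono ht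

theorem continuous_deficit (h : UnitProfile n v g) : Continuous (deficit n v) :=
  continuous_id.sub (h.prim.continuous.abs.rpow_const fun _ => Or.inr (cexp_pos n).le)

theorem exists_tail (h : UnitProfile n v g) {t : ℝ} (ht : 0 ≤ t) :
    ∃ E : ℝ, 0 ≤ E ∧ E ≤ 1 ∧ v t ^ (n + 1) ≤ (1 - E) * t ^ n ∧
      ∀ s, t ≤ s → (v s - v t) ^ (n + 1) ≤ E * (s - t) ^ n := by
  have hsplit : dirE n g (Set.Ioc 0 t) + dirE n g (Set.Ioi t) = dirE n g (Set.Ioi 0) := by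
    rw [← Set.Ioc_union_Ioi_eq_Ioi ht]
    exact (lintegral_union measurableSet_Ioi (Set.Ioc_disjoint_Ioi le_rfl)).symm
  have hle := h.energy
  rw [← hsplit] at hle
  have f1 : dirE n g (Set.Ioc 0 t) ≠ ⊤ :=
    ne_top_of_le_ne_top one_ne_top (le_self_add.trans hle)
  have f2 : dirE n g (Set.Ioi t) ≠ ⊤ :=
    ne_top_of_le_ne_top one_ne_top (le_add_self.trans hle)
  have hr := ENNReal.toReal_mono one_ne_top hle
  rw [ENNReal.toReal_add f1 f2, ENNReal.toReal_one] at hr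
  have n1 : 0 ≤ (dirE n g (Set.Ioc 0 t)).toReal := ENNReal.toReal_nonneg
  have n2 : 0 ≤ (dirE n g (Set.Ioi t)).toReal := ENNReal.toReal_nonneg
  refine ⟨(dirE n g (Set.Ioi t)).toReal, n2, by linarith, ?_, fun s hs => ?_⟩
  · have := h.prim.abs_sub_pow_le n ht n1 (by rw [ENNReal.ofReal_toReal f1])
    rw [h.zero, sub_zero, sub_zero, abs_of_nonneg (h.nonneg_of_nonneg ht)] at this
    refine this.trans ?_
    gcongr; linarith
  · have := h.prim.abs_sub_pow_le n hs n2 (by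
      rw [ENNReal.ofReal_toReal f2]; exact dirE_mono n g Set.Ioc_subset_Ioi_self)
    rwa [abs_of_nonneg (by linarith [h.mono hs])] at this

theorem deficit_nonneg (h : UnitProfile n v g) {t : ℝ} (ht : 0 ≤ t) : 0 ≤ deficit n v t := by
  obtain ⟨E, hE0, hE1, h1, -⟩ := h.exists_tail ht
  have := rpow_cexp_le_of_pow_le h.one_le (abs_nonneg (v t)) ht (by
    rw [abs_of_nonneg (h.nonneg_of_nonneg ht)]
    refine h1.trans ?_
    have : 0 ≤ t ^ n := by positivity
    nlinarith)
  unfold deficit; linarith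

theorem exists_tail_deficit (h : UnitProfile n v g) {t : ℝ} (ht : 0 < t) :
    ∃ E : ℝ, 0 ≤ E ∧ t * E ≤ n * deficit n v t ∧
      ∀ s, t ≤ s → (v s - v t) ^ (n + 1) ≤ E * (s - t) ^ n := by
  obtain ⟨E, hE0, hE1, h1, h2⟩ := h.exists_tail ht.le
  refine ⟨E, hE0, ?_, h2⟩
  have hV : (|v t| ^ cexp n) ^ n = v t ^ (n + 1) := by
    rw [rpow_cexp_pow h.one_le (abs_nonneg _), abs_of_nonneg (h.nonneg_of_nonneg ht.le)]
  have hz : 0 ≤ |v t| ^ cexp n / t := by positivity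
  have hb := one_add_mul_sub_le_pow (a := |v t| ^ cexp n / t) (n := n) (by linarith)
  rw [div_pow, hV] at hb
  have h3 : v t ^ (n + 1) / t ^ n ≤ 1 - E := by
    rw [div_le_iff₀ (by positivity)]; exact h1
  have h4 : E ≤ n * (1 - |v t| ^ cexp n / t) := by linarith
  calc t * E ≤ t * (n * (1 - |v t| ^ cexp n / t)) := by gcongr
    _ = n * deficit n v t := by unfold deficit; field_simp

/-- The deficit grows at least linearly to the right of a point where it is relatively small. -/
theorem two_point (h : UnitProfile n v g) {t s : ℝ} (ht : 0 < t) (hts : t ≤ s)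
    (hsm : 2 ^ (n + 2) * deficit n v t ≤ t) :
    n * (s - t) ≤ 4 * (n + 1) * deficit n v s + 2 ^ (n + 2) * n * deficit n v t := by
  obtain ⟨E, hE0, hE1, hE2⟩ := h.exists_tail_deficit ht
  have hs : 0 < s := by linarith
  obtain ⟨σ, hσ0, hσ⟩ := exists_root (n + 1) (by omega) hs.le
  obtain ⟨y, hy0, hy⟩ := exists_root n (by have := h.one_le; omega) (h.nonneg_of_nonneg ht.le)
  obtain ⟨e, he0, he⟩ := exists_root (n + 1) (by omega) hE0
  obtain ⟨k, hk0, hk⟩ := exists_root (n + 1) (by omega) (show 0 ≤ (s - t) / 2 by linarith)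
  have hdt := h.deficit_nonneg ht.le
  have hn : (1 : ℝ) ≤ n := by exact_mod_cast h.one_le
  have c1 : s - deficit n v s ≤ v s * σ := by
    have hV : s - deficit n v s = |v s| ^ cexp n := by unfold deficit; ring
    have hds := h.deficit_nonneg hs.le
    have hvs := h.nonneg_of_nonneg hs.le
    rw [hV]
    refine (pow_le_pow_iff_left₀ (by positivity) (by positivity) (Nat.succ_ne_zero n)).1 ?_
    rw [Nat.succ_eq_add_one, mul_pow, hσ, pow_succ, rpow_cexp_pow h.one_le (abs_nonneg _),
      abs_of_nonneg hvs]
    have : v s ^ cexp n ≤ s := by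
      rw [abs_of_nonneg hvs] at hV; linarith
    gcongr
  have c2 : (n + 1) * (v t * σ) ≤ s + n * t := by
    have := young_pow n hσ0 hy0
    rw [hy, hσ] at this
    have h2 : y ^ (n + 1) ≤ t := by
      rw [← pow_rpow_cexp h.one_le hy0, hy]
      have : deficit n v t = t - v t ^ cexp n := by
        unfold deficit; rw [abs_of_nonneg (h.nonneg_of_nonneg ht.le)]
      linarith
    nlinarith
  have c3 : (n + 1) * ((v s - v t) * σ) ≤ 2 ^ n * (s * E) + n * ((s - t) / 2) := by
    obtain ⟨z, hz0, hz⟩ := exists_root (n + 1) (by omega) (show (0 : ℝ) ≤ 2 ^ n by positivity)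
    have h2 : v s - v t ≤ z * e * k ^ n := by
      refine (pow_le_pow_iff_left₀ (by linarith [h.mono hts]) (by positivity)
        (Nat.succ_ne_zero n)).1 ((hE2 s hts).trans (le_of_eq ?_))
      rw [Nat.succ_eq_add_one, mul_pow, mul_pow, hz, he, ← pow_mul, mul_comm n, pow_mul, hk,
        div_pow]
      field_simp
    have := young_pow n (show 0 ≤ σ * z * e by positivity) hk0
    rw [mul_pow, mul_pow, hσ, hz, he, hk] at this
    have h5 : (v s - v t) * σ ≤ z * e * k ^ n * σ := by gcongr
    nlinarith
  have hp : (0 : ℝ) < 2 ^ n := by positivity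
  have hp2 : (2 : ℝ) ^ (n + 2) = 2 ^ n * 4 := by rw [pow_add]; norm_num
  rw [hp2] at hsm ⊢
  have h6 : 2 ^ n * ((s - t) * E) ≤ n * (s - t) / 4 := by
    have : t * (2 ^ n * 4 * E) ≤ t * n := by nlinarith
    have h7 : 2 ^ n * 4 * E ≤ n := le_of_mul_le_mul_left this ht
    nlinarith
  nlinarith
end UnitProfile

theorem integral_exp_neg_abs_le {b R t₁ k : ℝ} (hk : 0 < k) (h1 : b ≤ t₁) (h2 : t₁ ≤ R) :
    ∫ t in b..R, Real.exp (-(|t - t₁| / k)) ≤ 2 * k := by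
  have hc : Continuous fun t : ℝ => Real.exp (-(|t - t₁| / k)) := by fun_prop
  rw [← intervalIntegral.integral_add_adjacent_intervals (hc.intervalIntegrable b t₁)
    (hc.intervalIntegrable t₁ R)]
  have e1 : ∫ t in b..t₁, Real.exp (-(|t - t₁| / k)) = k - k * Real.exp ((b - t₁) / k) := by
    have hd : ∀ t : ℝ, HasDerivAt (fun t => k * Real.exp ((t - t₁) / k))
        (Real.exp ((t - t₁) / k)) t := fun t => by
      have := ((((hasDerivAt_id t).sub_const t₁).div_const k).exp).const_mul k
      exact this.congr_deriv (by field_simp; rfl)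
    rw [intervalIntegral.integral_congr (g := fun t => Real.exp ((t - t₁) / k)),
      intervalIntegral.integral_eq_sub_of_hasDerivAt (fun t _ => hd t)
        ((by fun_prop : Continuous fun t : ℝ => Real.exp ((t - t₁) / k)).intervalIntegrable _ _)]
    · simp
    · intro t ht
      rw [Set.uIcc_of_le h1] at ht
      simp only; rw [abs_of_nonpos (by linarith [ht.2])]; congr 1; ring
  have e2 : ∫ t in t₁..R, Real.exp (-(|t - t₁| / k)) = k - k * Real.exp (-(R - t₁) / k) := by
    have hd : ∀ t : ℝ, HasDerivAt (fun t => -(k * Real.exp (-(t - t₁) / k)))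
        (Real.exp (-(t - t₁) / k)) t := fun t => by
      have := (((((hasDerivAt_id t).sub_const t₁).neg.div_const k).exp).const_mul k).neg
      exact this.congr_deriv (by field_simp; rw [← neg_div]; rfl)
    rw [intervalIntegral.integral_congr (g := fun t => Real.exp (-(t - t₁) / k)),
      intervalIntegral.integral_eq_sub_of_hasDerivAt (fun t _ => hd t)
        ((by fun_prop : Continuous fun t : ℝ => Real.exp (-(t - t₁) / k)).intervalIntegrable _ _)]
    · simp; ring
    · intro t ht
      rw [Set.uIcc_of_le h2] at ht
      simp only; rw [abs_of_nonneg (by linarith [ht.1])]; congr 1; ring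
  rw [e1, e2]
  have := Real.exp_pos ((b - t₁) / k)
  have := Real.exp_pos (-(R - t₁) / k)
  nlinarith

theorem sq_mul_exp_neg_le {x : ℝ} (hx : 0 ≤ x) :
    x ^ 2 * Real.exp (-x) ≤ 8 * Real.exp (-(x / 2)) := by
  have h1 := Real.quadratic_le_exp_of_nonneg (show 0 ≤ x / 2 by linarith)
  have h2 : Real.exp (-x) = Real.exp (-(x / 2)) * Real.exp (-(x / 2)) := by
    rw [← Real.exp_add]; congr 1; ring
  have h3 : Real.exp (x / 2) * Real.exp (-(x / 2)) = 1 := by rw [← Real.exp_add]; simp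
  have h4 := Real.exp_pos (-(x / 2))
  have h5 : x ^ 2 ≤ 8 * Real.exp (x / 2) := by nlinarith
  rw [h2]
  calc x ^ 2 * (Real.exp (-(x / 2)) * Real.exp (-(x / 2)))
      ≤ 8 * Real.exp (x / 2) * (Real.exp (-(x / 2)) * Real.exp (-(x / 2))) := by gcongr
    _ = 8 * (Real.exp (x / 2) * Real.exp (-(x / 2))) * Real.exp (-(x / 2)) := by ring
    _ = _ := by rw [h3, mul_one]

namespace UnitProfile

variable {n : ℕ} {v g : ℝ → ℝ}

theorem mean_rpow_le (h : UnitProfile n v g) {b R : ℝ} (hb : 0 < b) (hbR : b ≤ R) {m : ℝ → ℝ}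
    (hm : Continuous m) (hm0 : ∀ t ∈ Set.Icc b R, 0 ≤ m t) :
    (v b + ∫ t in b..R, g t * m t) ^ cexp n ≤ b + ∫ t in b..R, m t ^ cexp n := by
  have hn : n ≠ 0 := by have := h.one_le; omega
  have hmq : Continuous fun t => m t ^ cexp n := hm.rpow_const fun _ => Or.inr (cexp_pos n).le
  have hI0 : 0 ≤ ∫ t in b..R, m t ^ cexp n :=
    intervalIntegral.integral_nonneg hbR fun t ht => Real.rpow_nonneg (hm0 t ht) _
  set A := b + ∫ t in b..R, m t ^ cexp n with hA
  have hA0 : 0 < A := by linarith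
  obtain ⟨z, hz0, hz⟩ := exists_root (n + 1) (by omega) (show 0 ≤ 1 / A by positivity)
  have hx0 : 0 ≤ v b + ∫ t in b..R, g t * m t :=
    add_nonneg (h.nonneg_of_nonneg hb.le) (intervalIntegral.integral_nonneg hbR
      fun t ht => mul_nonneg (h.nonneg t) (hm0 t ht))
  set x := v b + ∫ t in b..R, g t * m t with hx
  have hpI : IntegrableOn (fun t => |g t| ^ (n + 1)) (Set.Ioi 0) :=
    integrableOn_abs_pow n h.prim.aestronglyMeasurable.restrict
      (ne_top_of_le_ne_top one_ne_top h.energy)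
  have hpi : ∀ a c : ℝ, 0 ≤ a → a ≤ c → IntervalIntegrable (fun t => |g t| ^ (n + 1)) volume a c :=
    fun a c ha hac => (intervalIntegrable_iff_integrableOn_Ioc_of_le hac).2
      (hpI.mono_set fun t ht => lt_of_le_of_lt ha ht.1)
  have e0 : (∫ t in (0 : ℝ)..b, |g t| ^ (n + 1)) + ∫ t in b..R, |g t| ^ (n + 1) ≤ 1 := by
    rw [intervalIntegral.integral_add_adjacent_intervals (hpi 0 b le_rfl hb.le)
      (hpi b R hb.le hbR), intervalIntegral.integral_of_le (hb.le.trans hbR)]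
    exact integral_abs_pow_le n zero_le_one
      ((dirE_mono n g Set.Ioc_subset_Ioi_self).trans (by simpa using h.energy))
  have e1 : (n + 1) * (v b * z ^ n) ≤
      (∫ t in (0 : ℝ)..b, |g t| ^ (n + 1)) + n * z ^ (n + 1) * b := by
    have h1 : ∫ t in (0 : ℝ)..b, (n + 1) * (|g t| * z ^ n) ≤
        ∫ t in (0 : ℝ)..b, (|g t| ^ (n + 1) + n * z ^ (n + 1)) :=
      intervalIntegral.integral_mono_on hb.le (((h.prim.int _ _).abs.mul_const _).const_mul _)
        ((hpi 0 b le_rfl hb.le).add (by simp)) fun t _ => young_pow n (abs_nonneg _) hz0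
    rw [intervalIntegral.integral_add (hpi 0 b le_rfl hb.le) (by simp),
      intervalIntegral.integral_const_mul,
      intervalIntegral.integral_mul_const, intervalIntegral.integral_const, smul_eq_mul,
      intervalIntegral.integral_congr (g := g) (fun t _ => abs_of_nonneg (h.nonneg t)),
      ← h.prim.ftc, h.zero] at h1
    simp only [sub_zero] at h1
    linarith
  have hgm : IntervalIntegrable (fun t => g t * m t) volume b R :=
    (h.prim.int b R).mul_continuousOn hm.continuousOn
  have e2 : (n + 1) * ((∫ t in b..R, g t * m t) * z ^ n) ≤
      (∫ t in b..R, |g t| ^ (n + 1)) + n * z ^ (n + 1) * ∫ t in b..R, m t ^ cexp n := by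
    have h1 : ∫ t in b..R, (n + 1) * (g t * m t * z ^ n) ≤
        ∫ t in b..R, (|g t| ^ (n + 1) + n * z ^ (n + 1) * m t ^ cexp n) := by
      refine intervalIntegral.integral_mono_on hbR ((hgm.mul_const _).const_mul _)
        ((hpi b R hb.le hbR).add ((hmq.intervalIntegrable _ _).const_mul _)) fun t ht => ?_
      obtain ⟨c, hc0, hc⟩ := exists_root n hn (hm0 t ht)
      have := young_pow n (abs_nonneg (g t)) (mul_nonneg hc0 hz0)
      rw [mul_pow, hc, mul_pow, ← pow_rpow_cexp h.one_le hc0, hc,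
        abs_of_nonneg (h.nonneg t)] at this
      rw [abs_of_nonneg (h.nonneg t)]
      linarith
    rw [intervalIntegral.integral_add (hpi b R hb.le hbR)
        ((hmq.intervalIntegrable _ _).const_mul _), intervalIntegral.integral_const_mul,
      intervalIntegral.integral_mul_const, intervalIntegral.integral_const_mul] at h1
    linarith
  have e3 : (n + 1) * (x * z ^ n) ≤ 1 + n * (z ^ (n + 1) * A) := by
    rw [hx, hA]; nlinarith
  rw [hz, one_div, inv_mul_cancel₀ hA0.ne'] at e3
  have e4 : x * z ^ n ≤ 1 := by
    have : (0 : ℝ) < n + 1 := by positivity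
    nlinarith
  apply rpow_cexp_le_of_pow_le h.one_le hx0 hA0.le
  have e5 := pow_le_one₀ (n := n + 1) (by positivity) e4
  rw [mul_pow, ← pow_mul, mul_comm n, pow_mul, hz, div_pow, one_pow, mul_one_div,
    div_le_one (by positivity)] at e5
  exact e5

/-- A minimizer of the deficit controls distances and increments. -/
theorem exists_center (h : UnitProfile n v g) {b R : ℝ} (hb : 0 < b) (hbR : b ≤ R)
    (hsm : 2 ^ (n + 2) * deficit n v b ≤ b) {y : ℝ} (hy0 : 0 ≤ y) (hy : y ^ n = v b) :
    ∃ t₁ ∈ Set.Icc b R, ∀ t ∈ Set.Icc b R, |t - t₁| ≤ (8 + 2 ^ (n + 3)) * deficit n v t ∧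
      |v t - v t₁| * y ≤ 3 * n * (8 + 2 ^ (n + 3)) * deficit n v t := by
  have hn : (1 : ℝ) ≤ n := by exact_mod_cast h.one_le
  obtain ⟨t₁, ht₁, hmin⟩ := isCompact_Icc.exists_isMinOn ⟨b, Set.left_mem_Icc.2 hbR⟩
    h.continuous_deficit.continuousOn
  have hd0 : ∀ t ∈ Set.Icc b R, 0 ≤ deficit n v t := fun t ht =>
    h.deficit_nonneg (hb.le.trans ht.1)
  have hm : ∀ t ∈ Set.Icc b R, deficit n v t₁ ≤ deficit n v t := fun t ht => hmin ht
  have hp : (0 : ℝ) < 2 ^ n := by positivity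
  have hp1 : (1 : ℝ) ≤ 2 ^ n := one_le_pow₀ (by norm_num)
  have hp2 : (2 : ℝ) ^ (n + 2) = 2 ^ n * 4 := by rw [pow_add]; norm_num
  have hp3 : (2 : ℝ) ^ (n + 3) = 2 ^ n * 8 := by rw [pow_add]; norm_num
  have hdb := hm b (Set.left_mem_Icc.2 hbR)
  have h3b : t₁ ≤ 3 * b := by
    have h1 := h.two_point hb ht₁.1 hsm
    have h2 : deficit n v b ≤ b / 8 := by
      have := hd0 b (Set.left_mem_Icc.2 hbR)
      have : 8 * deficit n v b ≤ 2 ^ (n + 2) * deficit n v b := by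
        gcongr
        calc (8 : ℝ) = 2 ^ 3 := by norm_num
          _ ≤ 2 ^ (n + 2) := pow_le_pow_right₀ (by norm_num) (by have := h.one_le; omega)
      linarith
    have h3 : n * (t₁ - b) ≤ n * (2 * b) := by nlinarith
    have := le_of_mul_le_mul_left h3 (by linarith)
    linarith
  have hsm1 : 2 ^ (n + 2) * deficit n v t₁ ≤ t₁ := by
    have : 2 ^ (n + 2) * deficit n v t₁ ≤ 2 ^ (n + 2) * deficit n v b := by gcongr
    linarith [ht₁.1]
  have hdist : ∀ t ∈ Set.Icc b R, |t - t₁| ≤ (8 + 2 ^ (n + 3)) * deficit n v t := by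
    intro t ht
    have hmt := hm t ht
    have ht0 := hd0 t ht
    rcases le_total t₁ t with hle | hle
    · rw [abs_of_nonneg (by linarith)]
      have h1 := h.two_point (hb.trans_le ht₁.1) hle hsm1
      have h2 : n * (t - t₁) ≤ n * ((8 + 2 ^ (n + 3)) * deficit n v t) := by
        rw [hp2] at h1; rw [hp3]
        have h3 : 2 ^ n * 4 * n * deficit n v t₁ ≤ 2 ^ n * 4 * n * deficit n v t := by gcongr
        have h4 : 0 ≤ 2 ^ n * 4 * n * deficit n v t := by positivity
        nlinarith
      exact le_of_mul_le_mul_left h2 (by linarith)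
    · rw [abs_of_nonpos (by linarith), neg_sub]
      by_cases hc : 2 ^ (n + 2) * deficit n v t ≤ t
      · have h1 := h.two_point (hb.trans_le ht.1) hle hc
        have h2 : n * (t₁ - t) ≤ n * ((8 + 2 ^ (n + 3)) * deficit n v t) := by
          rw [hp2] at h1; rw [hp3]
          have h4 : 0 ≤ 2 ^ n * 4 * n * deficit n v t := by positivity
          nlinarith
        exact le_of_mul_le_mul_left h2 (by linarith)
      · push Not at hc
        rw [hp2] at hc; rw [hp3]
        nlinarith [ht.1]
  refine ⟨t₁, ht₁, fun t ht => ⟨hdist t ht, ?_⟩⟩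
  have ht0 := hd0 t ht
  have hC : (1 : ℝ) ≤ 8 + 2 ^ (n + 3) := by rw [hp3]; linarith
  set C : ℝ := 8 + 2 ^ (n + 3) with hCd
  have hyb : y ^ (n + 1) ≤ b := by
    rw [← pow_rpow_cexp h.one_le hy0, hy]
    have := hd0 b (Set.left_mem_Icc.2 hbR)
    have e : deficit n v b = b - v b ^ cexp n := by
      unfold deficit; rw [abs_of_nonneg (h.nonneg_of_nonneg hb.le)]
    linarith
  have key : ∃ E, 0 ≤ E ∧ b * E ≤ 3 * n * deficit n v t ∧
      |v t - v t₁| ^ (n + 1) ≤ E * |t - t₁| ^ n := by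
    rcases le_total t₁ t with hle | hle
    · obtain ⟨E, hE0, hE1, hE2⟩ := h.exists_tail_deficit (hb.trans_le ht₁.1)
      refine ⟨E, hE0, ?_, ?_⟩
      · have : b * E ≤ t₁ * E := by gcongr; exact ht₁.1
        have : n * deficit n v t₁ ≤ n * deficit n v t := by gcongr; exact hm t ht
        nlinarith
      · rw [abs_of_nonneg (by linarith [h.mono hle]), abs_of_nonneg (by linarith)]
        exact hE2 t hle
    · obtain ⟨E, hE0, hE1, hE2⟩ := h.exists_tail_deficit (hb.trans_le ht.1)
      refine ⟨E, hE0, ?_, ?_⟩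
      · have : b * E ≤ t * E := by gcongr; exact ht.1
        nlinarith [mul_nonneg (zero_le_one.trans hn) ht0]
      · rw [abs_sub_comm, abs_sub_comm t, abs_of_nonneg (by linarith [h.mono hle]),
          abs_of_nonneg (by linarith)]
        exact hE2 t₁ hle
  obtain ⟨E, hE0, hE1, hE2⟩ := key
  refine (pow_le_pow_iff_left₀ (by positivity) (by positivity) (Nat.succ_ne_zero n)).1 ?_
  rw [Nat.succ_eq_add_one]
  calc (|v t - v t₁| * y) ^ (n + 1) = |v t - v t₁| ^ (n + 1) * y ^ (n + 1) := mul_pow _ _ _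
    _ ≤ (E * |t - t₁| ^ n) * b := by gcongr
    _ = b * E * |t - t₁| ^ n := by ring
    _ ≤ (3 * n * deficit n v t) * (C * deficit n v t) ^ n := by gcongr; exact hdist t ht
    _ ≤ (3 * n * C * deficit n v t) * (3 * n * C * deficit n v t) ^ n := by
        have h3n : (1 : ℝ) ≤ 3 * n := by linarith
        have h3 : 3 * n ≤ 3 * n * C := le_mul_of_one_le_right (by linarith) hC
        have h4 : C ≤ 3 * n * C := le_mul_of_one_le_left (by linarith) h3n
        gcongr
    _ = _ := by rw [pow_succ]; ring
end UnitProfile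

/-- The constant in the error term of the Carleson–Chang estimate. -/
noncomputable def cCC (n : ℕ) : ℝ :=
  64 * (8 + 2 ^ (n + 3)) * (3 * n * (8 + 2 ^ (n + 3))) ^ 2

theorem cCC_nonneg (n : ℕ) : 0 ≤ cCC n := by unfold cCC; positivity

namespace UnitProfile

variable {n : ℕ} {v g : ℝ → ℝ}

theorem integral_sq_deficit_le {b R t₁ C : ℝ} (h : UnitProfile n v g) (hb : 0 < b) (hC : 0 < C)
    (ht₁ : t₁ ∈ Set.Icc b R) (hd : ∀ t ∈ Set.Icc b R, |t - t₁| ≤ C * deficit n v t) :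
    ∫ t in b..R, deficit n v t ^ 2 * Real.exp (-deficit n v t) ≤ 32 * C := by
  have hc := h.continuous_deficit
  have h1 : ∫ t in b..R, deficit n v t ^ 2 * Real.exp (-deficit n v t) ≤
      ∫ t in b..R, 8 * Real.exp (-(|t - t₁| / (2 * C))) := by
    refine intervalIntegral.integral_mono_on (ht₁.1.trans ht₁.2)
      ((hc.pow 2).mul hc.neg.rexp |>.intervalIntegrable _ _)
      (Continuous.intervalIntegrable (by fun_prop) _ _) fun t ht => ?_
    refine (sq_mul_exp_neg_le (h.deficit_nonneg (hb.le.trans ht.1))).trans ?_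
    refine mul_le_mul_of_nonneg_left (Real.exp_le_exp.2 (neg_le_neg ?_)) (by norm_num)
    rw [div_le_div_iff₀ (by positivity) (by norm_num)]
    nlinarith [hd t ht]
  rw [intervalIntegral.integral_const_mul] at h1
  have := integral_exp_neg_abs_le (k := 2 * C) (by positivity) ht₁.1 ht₁.2
  linarith

/-- The variance of the profile under a density. -/
theorem integral_rpow_le (h : UnitProfile n v g) {b R : ℝ} (hb : 0 < b) (hbR : b ≤ R)
    (hvb : 0 < v b) {ρ : ℝ → ℝ} (hρ : Continuous ρ) (hpos : ∀ t, 0 < ρ t)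
    (h1 : ∫ t in b..R, ρ t = 1) (a : ℝ) :
    ∫ t in b..R, |v t| ^ cexp n * ρ t ≤ (∫ t in b..R, v t * ρ t) ^ cexp n +
      v b ^ (cexp n - 2) * ∫ t in b..R, (v t - a) ^ 2 * ρ t := by
  have hv := h.prim.continuous
  have hq2 := cexp_le_two h.one_le
  have hq1 := one_le_cexp n
  set x := ∫ t in b..R, v t * ρ t with hx
  have I : ∀ {f : ℝ → ℝ}, Continuous f → IntervalIntegrable f volume b R := fun hf =>
    hf.intervalIntegrable _ _
  have hxb : v b ≤ x := by
    have : ∫ t in b..R, v b * ρ t ≤ x :=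
      intervalIntegral.integral_mono_on hbR (I (by fun_prop)) (I (by fun_prop)) fun t ht => by
        have := h.mono ht.1
        have := (hpos t).le
        gcongr
    rwa [intervalIntegral.integral_const_mul, h1, mul_one] at this
  have hx0 : 0 < x := hvb.trans_le hxb
  have e1 : ∫ t in b..R, |v t| ^ cexp n * ρ t ≤ ∫ t in b..R,
      ((x ^ cexp n - cexp n * x ^ (cexp n - 1) * x) * ρ t +
        cexp n * x ^ (cexp n - 1) * (v t * ρ t) +
        x ^ (cexp n - 2) * ((v t - x) ^ 2 * ρ t)) := by
    refine intervalIntegral.integral_mono_on hbR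
      (I ((hv.abs.rpow_const fun _ => Or.inr (by linarith)).mul hρ))
      (I (by fun_prop)) fun t ht => ?_
    have hvt := h.nonneg_of_nonneg (hb.le.trans ht.1)
    rw [abs_of_nonneg hvt]
    have := mul_le_mul_of_nonneg_right (rpow_le_quadratic hq1 hq2 hx0 hvt) (hpos t).le
    linarith
  rw [intervalIntegral.integral_add (I (by fun_prop)) (I (by fun_prop)),
    intervalIntegral.integral_add (I (by fun_prop)) (I (by fun_prop)),
    intervalIntegral.integral_const_mul, intervalIntegral.integral_const_mul,
    intervalIntegral.integral_const_mul, h1, ← hx] at e1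
  have e2 : ∫ t in b..R, (v t - x) ^ 2 * ρ t ≤ ∫ t in b..R, (v t - a) ^ 2 * ρ t := by
    have : ∫ t in b..R, (v t - a) ^ 2 * ρ t = ∫ t in b..R,
        ((v t - x) ^ 2 * ρ t + 2 * (x - a) * (v t * ρ t) + ((a ^ 2 - x ^ 2)) * ρ t) :=
      intervalIntegral.integral_congr fun t _ => by ring
    rw [this, intervalIntegral.integral_add (I (by fun_prop)) (I (by fun_prop)),
      intervalIntegral.integral_add (I (by fun_prop)) (I (by fun_prop)),
      intervalIntegral.integral_const_mul, intervalIntegral.integral_const_mul, h1, ← hx]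
    nlinarith [sq_nonneg (x - a)]
  have e3 : x ^ (cexp n - 2) ≤ v b ^ (cexp n - 2) :=
    Real.rpow_le_rpow_of_nonpos hvb hxb (by linarith)
  have e4 : 0 ≤ ∫ t in b..R, (v t - x) ^ 2 * ρ t :=
    intervalIntegral.integral_nonneg hbR fun t _ => mul_nonneg (sq_nonneg _) (hpos t).le
  have e5 : x ^ (cexp n - 2) * ∫ t in b..R, (v t - x) ^ 2 * ρ t ≤
      v b ^ (cexp n - 2) * ∫ t in b..R, (v t - a) ^ 2 * ρ t := by gcongr
  linarith

/-- The entropy bound for the exponential integral beyond a point of small deficit. -/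
theorem log_integral_le (h : UnitProfile n v g) {b R : ℝ} (hb : 0 < b) (hbR : b < R)
    (hsm : 2 ^ (n + 2) * deficit n v b ≤ b) {Z : ℝ}
    (hZ : Z = ∫ t in b..R, Real.exp (-deficit n v t)) :
    Real.log Z ≤ hCC n + cCC n / (b * Z) := by
  have hn := h.one_le
  have hc := h.continuous_deficit
  have hf : Continuous fun t => Real.exp (-deficit n v t) := hc.neg.rexp
  have hZ0 : 0 < Z := by
    rw [hZ]
    exact intervalIntegral.intervalIntegral_pos_of_pos (hf.intervalIntegrable _ _)
      (fun t => Real.exp_pos _) hbR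
  set ρ : ℝ → ℝ := fun t => Real.exp (-deficit n v t) / Z with hρd
  have hρ : Continuous ρ := hf.div_const _
  have hpos : ∀ t, 0 < ρ t := fun t => by positivity
  have h1 : ∫ t in b..R, ρ t = 1 := by
    rw [hρd, intervalIntegral.integral_div, ← hZ, div_self hZ0.ne']
  obtain ⟨y, hy0, hy⟩ := exists_root n (by omega) (h.nonneg_of_nonneg hb.le)
  obtain ⟨t₁, ht₁, hcen⟩ := h.exists_center hb hbR.le hsm hy0 hy
  have hdb : 8 * deficit n v b ≤ b := by
    have := h.deficit_nonneg hb.le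
    refine le_trans ?_ hsm
    gcongr
    calc (8 : ℝ) = 2 ^ 3 := by norm_num
      _ ≤ 2 ^ (n + 2) := pow_le_pow_right₀ (by norm_num) (by omega)
  have hyb : b / 2 ≤ y ^ (n + 1) := by
    rw [← pow_rpow_cexp hn hy0, hy]
    have e : deficit n v b = b - v b ^ cexp n := by
      unfold deficit; rw [abs_of_nonneg (h.nonneg_of_nonneg hb.le)]
    linarith
  have hy1 : 0 < y := by
    rcases hy0.eq_or_lt with rfl | hy1
    · rw [zero_pow (by omega)] at hyb; linarith
    · exact hy1
  have hvb : 0 < v b := by rw [← hy]; positivity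
  set C : ℝ := 8 + 2 ^ (n + 3) with hC
  have hC0 : 0 < C := by positivity
  obtain ⟨hd, -, -⟩ := tailMass_props hρ hpos h1
  have hent := neg_hCC_le_integral hn hρ hpos hbR.le h1
  set m := fun t => ∫ s in t..R, ρ s with hmd
  have hmc : Continuous m := continuous_iff_continuousAt.2 fun t => (hd t).continuousAt
  have hmp : IsPrim m (fun t => -ρ t) := isPrim_of_hasDerivAt hρ.neg hd
  have hmb : m b = 1 := h1
  have hmR : m R = 0 := intervalIntegral.integral_same
  have hm0 : ∀ t ∈ Set.Icc b R, 0 ≤ m t := fun t ht =>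
    intervalIntegral.integral_nonneg ht.2 fun s _ => (hpos s).le
  have I : ∀ {f : ℝ → ℝ}, Continuous f → IntervalIntegrable f volume b R := fun hf =>
    hf.intervalIntegrable _ _
  have hv := h.prim.continuous
  have hmq : Continuous fun t => m t ^ cexp n := hmc.rpow_const fun _ => Or.inr (cexp_pos n).le
  have hvq : Continuous fun t => |v t| ^ cexp n :=
    hv.abs.rpow_const fun _ => Or.inr (cexp_pos n).le
  have hl : Continuous fun t => ρ t * Real.log (ρ t) := hρ.mul (hρ.log fun t => (hpos t).ne')
  have p1 : ∫ t in b..R, v t * ρ t = v b + ∫ t in b..R, g t * m t := by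
    have := h.prim.integral_mul hmp b R
    simp only [mul_neg, intervalIntegral.integral_neg, hmb, hmR] at this
    linarith
  have p2 : ∫ t in b..R, t * ρ t = b + ∫ t in b..R, m t := by
    have := (isPrim_of_hasDerivAt (m := fun t => t) continuous_const
      (fun t => hasDerivAt_id t)).integral_mul hmp b R
    simp only [mul_neg, intervalIntegral.integral_neg, hmb, hmR, one_mul] at this
    linarith
  have p3 := h.integral_rpow_le hb hbR.le hvb hρ hpos h1 (v t₁)
  have p4 := h.mean_rpow_le hb hbR.le hmc hm0
  rw [p1] at p3
  have p5 : v b ^ (cexp n - 2) * ∫ t in b..R, (v t - v t₁) ^ 2 * ρ t ≤ cCC n / (b * Z) := by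
    have q1 : ∫ t in b..R, (v t - v t₁) ^ 2 * ρ t ≤ ∫ t in b..R,
        (3 * n * C) ^ 2 / (y ^ 2 * Z) * (deficit n v t ^ 2 * Real.exp (-deficit n v t)) := by
      refine intervalIntegral.integral_mono_on hbR.le (I (by fun_prop))
        (I (continuous_const.mul ((hc.pow 2).mul hf))) fun t ht => ?_
      have h3 := pow_le_pow_left₀ (by positivity) (hcen t ht).2 2
      rw [mul_pow, sq_abs, mul_pow] at h3
      have h4 : (v t - v t₁) ^ 2 ≤ (3 * n * C) ^ 2 * deficit n v t ^ 2 / y ^ 2 := by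
        rw [le_div_iff₀ (by positivity)]; exact h3
      calc (v t - v t₁) ^ 2 * ρ t ≤ (3 * n * C) ^ 2 * deficit n v t ^ 2 / y ^ 2 * ρ t := by
            have := (hpos t).le
            gcongr
        _ = _ := by simp only [hρd]; field_simp
    rw [intervalIntegral.integral_const_mul] at q1
    have q2 := h.integral_sq_deficit_le hb hC0 ht₁ fun t ht => (hcen t ht).1
    have q3 : v b ^ (cexp n - 2) = y ^ (n + 1) / (y ^ n) ^ 2 := by
      rw [Real.rpow_sub hvb, ← hy, pow_rpow_cexp hn hy0]; norm_num
    calc v b ^ (cexp n - 2) * ∫ t in b..R, (v t - v t₁) ^ 2 * ρ t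
        ≤ v b ^ (cexp n - 2) * ((3 * n * C) ^ 2 / (y ^ 2 * Z) * (32 * C)) := by
          refine mul_le_mul_of_nonneg_left (q1.trans ?_) (by positivity)
          gcongr
      _ = 32 * C * (3 * n * C) ^ 2 / (y ^ (n + 1) * Z) := by
          rw [q3]; field_simp; ring
      _ ≤ 32 * C * (3 * n * C) ^ 2 / (b / 2 * Z) := by gcongr
      _ = cCC n / (b * Z) := by unfold cCC; field_simp; ring
  have hvr : Continuous fun t => |v t| ^ cexp n * ρ t := hvq.mul hρ
  have htr : Continuous fun t => t * ρ t := continuous_id.mul hρ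
  have hvt : Continuous fun t => |v t| ^ cexp n * ρ t - t * ρ t := hvr.sub htr
  have hlm : Continuous fun t => ρ t * Real.log (ρ t) + m t := hl.add hmc
  have p6 : ∫ t in b..R, Real.log Z * ρ t = ∫ t in b..R,
      (|v t| ^ cexp n * ρ t - t * ρ t - ρ t * Real.log (ρ t)) := by
    refine intervalIntegral.integral_congr fun t _ => ?_
    have : Real.log (ρ t) = -deficit n v t - Real.log Z := by
      simp only [hρd]; rw [Real.log_div (Real.exp_pos _).ne' hZ0.ne', Real.log_exp]
    simp only [this, deficit]; ring
  rw [intervalIntegral.integral_const_mul, h1, mul_one,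
    intervalIntegral.integral_sub (I hvt) (I hl),
    intervalIntegral.integral_sub (I hvr) (I htr), p2] at p6
  rw [intervalIntegral.integral_sub (I hlm) (I hmq),
    intervalIntegral.integral_add (I hl) (I hmc)] at hent
  linarith

theorem integral_le_of_small (h : UnitProfile n v g) {b R : ℝ} (hb : 0 < b) (hbR : b ≤ R)
    (hsm : 2 ^ (n + 2) * deficit n v b ≤ b) :
    ∫ t in b..R, Real.exp (-deficit n v t) ≤
      Real.exp (hCC n + cCC n * Real.exp (-hCC n) / b) := by
  rcases hbR.eq_or_lt with rfl | hbR
  · rw [intervalIntegral.integral_same]; positivity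
  set Z := ∫ t in b..R, Real.exp (-deficit n v t) with hZ
  have hl := h.log_integral_le hb hbR hsm hZ
  have hC := cCC_nonneg n
  by_contra! hlt
  have h0 : 0 ≤ cCC n * Real.exp (-hCC n) / b := by positivity
  have hZH : Real.exp (hCC n) < Z := lt_of_le_of_lt (Real.exp_le_exp.2 (by linarith)) hlt
  have hZ0 : 0 < Z := (Real.exp_pos _).trans hZH
  rw [← Real.lt_log_iff_exp_lt hZ0] at hlt
  have : cCC n / (b * Z) ≤ cCC n * Real.exp (-hCC n) / b := by
    rw [Real.exp_neg, ← div_eq_mul_inv, div_div]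
    have := Real.exp_pos (hCC n)
    rw [mul_comm (Real.exp (hCC n))]
    gcongr
  linarith

/-- The Carleson–Chang estimate on bounded intervals. -/
theorem integral_exp_neg_deficit_le (h : UnitProfile n v g) {B R : ℝ} (hB : 0 < B) (hBR : B ≤ R) :
    ∫ t in B..R, Real.exp (-deficit n v t) ≤ 2 ^ (n + 2) * Real.exp (-(B / 2 ^ (n + 2))) +
      Real.exp (hCC n + cCC n * Real.exp (-hCC n) / B) := by
  have hc := h.continuous_deficit
  have hf : Continuous fun t => Real.exp (-deficit n v t) := hc.neg.rexp
  set k : ℝ := 2 ^ (n + 2) with hk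
  have hk0 : 0 < k := by positivity
  have far : ∀ b, B ≤ b → (∀ t ∈ Set.Ioo B b, t < k * deficit n v t) →
      ∫ t in B..b, Real.exp (-deficit n v t) ≤ k * Real.exp (-(B / k)) := by
    intro b hBb hlt
    have e1 : ∫ t in B..b, Real.exp (-deficit n v t) ≤ ∫ t in B..b, Real.exp (-(t / k)) := by
      refine intervalIntegral.integral_mono_on_of_le_Ioo hBb (hf.intervalIntegrable _ _)
        (Continuous.intervalIntegrable (by fun_prop) _ _) fun t ht => ?_
      gcongr
      rw [div_le_iff₀ hk0]; linarith [hlt t ht]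
    have hd : ∀ t : ℝ, HasDerivAt (fun t => -(k * Real.exp (-(t / k)))) (Real.exp (-(t / k))) t :=
      fun t => by
        have := (((((hasDerivAt_id t).div_const k).neg).exp).const_mul k).neg
        exact this.congr_deriv (by field_simp; rfl)
    rw [intervalIntegral.integral_eq_sub_of_hasDerivAt (fun t _ => hd t)
      (Continuous.intervalIntegrable (by fun_prop) _ _)] at e1
    have := Real.exp_pos (-(b / k))
    nlinarith
  set S := {t | t ∈ Set.Icc B R ∧ k * deficit n v t ≤ t} with hS
  have hSc : IsCompact S := isCompact_Icc.inter_right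
    (isClosed_le (continuous_const.mul hc) continuous_id)
  by_cases hne : S.Nonempty
  · obtain ⟨b, hbS, hbl⟩ := hSc.exists_isLeast hne
    have hb0 : 0 < b := hB.trans_le hbS.1.1
    rw [← intervalIntegral.integral_add_adjacent_intervals (hf.intervalIntegrable B b)
      (hf.intervalIntegrable b R)]
    refine add_le_add (far b hbS.1.1 fun t ht => ?_)
      ((h.integral_le_of_small hb0 hbS.1.2 hbS.2).trans ?_)
    · by_contra! hle
      have := hbl ⟨⟨ht.1.le, ht.2.le.trans hbS.1.2⟩, hle⟩
      linarith [ht.2]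
    · have := cCC_nonneg n
      have := hbS.1.1
      gcongr
  · have := far R hBR fun t ht => by
      by_contra! hle
      exact hne ⟨t, ⟨ht.1.le, ht.2.le⟩, hle⟩
    linarith [Real.exp_pos (hCC n + cCC n * Real.exp (-hCC n) / B)]

end UnitProfile

/-- `K` bounds the Trudinger–Moser mass which unit profiles can carry at infinity. -/
def ConcBound (n : ℕ) (β K : ℝ) : Prop :=
  ∀ η > 0, ∃ B : ℝ, 0 < B ∧ ∀ v g : ℝ → ℝ, UnitProfile n v g →
    mosF n β v (Set.Ioi B) ≤ ENNReal.ofReal (K + η)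

theorem mosF_mono (n : ℕ) (β : ℝ) (w : ℝ → ℝ) {S T : Set ℝ} (h : S ⊆ T) :
    mosF n β w S ≤ mosF n β w T :=
  lintegral_mono_set h

theorem continuous_abs_rpow_cexp {w : ℝ → ℝ} (hw : Continuous w) (n : ℕ) :
    Continuous fun t => |w t| ^ cexp n :=
  hw.abs.rpow_const fun _ => Or.inr (cexp_pos n).le

theorem continuous_mosF_integrand {w : ℝ → ℝ} (hw : Continuous w) (n : ℕ) (β : ℝ) :
    Continuous fun t => expTail n (β * |w t| ^ cexp n) * Real.exp (-t) := by
  have h1 := (continuous_expTail n).comp (continuous_const.mul (continuous_abs_rpow_cexp hw n) :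
    Continuous fun t => β * |w t| ^ cexp n)
  exact h1.mul (by fun_prop)

theorem lintegral_Ioi_le_of_Ioc {f : ℝ → ℝ≥0∞} (hf : Measurable f) {B : ℝ} {M : ℝ≥0∞}
    (h : ∀ R, B ≤ R → ∫⁻ t in Set.Ioc B R, f t ≤ M) : ∫⁻ t in Set.Ioi B, f t ≤ M := by
  have hc : AECover (volume.restrict (Set.Ioi B)) atTop fun R : ℝ => Set.Iic R :=
    aecover_Iic tendsto_id
  refine le_of_tendsto (hc.lintegral_tendsto_of_countably_generated hf.aemeasurable) ?_
  filter_upwards [eventually_ge_atTop B] with R hR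
  rw [Measure.restrict_restrict measurableSet_Iic, Set.inter_comm, Set.Ioi_inter_Iic]
  exact h R hR

theorem concBound_one {n : ℕ} : ConcBound n 1 (Real.exp (hCC n)) := by
  intro η hη
  have ht : Tendsto (fun B : ℝ => 2 ^ (n + 2) * Real.exp (-(B / 2 ^ (n + 2))) +
      Real.exp (hCC n + cCC n * Real.exp (-hCC n) / B)) atTop
      (nhds (2 ^ (n + 2) * 0 + Real.exp (hCC n + 0))) := by
    refine Tendsto.add (Tendsto.const_mul _ ?_) ?_
    · exact tendsto_exp_neg_atTop_nhds_zero.comp (tendsto_id.atTop_div_const (by positivity))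
    · refine (Real.continuous_exp.tendsto _).comp (tendsto_const_nhds.add ?_)
      exact tendsto_const_nhds.div_atTop tendsto_id
  have h1 := ht.eventually_lt_const (u := Real.exp (hCC n) + η) (by simpa using hη)
  obtain ⟨B, hB, hB0⟩ := (h1.and (eventually_gt_atTop 0)).exists
  refine ⟨B, hB0, fun v g h => lintegral_Ioi_le_of_Ioc
    (continuous_mosF_integrand h.prim.continuous n 1).measurable.ennreal_ofReal fun R hR => ?_⟩
  have hd : Continuous fun t => Real.exp (-deficit n v t) := (h.continuous_deficit.neg).rexp
  rw [← ofReal_integral_eq_lintegral_ofReal]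
  · refine ENNReal.ofReal_le_ofReal (le_trans ?_ hB.le)
    refine le_trans ?_ (h.integral_exp_neg_deficit_le hB0 hR)
    rw [intervalIntegral.integral_of_le hR]
    refine setIntegral_mono_on ?_ (hd.integrableOn_Ioc) measurableSet_Ioc fun t _ => ?_
    · exact (continuous_mosF_integrand h.prim.continuous n 1).integrableOn_Ioc
    · have h0 : 0 ≤ |v t| ^ cexp n := by positivity
      have := expTail_le_exp n h0
      rw [one_mul, deficit, neg_sub, sub_eq_add_neg, Real.exp_add]
      gcongr
  · exact (continuous_mosF_integrand h.prim.continuous n 1).integrableOn_Ioc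
  · exact ae_of_all _ fun t => mul_nonneg (expTail_nonneg n (by positivity)) (Real.exp_pos _).le

theorem concBound_zero {n : ℕ} {β : ℝ} (h0 : 0 < β) (h1 : β < 1) : ConcBound n β 0 := by
  intro η hη
  have hb : 0 < 1 - β := by linarith
  have ht : Tendsto (fun B : ℝ => Real.exp (-((1 - β) * B)) / (1 - β)) atTop
      (nhds (0 / (1 - β))) :=
    (tendsto_exp_neg_atTop_nhds_zero.comp (tendsto_id.const_mul_atTop hb)).div_const _
  have h1 := ht.eventually_lt_const (u := 0 + η) (by simpa using hη)
  obtain ⟨B, hB, hB0⟩ := (h1.and (eventually_gt_atTop 0)).exists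
  refine ⟨B, hB0, fun v g h => ?_⟩
  calc mosF n β v (Set.Ioi B) ≤ ∫⁻ t in Set.Ioi B, ENNReal.ofReal (Real.exp (-(1 - β) * t)) := by
        refine setLIntegral_mono' measurableSet_Ioi fun t ht => ENNReal.ofReal_le_ofReal ?_
        have hd := h.deficit_nonneg (hB0.trans ht).le
        have h2 : 0 ≤ |v t| ^ cexp n := by positivity
        have := expTail_le_exp n (mul_nonneg h0.le h2)
        calc _ ≤ Real.exp (β * |v t| ^ cexp n) * Real.exp (-t) := by gcongr
          _ ≤ _ := by
            rw [← Real.exp_add]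
            refine Real.exp_le_exp.2 ?_
            unfold deficit at hd
            nlinarith
    _ = ENNReal.ofReal (Real.exp (-((1 - β) * B)) / (1 - β)) := by
        rw [← ofReal_integral_eq_lintegral_ofReal (integrableOn_exp_mul_Ioi (by linarith) B)
          (ae_of_all _ fun t => (Real.exp_pos _).le), integral_exp_mul_Ioi (by linarith)]
        congr 1
        rw [neg_mul, neg_div_neg_eq]
    _ ≤ _ := ENNReal.ofReal_le_ofReal hB.le

/-- The part of a function to the right of `L` is dominated by a shifted, scaled unit profile. -/
theorem IsPrim.exists_unitProfile {w g : ℝ → ℝ} (hw : IsPrim w g) {n : ℕ} (hn : 1 ≤ n)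
    {L l κ : ℝ} (hl : 0 < l) (hκ : 0 < κ)
    (he : ENNReal.ofReal (|w L| ^ (n + 1) / l ^ n) + dirE n g (Set.Ioi L) ≤
      ENNReal.ofReal (κ ^ (n + 1))) :
    ∃ v r, UnitProfile n v r ∧ ∀ t, L ≤ t → |w t| ≤ κ * v (t - (L - l)) := by
  set a := L - l with ha
  set r : ℝ → ℝ := fun s => (Set.Iic l).indicator (fun _ => |w L| / (l * κ)) s +
    (Set.Ioi l).indicator (fun s => |g (s + a)| / κ) s with hr
  have hr1 : ∀ s ≤ l, r s = |w L| / (l * κ) := fun s hs => by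
    simp [hr, hs]
  have hr2 : ∀ s, l < s → r s = |g (s + a)| / κ := fun s hs => by
    simp [hr, hs]
  have hintg : ∀ x y, IntervalIntegrable r volume x y := fun x y => by
    have h1 : IntervalIntegrable (fun s => |g (s + a)| / κ) volume x y :=
      ((hw.comp_add a).int x y).abs.div_const κ
    have h2 : IntervalIntegrable (fun _ : ℝ => |w L| / (l * κ)) volume x y :=
      intervalIntegrable_const
    exact ⟨(h2.1.indicator measurableSet_Iic).add (h1.1.indicator measurableSet_Ioi),
      (h2.2.indicator measurableSet_Iic).add (h1.2.indicator measurableSet_Ioi)⟩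
  have hprim : IsPrim (fun t => ∫ s in (0 : ℝ)..t, r s) r := ⟨hintg, fun x y =>
    intervalIntegral.integral_interval_sub_left (hintg _ _) (hintg _ _)⟩
  have hr0 : ∀ t, 0 ≤ r t := fun t => by
    rcases le_or_gt t l with h | h
    · rw [hr1 t h]; positivity
    · rw [hr2 t h]; positivity
  refine ⟨_, r, ⟨hn, hprim, hr0, by simp, ?_⟩, fun t ht => ?_⟩
  · have hκp : ENNReal.ofReal (κ ^ (n + 1)) ≠ 0 := by simpa using by positivity
    rw [dirE, ← Set.Ioc_union_Ioi_eq_Ioi hl.le, lintegral_union measurableSet_Ioi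
      (Set.Ioc_disjoint_Ioi le_rfl)]
    have e1 : ∫⁻ t in Set.Ioc 0 l, ENNReal.ofReal (|r t| ^ (n + 1)) =
        ENNReal.ofReal (|w L| ^ (n + 1) / l ^ n) / ENNReal.ofReal (κ ^ (n + 1)) := by
      rw [setLIntegral_congr_fun measurableSet_Ioc (g := fun _ =>
        ENNReal.ofReal ((|w L| / (l * κ)) ^ (n + 1))) fun t ht => by
          simp only [hr1 t ht.2]; rw [abs_of_nonneg (by positivity)]]
      rw [setLIntegral_const, Real.volume_Ioc, ← ENNReal.ofReal_mul (by positivity),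
        ← ENNReal.ofReal_div_of_pos (by positivity)]
      congr 1
      rw [div_pow, mul_pow, sub_zero]
      field_simp
      ring
    have e2 : ∫⁻ t in Set.Ioi l, ENNReal.ofReal (|r t| ^ (n + 1)) =
        dirE n g (Set.Ioi L) / ENNReal.ofReal (κ ^ (n + 1)) := by
      rw [setLIntegral_congr_fun measurableSet_Ioi (g := fun s =>
        (ENNReal.ofReal (κ ^ (n + 1)))⁻¹ * ENNReal.ofReal (|g (s + a)| ^ (n + 1))) fun t ht => by
          simp only [hr2 t ht]
          rw [abs_of_nonneg (by positivity), div_pow,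
            ENNReal.ofReal_div_of_pos (by positivity), ENNReal.div_eq_inv_mul]]
      rw [lintegral_const_mul' _ _ (ENNReal.inv_ne_top.2 hκp), ENNReal.div_eq_inv_mul]
      congr 1
      have := (measurePreserving_add_right volume a).setLIntegral_comp_preimage_emb
        (MeasurableEquiv.addRight a).measurableEmbedding
        (fun s => ENNReal.ofReal (|g s| ^ (n + 1))) (Set.Ioi L)
      rw [dirE, ← this]
      congr 2
      ext x; simp [ha]
    rw [e1, e2, ← ENNReal.add_div]
    exact ENNReal.div_le_of_le_mul (by rwa [one_mul])
  · have hlt : l ≤ t - a := by rw [ha]; linarith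
    have h1 : ∫ s in (0 : ℝ)..l, r s = |w L| / κ := by
      rw [intervalIntegral.integral_congr (g := fun _ => |w L| / (l * κ)) fun s hs => by
        rw [Set.uIcc_of_le hl.le] at hs; exact hr1 s hs.2]
      rw [intervalIntegral.integral_const, smul_eq_mul]
      field_simp
      ring
    have h2 : ∫ s in l..(t - a), r s = (∫ s in L..t, |g s|) / κ := by
      rw [intervalIntegral.integral_congr_ae (g := fun s => |g (s + a)| / κ)
        (ae_of_all _ fun s hs => by
        rw [Set.uIoc_of_le hlt] at hs; exact hr2 s hs.1)]
      rw [intervalIntegral.integral_div, intervalIntegral.integral_comp_add_right (fun s => |g s|)]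
      simp [ha]
    have h3 := hw.abs_sub_le ht
    have h4 : |w t| ≤ |w L| + ∫ s in L..t, |g s| := by
      have := abs_sub_abs_le_abs_sub (w t) (w L); linarith
    rw [← intervalIntegral.integral_add_adjacent_intervals (hintg 0 l) (hintg l (t - a)), h1, h2]
    calc _ ≤ _ := h4
      _ = _ := by field_simp

/-- Translating the functional. -/
theorem mosF_comp_sub (n : ℕ) (β : ℝ) (v : ℝ → ℝ) (a B : ℝ) :
    mosF n β (fun t => v (t - a)) (Set.Ioi B) =
      ENNReal.ofReal (Real.exp (-a)) * mosF n β v (Set.Ioi (B - a)) := by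
  rw [mosF, mosF, ← lintegral_const_mul' _ _ ENNReal.ofReal_ne_top]
  have := (measurePreserving_sub_right volume a).setLIntegral_comp_preimage_emb
    (MeasurableEquiv.subRight a).measurableEmbedding
    (fun s => ENNReal.ofReal (Real.exp (-a)) *
      ENNReal.ofReal (expTail n (β * |v s| ^ cexp n) * Real.exp (-s))) (Set.Ioi (B - a))
  rw [← this]
  have e : (fun x => x - a) ⁻¹' Set.Ioi (B - a) = Set.Ioi B := by ext x; simp
  rw [e]
  refine lintegral_congr fun t => ?_
  rw [← ENNReal.ofReal_mul (Real.exp_pos _).le]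
  congr 1
  rw [show -t = -a + -(t - a) by ring, Real.exp_add]; ring

/-- Upper bound for the mass carried by the part to the right of `B ≥ L`. -/
theorem IsPrim.exists_mosF_tail_le {w g : ℝ → ℝ} (hw : IsPrim w g) {n : ℕ} (hn : 1 ≤ n)
    {L l κ β B : ℝ} (hl : 0 < l) (hκ : 0 < κ) (hκ1 : κ ≤ 1) (hβ : 0 ≤ β) (hB : L ≤ B)
    (he : ENNReal.ofReal (|w L| ^ (n + 1) / l ^ n) + dirE n g (Set.Ioi L) ≤
      ENNReal.ofReal (κ ^ (n + 1))) :
    ∃ v r, UnitProfile n v r ∧ mosF n β w (Set.Ioi B) ≤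
      ENNReal.ofReal (κ ^ (n + 1)) * (ENNReal.ofReal (Real.exp (-(L - l))) *
        mosF n β v (Set.Ioi (B - (L - l)))) := by
  obtain ⟨v, r, hv, h⟩ := hw.exists_unitProfile hn hl hκ he
  refine ⟨v, r, hv, ?_⟩
  rw [← mosF_comp_sub, mosF, mosF, ← lintegral_const_mul' _ _ ENNReal.ofReal_ne_top]
  refine setLIntegral_mono' measurableSet_Ioi fun t ht => ?_
  rw [← ENNReal.ofReal_mul (by positivity), ← mul_assoc]
  refine ENNReal.ofReal_le_ofReal ?_
  have h1 := h t (hB.trans ht.le)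
  have h2 : |w t| ^ cexp n ≤ κ ^ cexp n * |v (t - (L - l))| ^ cexp n := by
    rw [← Real.mul_rpow hκ.le (abs_nonneg _)]
    refine Real.rpow_le_rpow (abs_nonneg _) (h1.trans ?_) (cexp_pos n).le
    gcongr; exact le_abs_self _
  have h3 : κ ^ cexp n ≤ 1 := Real.rpow_le_one hκ.le hκ1 (cexp_pos n).le
  have h4 := expTail_mul_le n (c := κ ^ cexp n) (x := β * |v (t - (L - l))| ^ cexp n)
    (by positivity) h3 (by positivity)
  rw [rpow_cexp_pow hn hκ.le] at h4
  refine mul_le_mul_of_nonneg_right (le_trans (expTail_mono n (by positivity) ?_) h4)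
    (Real.exp_pos _).le
  calc _ ≤ β * (κ ^ cexp n * |v (t - (L - l))| ^ cexp n) := by gcongr
    _ = _ := by ring

/-- The quantity `log ((1 - x / c) / (1 - x))` is small in mean when `c` is close to one. -/
theorem integral_log_profile_le {n : ℕ} (hn : 1 ≤ n) {c : ℝ} (hc : 1 ≤ c) :
    ∫ s in Set.Ioo (0 : ℝ) 1, Real.log (s - s ^ cexp n / c) ≤
      -hCC n - 1 + 4 * √(n * (1 - 1 / c)) := by
  have i0 := integrableOn_log_profile hn le_rfl
  simp only [div_one] at i0
  have e0 : ∫ s in Set.Ioo (0 : ℝ) 1, Real.log (s - s ^ cexp n) = -hCC n - 1 := by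
    have := integral_add (μ := volume.restrict (Set.Ioo (0 : ℝ) 1)) i0
      (integrableOn_const (C := (1 : ℝ)) (by simp))
    rw [hCC, neg_neg, this]; simp
  have hii : IntervalIntegrable (fun s : ℝ => (1 - s) ^ (-(1 / 2) : ℝ)) volume 0 1 := by
    have := (intervalIntegral.intervalIntegrable_rpow' (a := 1) (b := 0) (r := -(1 / 2))
      (by norm_num)).comp_sub_left 1
    simpa using this
  have e1 : ∫ s in Set.Ioo (0 : ℝ) 1, (1 - s) ^ (-(1 / 2) : ℝ) = 2 := by
    rw [← integral_Ioc_eq_integral_Ioo, ← intervalIntegral.integral_of_le zero_le_one,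
      intervalIntegral.integral_comp_sub_left (fun s : ℝ => s ^ (-(1 / 2) : ℝ)),
      integral_rpow (Or.inl (by norm_num))]
    norm_num
  have i1 : IntegrableOn (fun s : ℝ => (1 - s) ^ (-(1 / 2) : ℝ)) (Set.Ioo 0 1) :=
    (intervalIntegrable_iff_integrableOn_Ioo_of_le zero_le_one).1 hii
  set e := n * (1 - 1 / c) with he
  have hc1 : 0 ≤ 1 - 1 / c := by
    have : 1 / c ≤ 1 := by rw [div_le_one (by linarith)]; exact hc
    linarith
  have he0 : 0 ≤ e := by positivity
  calc ∫ s in Set.Ioo (0 : ℝ) 1, Real.log (s - s ^ cexp n / c)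
      ≤ ∫ s in Set.Ioo (0 : ℝ) 1,
        (Real.log (s - s ^ cexp n) + 2 * √e * (1 - s) ^ (-(1 / 2) : ℝ)) := by
        refine setIntegral_mono_on (integrableOn_log_profile hn hc)
          (i0.add (i1.const_mul _)) measurableSet_Ioo fun s hs => ?_
        have h1s : 0 < 1 - s := by linarith [hs.2]
        have hs0 := hs.1
        have hn' : (0 : ℝ) < n := by positivity
        have hge := self_sub_rpow_cexp_ge hn hs.1
        have hle := rpow_cexp_lt_self hn hs.1 hs.2
        set x := s ^ cexp n with hx
        have hx0 : 0 ≤ x := Real.rpow_nonneg hs.1.le _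
        have hd : 0 < s - x := by linarith
        have hw : 0 < (1 - s) := h1s
        have hz : s - x / c ≤ (s - x) * (1 + e / (1 - s)) := by
          have h2 : (s - x) * (e / (1 - s)) ≥ s * ((1 - s) / n) * (e / (1 - s)) := by
            gcongr
          have h3 : s * ((1 - s) / n) * (e / (1 - s)) = s * (1 - 1 / c) := by
            rw [he]; field_simp
          have h4 : x * (1 - 1 / c) ≤ s * (1 - 1 / c) := by gcongr
          have h5 : x / c = x * (1 / c) := by ring
          nlinarith
        have hxc : 0 < s - x / c := by
          have : x / c ≤ x := div_le_self hx0 hc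
          linarith
        have h6 := Real.log_le_log hxc hz
        rw [Real.log_mul hd.ne' (by positivity)] at h6
        have h7 : Real.log (1 + e / (1 - s)) ≤ 2 * √(e / (1 - s)) := by
          have h8 : Real.log (1 + √(e / (1 - s))) ≤ √(e / (1 - s)) := by
            have := Real.log_le_sub_one_of_pos (x := 1 + √(e / (1 - s))) (by positivity)
            linarith
          have h9 : 1 + e / (1 - s) ≤ (1 + √(e / (1 - s))) ^ 2 := by
            nlinarith [Real.sq_sqrt (show 0 ≤ e / (1 - s) by positivity),
              Real.sqrt_nonneg (e / (1 - s))]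
          have := Real.log_le_log (by positivity) h9
          rw [Real.log_pow] at this
          push_cast at this
          linarith
        have h10 : √(e / (1 - s)) = √e * (1 - s) ^ (-(1 / 2) : ℝ) := by
          rw [Real.sqrt_div he0, Real.rpow_neg hw.le, ← Real.sqrt_eq_rpow, div_eq_mul_inv]
        rw [h10] at h7
        linarith
    _ = _ := by
      rw [integral_add i0 (i1.const_mul _), integral_const_mul, e0, e1]
      ring

/-- The slope of the concentrating extremal profile. -/
noncomputable def innerSlope (n : ℕ) (l t : ℝ) : ℝ :=
  (1 + Real.exp (-l)) * Real.exp (l - (t - l) / n) / (1 + Real.exp (l - (t - l) / n))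

/-- The concentrating extremal profile. -/
noncomputable def innerProfile (n : ℕ) (l t : ℝ) : ℝ :=
  l + (1 + Real.exp (-l)) * n * (Real.log (1 + Real.exp l) -
    Real.log (1 + Real.exp (l - (t - l) / n)))

section Inner

variable {n : ℕ} {l : ℝ}

theorem innerSlope_pos (n : ℕ) (l t : ℝ) : 0 < innerSlope n l t := by
  unfold innerSlope; positivity

theorem continuous_innerSlope (n : ℕ) (l : ℝ) : Continuous (innerSlope n l) := by
  unfold innerSlope
  refine Continuous.div (by fun_prop) (by fun_prop) fun t => by positivity

theorem innerSlope_self (n : ℕ) (l : ℝ) : innerSlope n l l = 1 := by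
  unfold innerSlope
  rw [sub_self, zero_div, sub_zero, Real.exp_neg]
  have := Real.exp_pos l
  field_simp
  ring

theorem hasDerivAt_innerExp (n : ℕ) (l t : ℝ) :
    HasDerivAt (fun t => 1 + Real.exp (l - (t - l) / n))
      (-(Real.exp (l - (t - l) / n) / n)) t := by
  have := (((((hasDerivAt_id t).sub_const l).div_const (n : ℝ)).const_sub l).exp).const_add 1
  exact this.congr_deriv (by simp; ring)

theorem hasDerivAt_innerSlope (hn : 1 ≤ n) (l t : ℝ) :
    HasDerivAt (innerSlope n l)
      (-(innerSlope n l t * (1 - innerSlope n l t / (1 + Real.exp (-l))) / n)) t := by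
  have h1 := hasDerivAt_innerExp n l t
  have e : innerSlope n l = fun t =>
      (1 + Real.exp (-l)) * (1 - (1 + Real.exp (l - (t - l) / n))⁻¹) := by
    funext t; unfold innerSlope; field_simp; ring
  have h2 := ((h1.inv (by positivity)).const_sub 1).const_mul (1 + Real.exp (-l))
  rw [e]
  refine HasDerivAt.congr_deriv h2 ?_
  have hn' : (n : ℝ) ≠ 0 := by positivity
  field_simp
  ring

theorem hasDerivAt_innerProfile (hn : 1 ≤ n) (l t : ℝ) :
    HasDerivAt (innerProfile n l) (innerSlope n l t) t := by
  have h1 := hasDerivAt_innerExp n l t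
  have h2 := ((((h1.log (by positivity)).const_sub (Real.log (1 + Real.exp l))).const_mul
    ((1 + Real.exp (-l)) * n))).const_add l
  refine h2.congr_deriv ?_
  unfold innerSlope
  have hn' : (n : ℝ) ≠ 0 := by positivity
  field_simp

theorem innerProfile_self (n : ℕ) (l : ℝ) : innerProfile n l l = l := by
  simp [innerProfile]

theorem strictAnti_innerSlope (hn : 1 ≤ n) (l : ℝ) : StrictAnti (innerSlope n l) := by
  refine strictAnti_of_hasDerivAt_neg (hasDerivAt_innerSlope hn l) fun t => ?_
  have h1 := innerSlope_pos n l t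
  have h2 : innerSlope n l t / (1 + Real.exp (-l)) < 1 := by
    unfold innerSlope
    have := Real.exp_pos (l - (t - l) / n)
    rw [mul_div_assoc, mul_div_cancel_left₀ _ (by positivity), div_lt_one (by positivity)]
    linarith
  have h3 : 0 < innerSlope n l t * (1 - innerSlope n l t / (1 + Real.exp (-l))) / n := by
    have : 0 < 1 - innerSlope n l t / (1 + Real.exp (-l)) := by linarith
    positivity
  linarith

theorem tendsto_innerExp (hn : 1 ≤ n) (l : ℝ) :
    Tendsto (fun t : ℝ => Real.exp (l - (t - l) / n)) atTop (nhds 0) := by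
  have hn' : (0 : ℝ) < n := by positivity
  refine Real.tendsto_exp_atBot.comp (tendsto_atBot_add_const_left _ l ?_)
  exact tendsto_neg_atTop_atBot.comp
    ((tendsto_atTop_add_const_right _ (-l) tendsto_id).atTop_div_const hn')

theorem tendsto_innerSlope (hn : 1 ≤ n) (l : ℝ) :
    Tendsto (innerSlope n l) atTop (nhds 0) := by
  have h := tendsto_innerExp hn l
  have := (h.const_mul (1 + Real.exp (-l))).div (h.const_add 1) (by norm_num)
  simp only [mul_zero, zero_div] at this
  exact this

theorem tendsto_innerProfile (hn : 1 ≤ n) (l : ℝ) :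
    Tendsto (innerProfile n l) atTop
      (nhds (l + (1 + Real.exp (-l)) * n * Real.log (1 + Real.exp l))) := by
  have h := (tendsto_innerExp hn l).const_add 1
  have := ((((h.log (by norm_num)).const_sub (Real.log (1 + Real.exp l))).const_mul
    ((1 + Real.exp (-l)) * n))).const_add l
  simp only [add_zero, Real.log_one, sub_zero] at this
  exact this

theorem tendsto_mul_innerSlope_pow (hn : 1 ≤ n) (l : ℝ) :
    Tendsto (fun t => t * innerSlope n l t ^ n) atTop (nhds 0) := by
  have h1 : Tendsto (fun t : ℝ => ((1 + Real.exp (-l)) ^ n * Real.exp ((n + 1) * l)) *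
      (t ^ 1 * Real.exp (-t))) atTop
      (nhds (((1 + Real.exp (-l)) ^ n * Real.exp ((n + 1) * l)) * 0)) :=
    (Real.tendsto_pow_mul_exp_neg_atTop_nhds_zero 1).const_mul _
  rw [mul_zero] at h1
  refine squeeze_zero' ?_ ?_ h1
  · filter_upwards [eventually_ge_atTop 0] with t ht
    have := innerSlope_pos n l t
    positivity
  · filter_upwards [eventually_ge_atTop 0] with t ht
    have hle : innerSlope n l t ≤ (1 + Real.exp (-l)) * Real.exp (l - (t - l) / n) := by
      unfold innerSlope
      exact div_le_self (by positivity) (by linarith [Real.exp_pos (l - (t - l) / n)])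
    have hn' : (n : ℝ) ≠ 0 := by positivity
    calc t * innerSlope n l t ^ n ≤ t * ((1 + Real.exp (-l)) * Real.exp (l - (t - l) / n)) ^ n := by
          have := innerSlope_pos n l t
          gcongr
      _ = _ := by
          rw [mul_pow, ← Real.exp_nat_mul]
          have : (n : ℝ) * (l - (t - l) / n) = (n + 1) * l + -t := by field_simp; ring
          rw [this, Real.exp_add]; ring

theorem innerSlope_le_one (hn : 1 ≤ n) {t : ℝ} (ht : l ≤ t) : innerSlope n l t ≤ 1 := by
  rw [← innerSlope_self n l]; exact (strictAnti_innerSlope hn l).antitone ht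

theorem integrableOn_innerSlope (hn : 1 ≤ n) (l : ℝ) :
    IntegrableOn (innerSlope n l) (Set.Ioi l) :=
  integrableOn_Ioi_deriv_of_nonneg' (fun t _ => hasDerivAt_innerProfile hn l t)
    (fun t _ => (innerSlope_pos n l t).le) (tendsto_innerProfile hn l)

theorem integrableOn_innerSlope_pow (hn : 1 ≤ n) (l : ℝ) :
    IntegrableOn (fun t => innerSlope n l t ^ (n + 1)) (Set.Ioi l) := by
  refine (integrableOn_innerSlope hn l).mono'
    ((continuous_innerSlope n l).pow _).aestronglyMeasurable ?_
  filter_upwards [self_mem_ae_restrict measurableSet_Ioi] with t ht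
  have h0 := innerSlope_pos n l t
  rw [Real.norm_eq_abs, abs_of_pos (by positivity)]
  exact pow_le_of_le_one h0.le (innerSlope_le_one hn ht.le) (by omega)

/-- The energy of the extremal profile. -/
noncomputable def innerEnergy (n : ℕ) (l : ℝ) : ℝ :=
  ∫ t in Set.Ioi l, innerSlope n l t ^ (n + 1)

theorem innerEnergy_nonneg (n : ℕ) (l : ℝ) : 0 ≤ innerEnergy n l :=
  setIntegral_nonneg measurableSet_Ioi fun t _ => pow_nonneg (innerSlope_pos n l t).le _

theorem innerEnergy_le (hn : 1 ≤ n) (hl : 0 ≤ l) : innerEnergy n l ≤ 2 * n * (l + 1) := by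
  have h1 : innerEnergy n l ≤ ∫ t in Set.Ioi l, innerSlope n l t := by
    refine setIntegral_mono_on (integrableOn_innerSlope_pow hn l) (integrableOn_innerSlope hn l)
      measurableSet_Ioi fun t ht => ?_
    exact pow_le_of_le_one (innerSlope_pos n l t).le (innerSlope_le_one hn (le_of_lt ht)) (by omega)
  rw [integral_Ioi_of_hasDerivAt_of_nonneg' (fun t _ => hasDerivAt_innerProfile hn l t)
    (fun t _ => (innerSlope_pos n l t).le) (tendsto_innerProfile hn l), innerProfile_self] at h1
  have h2 : Real.exp (-l) ≤ 1 := Real.exp_le_one_iff.2 (by linarith)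
  have h3 : Real.log (1 + Real.exp l) ≤ l + 1 := by
    rw [Real.log_le_iff_le_exp (by positivity), Real.exp_add]
    have := Real.add_one_le_exp 1
    have := Real.one_le_exp hl
    nlinarith
  have h4 : 0 ≤ Real.log (1 + Real.exp l) := Real.log_nonneg (by linarith [Real.exp_pos l])
  calc _ ≤ _ := h1
    _ = (1 + Real.exp (-l)) * n * Real.log (1 + Real.exp l) := by ring
    _ ≤ (1 + 1) * n * (l + 1) := by gcongr
    _ = _ := by ring

theorem dirE_innerSlope (hn : 1 ≤ n) (l : ℝ) :
    dirE n (innerSlope n l) (Set.Ioi l) = ENNReal.ofReal (innerEnergy n l) := by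
  rw [innerEnergy, ofReal_integral_eq_lintegral_ofReal (integrableOn_innerSlope_pow hn l)
    (ae_of_all _ fun t => pow_nonneg (innerSlope_pos n l t).le _), dirE]
  simp only [abs_of_pos (innerSlope_pos n l _)]

theorem innerProfile_mem (hn : 1 ≤ n) {t : ℝ} (ht : l ≤ t) :
    l ≤ innerProfile n l t ∧ innerProfile n l t ≤ t := by
  have h1 : Monotone (innerProfile n l) := monotone_of_hasDerivAt_nonneg
    (hasDerivAt_innerProfile hn l) fun t => (innerSlope_pos n l t).le
  refine ⟨(innerProfile_self n l).symm.le.trans (h1 ht), ?_⟩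
  have h2 : AntitoneOn (fun t => innerProfile n l t - t) (Set.Ici l) := by
    refine antitoneOn_of_deriv_nonpos (convex_Ici l) ?_ ?_ ?_
    · exact fun t _ => ((hasDerivAt_innerProfile hn l t).sub
        (hasDerivAt_id t)).continuousAt.continuousWithinAt
    · exact fun t _ => ((hasDerivAt_innerProfile hn l t).sub
        (hasDerivAt_id t)).differentiableAt.differentiableWithinAt
    · intro t ht
      have := ((hasDerivAt_innerProfile hn l t).sub (hasDerivAt_id t)).deriv
      rw [interior_Ici] at ht
      have h3 := innerSlope_le_one hn (le_of_lt ht)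
      change deriv (innerProfile n l - id) t ≤ 0
      rw [this]; linarith
  have := h2 Set.self_mem_Ici ht ht
  simp only [innerProfile_self] at this
  linarith

theorem isPrim_innerProfile (hn : 1 ≤ n) (l : ℝ) : IsPrim (innerProfile n l) (innerSlope n l) :=
  isPrim_of_hasDerivAt (continuous_innerSlope n l) (hasDerivAt_innerProfile hn l)

end Inner

/-- The probability density attached to the extremal profile. -/
noncomputable def innerDensity (n : ℕ) (l t : ℝ) : ℝ :=
  innerSlope n l t ^ n * (1 - innerSlope n l t / (1 + Real.exp (-l)))

section Inner

variable {n : ℕ} {l : ℝ}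

theorem innerDensity_pos (n : ℕ) (l t : ℝ) : 0 < innerDensity n l t := by
  have h1 := innerSlope_pos n l t
  have h2 : innerSlope n l t / (1 + Real.exp (-l)) < 1 := by
    unfold innerSlope
    have := Real.exp_pos (l - (t - l) / n)
    rw [mul_div_assoc, mul_div_cancel_left₀ _ (by positivity), div_lt_one (by positivity)]
    linarith
  have : 0 < 1 - innerSlope n l t / (1 + Real.exp (-l)) := by linarith
  unfold innerDensity
  positivity

theorem continuous_innerDensity (n : ℕ) (l : ℝ) : Continuous (innerDensity n l) := by
  have := continuous_innerSlope n l
  unfold innerDensity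
  fun_prop

theorem hasDerivAt_innerSlope_pow (hn : 1 ≤ n) (l t : ℝ) :
    HasDerivAt (fun t => innerSlope n l t ^ n) (-innerDensity n l t) t := by
  refine ((hasDerivAt_innerSlope hn l t).pow n).congr_deriv ?_
  obtain ⟨k, rfl⟩ : ∃ k, n = k + 1 := ⟨n - 1, by omega⟩
  unfold innerDensity
  rw [Nat.add_sub_cancel]
  have hk : ((k + 1 : ℕ) : ℝ) ≠ 0 := by positivity
  field_simp
  ring

theorem tendsto_innerSlope_pow (hn : 1 ≤ n) (l : ℝ) :
    Tendsto (fun t => innerSlope n l t ^ n) atTop (nhds 0) := by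
  have := (tendsto_innerSlope hn l).pow n
  rwa [zero_pow (by omega)] at this

theorem integrableOn_innerDensity (hn : 1 ≤ n) (l : ℝ) :
    IntegrableOn (innerDensity n l) (Set.Ioi l) := by
  refine integrableOn_Ioi_deriv_of_nonneg' (g := fun t => -innerSlope n l t ^ n) (l := -0)
    (fun t _ => ?_) (fun t _ => (innerDensity_pos n l t).le) (tendsto_innerSlope_pow hn l).neg
  exact ((hasDerivAt_innerSlope_pow hn l t).neg).congr_deriv (neg_neg _)

theorem integral_innerDensity (hn : 1 ≤ n) (l : ℝ) :
    ∫ t in Set.Ioi l, innerDensity n l t = 1 := by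
  rw [integral_Ioi_of_hasDerivAt_of_nonneg' (g := fun t => -innerSlope n l t ^ n) (l := -0)
    (fun t _ => ((hasDerivAt_innerSlope_pow hn l t).neg).congr_deriv (neg_neg _))
    (fun t _ => (innerDensity_pos n l t).le) (tendsto_innerSlope_pow hn l).neg, innerSlope_self]
  simp

theorem innerSlope_pow_eq (n : ℕ) (l t : ℝ) : innerSlope n l t ^ n =
    innerDensity n l t + innerSlope n l t ^ (n + 1) / (1 + Real.exp (-l)) := by
  unfold innerDensity; ring

theorem integrableOn_innerSlope_pow_self (hn : 1 ≤ n) (l : ℝ) :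
    IntegrableOn (fun t => innerSlope n l t ^ n) (Set.Ioi l) := by
  simp only [innerSlope_pow_eq]
  exact (integrableOn_innerDensity hn l).add ((integrableOn_innerSlope_pow hn l).div_const _)

theorem integral_innerSlope_pow_self_le (hn : 1 ≤ n) (l : ℝ) :
    ∫ t in Set.Ioi l, innerSlope n l t ^ n ≤ 1 + innerEnergy n l := by
  simp only [innerSlope_pow_eq]
  rw [integral_add (integrableOn_innerDensity hn l)
    ((integrableOn_innerSlope_pow hn l).div_const _), integral_innerDensity hn, integral_div]
  have := innerEnergy_nonneg n l
  gcongr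
  exact div_le_self this (by linarith [Real.exp_pos (-l)])

theorem integral_id_mul_innerDensity (hn : 1 ≤ n) (hl : 0 ≤ l) :
    IntegrableOn (fun t => t * innerDensity n l t) (Set.Ioi l) ∧
    ∫ t in Set.Ioi l, t * innerDensity n l t ≤ l + 1 + innerEnergy n l := by
  have hc : Continuous fun t => innerSlope n l t ^ n := (continuous_innerSlope n l).pow n
  have hd : ∀ t ∈ Set.Ici l, HasDerivAt (fun t => (∫ s in l..t, innerSlope n l s ^ n) -
      t * innerSlope n l t ^ n) (t * innerDensity n l t) t := fun t _ => by
    have h1 := intervalIntegral.integral_hasDerivAt_right (hc.intervalIntegrable l t)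
      (hc.stronglyMeasurableAtFilter _ _) hc.continuousAt
    exact (h1.sub ((hasDerivAt_id t).mul (hasDerivAt_innerSlope_pow hn l t))).congr_deriv
      (by simp)
  have ht : Tendsto (fun t => (∫ s in l..t, innerSlope n l s ^ n) -
      t * innerSlope n l t ^ n) atTop (nhds ((∫ s in Set.Ioi l, innerSlope n l s ^ n) - 0)) :=
    (intervalIntegral_tendsto_integral_Ioi l (integrableOn_innerSlope_pow_self hn l)
      tendsto_id).sub (tendsto_mul_innerSlope_pow hn l)
  have h0 : ∀ t ∈ Set.Ioi l, 0 ≤ t * innerDensity n l t := fun t ht =>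
    mul_nonneg (hl.trans (le_of_lt ht)) (innerDensity_pos n l t).le
  refine ⟨integrableOn_Ioi_deriv_of_nonneg' hd h0 ht, ?_⟩
  rw [integral_Ioi_of_hasDerivAt_of_nonneg' hd h0 ht, innerSlope_self]
  have := integral_innerSlope_pow_self_le hn l
  simp only [intervalIntegral.integral_same, one_pow]
  linarith

theorem integral_innerProfile_mul_innerDensity (hn : 1 ≤ n) (hl : 0 ≤ l) :
    IntegrableOn (fun t => innerProfile n l t * innerDensity n l t) (Set.Ioi l) ∧
    ∫ t in Set.Ioi l, innerProfile n l t * innerDensity n l t = l + innerEnergy n l := by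
  have hi : IntegrableOn (fun t => innerProfile n l t * innerDensity n l t) (Set.Ioi l) := by
    refine (integral_id_mul_innerDensity hn hl).1.mono'
      ((isPrim_innerProfile hn l).continuous.mul
        (continuous_innerDensity n l)).aestronglyMeasurable ?_
    filter_upwards [self_mem_ae_restrict measurableSet_Ioi] with t ht
    have h1 := innerProfile_mem hn (le_of_lt ht)
    have h2 := innerDensity_pos n l t
    have h3 : 0 ≤ innerProfile n l t := hl.trans h1.1
    rw [Real.norm_eq_abs, abs_of_nonneg (by positivity)]
    gcongr
    exact h1.2
  refine ⟨hi, ?_⟩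
  have hd : ∀ t, HasDerivAt (fun t => -(innerProfile n l t * innerSlope n l t ^ n))
      (innerProfile n l t * innerDensity n l t - innerSlope n l t ^ (n + 1)) t := fun t =>
    (((hasDerivAt_innerProfile hn l t).mul (hasDerivAt_innerSlope_pow hn l t)).neg).congr_deriv
      (by ring)
  have ht : Tendsto (fun t => -(innerProfile n l t * innerSlope n l t ^ n)) atTop
      (nhds (-(_ * 0))) := ((tendsto_innerProfile hn l).mul (tendsto_innerSlope_pow hn l)).neg
  have h1 := integral_Ioi_of_hasDerivAt_of_tendsto (a := l)
    (hd l).continuousAt.continuousWithinAt (fun t _ => hd t)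
    (hi.sub (integrableOn_innerSlope_pow hn l)) ht
  rw [integral_sub hi (integrableOn_innerSlope_pow hn l), innerSlope_self, innerProfile_self] at h1
  rw [innerEnergy]
  simp only [mul_zero, neg_zero, one_pow, mul_one, zero_sub, neg_neg] at h1
  linarith

theorem integral_innerDensity_mul_log (hn : 1 ≤ n) (l : ℝ) :
    IntegrableOn (fun t => innerDensity n l t * Real.log (innerDensity n l t)) (Set.Ioi l) ∧
    ∫ t in Set.Ioi l, innerDensity n l t * Real.log (innerDensity n l t) ≤
      -hCC n - 1 + 4 * √(n * Real.exp (-l)) := by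
  set m := fun t => innerSlope n l t ^ n with hm
  set c := 1 + Real.exp (-l) with hc
  have hc1 : 1 ≤ c := by linarith [Real.exp_pos (-l)]
  have hanti : StrictAnti m := fun s t h =>
    pow_lt_pow_left₀ (strictAnti_innerSlope hn l h) (innerSlope_pos n l t).le (by omega)
  have hml : m l = 1 := by simp [hm, innerSlope_self]
  have hmc : Continuous m := (continuous_innerSlope n l).pow n
  have him : m '' Set.Ioi l = Set.Ioo 0 1 := by
    apply Set.Subset.antisymm
    · rintro _ ⟨t, ht, rfl⟩
      exact ⟨pow_pos (innerSlope_pos n l t) n, hml ▸ hanti ht⟩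
    · intro s hs
      obtain ⟨R, hR, hlR⟩ := (((tendsto_innerSlope_pow hn l).eventually_lt_const hs.1).and
        (eventually_gt_atTop l)).exists
      obtain ⟨t, ht, rfl⟩ := intermediate_value_Ioo' hlR.le hmc.continuousOn
        (⟨hR, by rw [hml]; exact hs.2⟩ : s ∈ Set.Ioo (m R) (m l))
      exact ⟨t, ht.1, rfl⟩
  have hρ : ∀ t, |-innerDensity n l t| • Real.log (m t - m t ^ cexp n / c) =
      innerDensity n l t * Real.log (innerDensity n l t) := fun t => by
    rw [abs_neg, abs_of_pos (innerDensity_pos n l t), smul_eq_mul]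
    congr 2
    rw [hm]
    simp only
    rw [pow_rpow_cexp hn (innerSlope_pos n l t).le, innerDensity]
    ring
  have hd : ∀ t ∈ Set.Ioi l, HasDerivWithinAt m (-innerDensity n l t) (Set.Ioi l) t := fun t _ =>
    (hasDerivAt_innerSlope_pow hn l t).hasDerivWithinAt
  have h1 := (integrableOn_image_iff_integrableOn_abs_deriv_smul measurableSet_Ioi hd
    hanti.injective.injOn (fun s : ℝ => Real.log (s - s ^ cexp n / c))).1
      (by rw [him]; exact integrableOn_log_profile hn hc1)
  have h2 := integral_image_eq_integral_abs_deriv_smul measurableSet_Ioi hd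
    hanti.injective.injOn (fun s : ℝ => Real.log (s - s ^ cexp n / c))
  simp only [hρ] at h1 h2
  refine ⟨h1, ?_⟩
  rw [← h2, him]
  refine (integral_log_profile_le hn hc1).trans ?_
  gcongr
  have h3 : 1 - 1 / c = Real.exp (-l) / c := by rw [hc]; field_simp; ring
  rw [h3]
  exact div_le_self (Real.exp_pos _).le hc1

/-- Lower bound for the exponential integral of a multiple of the extremal profile. -/
theorem le_lintegral_innerProfile (hn : 1 ≤ n) (hl : 1 ≤ l) {k : ℝ} (hk : 0 < k) :
    ENNReal.ofReal (Real.exp ((k * (l + innerEnergy n l)) ^ cexp n - (l + innerEnergy n l) +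
      hCC n - 4 * √(n * Real.exp (-l)))) ≤
    ∫⁻ t in Set.Ioi l, ENNReal.ofReal (Real.exp ((k * innerProfile n l t) ^ cexp n - t)) := by
  have hl0 : 0 ≤ l := by linarith
  set Q := l + innerEnergy n l with hQ
  have hQ0 : 0 < Q := by have := innerEnergy_nonneg n l; linarith
  set E := (k * Q) ^ cexp n with hE
  set d := cexp n * (k * Q) ^ (cexp n - 1) with hd
  set c₀ := E - Q + hCC n - 4 * √(n * Real.exp (-l)) with hc₀
  set ρ := innerDensity n l with hρ
  have i0 : IntegrableOn ρ (Set.Ioi l) := integrableOn_innerDensity hn l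
  have e0 : ∫ t in Set.Ioi l, ρ t = 1 := integral_innerDensity hn l
  obtain ⟨i1, e1⟩ := integral_id_mul_innerDensity hn hl0
  obtain ⟨i2, e2⟩ := integral_innerProfile_mul_innerDensity hn hl0
  obtain ⟨i3, e3⟩ := integral_innerDensity_mul_log hn l
  rw [← hρ] at i1 e1 i2 e2 i3 e3
  set G : ℝ → ℝ := fun t => Real.exp c₀ * ((1 + E - d * (k * Q) - c₀) * ρ t +
    d * k * (innerProfile n l t * ρ t) - t * ρ t - ρ t * Real.log (ρ t)) with hG
  have iG : IntegrableOn G (Set.Ioi l) :=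
    ((((i0.const_mul _).add (i2.const_mul _)).sub i1).sub i3).const_mul _
  have eG : Real.exp c₀ ≤ ∫ t in Set.Ioi l, G t := by
    have j0 := i0.const_mul (1 + E - d * (k * Q) - c₀)
    have j2 := i2.const_mul (d * k)
    have a1 := integral_sub ((j0.add j2).sub i1) i3
    have a2 := integral_sub (j0.add j2) i1
    have a3 := integral_add j0 j2
    rw [integral_const_mul, integral_const_mul, e0, e2] at a3
    simp only [Pi.add_apply, Pi.sub_apply] at a1 a2
    rw [hG, integral_const_mul, a1, a2, a3]
    refine le_mul_of_one_le_right (Real.exp_pos _).le ?_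
    have : d * k * (l + innerEnergy n l) = d * (k * Q) := by rw [hQ]; ring
    rw [this]
    linarith
  have hle : ∀ t ∈ Set.Ioi l, G t ≤ Real.exp ((k * innerProfile n l t) ^ cexp n - t) := by
    intro t ht
    have hρ0 : 0 < ρ t := innerDensity_pos n l t
    have hΩ : 0 ≤ k * innerProfile n l t :=
      mul_nonneg hk.le (hl0.trans (innerProfile_mem hn (le_of_lt ht)).1)
    have h1 := tangent_le_rpow (one_le_cexp n) (show 0 < k * Q by positivity) hΩ
    set A := (k * innerProfile n l t) ^ cexp n - t with hA
    have h2 := Real.add_one_le_exp (A - Real.log (ρ t) - c₀)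
    have h3 : Real.exp A = Real.exp c₀ * (ρ t * Real.exp (A - Real.log (ρ t) - c₀)) := by
      rw [sub_sub, Real.exp_sub A, Real.exp_add, Real.exp_log hρ0]
      have := Real.exp_pos c₀
      field_simp
    rw [h3, hG]
    refine mul_le_mul_of_nonneg_left ?_ (Real.exp_pos _).le
    calc _ = ρ t * (E + d * (k * innerProfile n l t - k * Q) - t - Real.log (ρ t) - c₀ + 1) := by
          ring
      _ ≤ ρ t * Real.exp (A - Real.log (ρ t) - c₀) := by
          refine mul_le_mul_of_nonneg_left (le_trans ?_ h2) hρ0.le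
          rw [hA]; linarith
  calc ENNReal.ofReal (Real.exp c₀) ≤ ENNReal.ofReal (∫ t in Set.Ioi l, max (G t) 0) := by
        refine ENNReal.ofReal_le_ofReal (eG.trans ?_)
        exact integral_mono iG iG.pos_part fun t => le_max_left _ _
    _ = ∫⁻ t in Set.Ioi l, ENNReal.ofReal (max (G t) 0) :=
        ofReal_integral_eq_lintegral_ofReal iG.pos_part (ae_of_all _ fun t => le_max_right _ _)
    _ ≤ _ := setLIntegral_mono' measurableSet_Ioi fun t ht =>
        ENNReal.ofReal_le_ofReal (max_le (hle t ht) (Real.exp_pos _).le)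

end Inner

/-- The energy to the left of `L`. -/
noncomputable def outE (n : ℕ) (w g : ℝ → ℝ) (L : ℝ) : ℝ≥0∞ :=
  dirE n g (Set.Iio L) + potE n w (Set.Iio L)

theorem dirE_const_mul (n : ℕ) (g : ℝ → ℝ) (S : Set ℝ) (c : ℝ) :
    dirE n (fun t => c * g t) S = ENNReal.ofReal (|c| ^ (n + 1)) * dirE n g S := by
  rw [dirE, dirE, ← lintegral_const_mul' _ _ ENNReal.ofReal_ne_top]
  refine lintegral_congr fun t => ?_
  rw [← ENNReal.ofReal_mul (by positivity), abs_mul, mul_pow]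

theorem potE_const_mul (n : ℕ) (w : ℝ → ℝ) (S : Set ℝ) (c : ℝ) :
    potE n (fun t => c * w t) S = ENNReal.ofReal (|c| ^ (n + 1)) * potE n w S := by
  rw [potE, potE, ← lintegral_const_mul' _ _ ENNReal.ofReal_ne_top]
  refine lintegral_congr fun t => ?_
  rw [← ENNReal.ofReal_mul (by positivity), abs_mul, mul_pow]
  congr 1; ring

theorem outE_const_mul (n : ℕ) (w g : ℝ → ℝ) (L c : ℝ) :
    outE n (fun t => c * w t) (fun t => c * g t) L =
      ENNReal.ofReal (|c| ^ (n + 1)) * outE n w g L := by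
  rw [outE, dirE_const_mul, potE_const_mul, ← mul_add, outE]

/-- The values at `L` of functions of energy at most one to the left of `L`. -/
def outerSet (n : ℕ) (L : ℝ) : Set ℝ :=
  {x | ∃ w g : ℝ → ℝ, IsPrim w g ∧ outE n w g L ≤ 1 ∧ x = |w L| ^ cexp n}

/-- The largest value at `L` of functions of energy at most one to the left of `L`. -/
noncomputable def outerLevel (n : ℕ) (L : ℝ) : ℝ := sSup (outerSet n L)

theorem bddAbove_outerSet (n : ℕ) (L : ℝ) : BddAbove (outerSet n L) := by
  refine ⟨(2 + 2 * Real.exp L) ^ cexp n, ?_⟩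
  rintro _ ⟨w, g, hw, hE, rfl⟩
  refine Real.rpow_le_rpow (abs_nonneg _) (hw.abs_le_exp n ?_ ?_) (cexp_pos n).le
  · exact le_self_add.trans hE
  · exact le_add_self.trans hE

theorem outerLevel_nonneg (n : ℕ) (L : ℝ) : 0 ≤ outerLevel n L :=
  Real.sSup_nonneg (by rintro _ ⟨w, g, -, -, rfl⟩; positivity)

theorem IsPrim.abs_rpow_le_outerLevel {w g : ℝ → ℝ} (hw : IsPrim w g) {n : ℕ} {L : ℝ}
    (h : outE n w g L ≤ 1) : |w L| ^ cexp n ≤ outerLevel n L :=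
  le_csSup (bddAbove_outerSet n L) ⟨w, g, hw, h, rfl⟩

theorem IsPrim.abs_pow_le_outerLevel {w g : ℝ → ℝ} (hw : IsPrim w g) {n : ℕ} (hn : 1 ≤ n)
    {L e : ℝ} (he : 0 < e) (h : outE n w g L ≤ ENNReal.ofReal e) :
    |w L| ^ (n + 1) ≤ e * outerLevel n L ^ n := by
  obtain ⟨κ, hκ0, hκ⟩ := exists_root (n + 1) (by omega) he.le
  have hκp : 0 < κ := by
    rcases hκ0.eq_or_lt with h0 | h0
    · rw [← h0, zero_pow (by omega)] at hκ; linarith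
    · exact h0
  have h1 := (hw.const_mul κ⁻¹).abs_rpow_le_outerLevel (n := n) (L := L) (by
    rw [outE_const_mul, abs_of_pos (by positivity), inv_pow, hκ]
    refine (mul_le_mul_right h _).trans ?_
    rw [← ENNReal.ofReal_mul (by positivity), inv_mul_cancel₀ he.ne', ENNReal.ofReal_one])
  have h2 := pow_le_pow_left₀ (by positivity) h1 n
  rw [rpow_cexp_pow hn (abs_nonneg _), abs_mul, abs_of_pos (inv_pos.2 hκp), mul_pow, inv_pow,
    hκ] at h2
  rwa [inv_mul_le_iff₀ he] at h2

theorem exists_outer_test (n : ℕ) : ∃ C : ℝ, 0 ≤ C ∧ ∀ L : ℝ, 0 ≤ L → ∃ w g : ℝ → ℝ,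
    IsPrim w g ∧ w L = L + 1 ∧ outE n w g L ≤ ENNReal.ofReal (L + 1 + C) := by
  have hfi : IntegrableOn (fun t : ℝ => (t + 1) ^ (n + 1) * Real.exp (-t)) (Set.Ioi (-1)) := by
    refine integrable_of_isBigO_exp_neg (b := 1 / 2) (by norm_num)
      (by fun_prop) ?_
    have h1 : Tendsto (fun t : ℝ => (t + 1) ^ (n + 1) * Real.exp (-t) / Real.exp (-(1 / 2) * t))
        atTop (nhds 0) := by
      have h2 : Tendsto (fun t : ℝ => (2 ^ (n + 1) * Real.exp (1 / 2)) *
          (((1 / 2) * (t + 1)) ^ (n + 1) * Real.exp (-((1 / 2) * (t + 1))))) atTop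
          (nhds ((2 ^ (n + 1) * Real.exp (1 / 2)) * 0)) :=
        ((Real.tendsto_pow_mul_exp_neg_atTop_nhds_zero (n + 1)).comp
          ((tendsto_atTop_add_const_right _ 1 tendsto_id).const_mul_atTop
            (by norm_num : (0 : ℝ) < 1 / 2))).const_mul _
      rw [mul_zero] at h2
      refine h2.congr fun t => ?_
      rw [div_eq_mul_inv ((t + 1) ^ (n + 1) * Real.exp (-t)), ← Real.exp_neg, mul_pow, div_pow,
        one_pow, mul_assoc ((t + 1) ^ (n + 1)), ← Real.exp_add]
      have : Real.exp (-t + -(-(1 / 2) * t)) =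
          Real.exp (1 / 2) * Real.exp (-(1 / 2 * (t + 1))) := by
        rw [← Real.exp_add]; congr 1; ring
      rw [this]
      field_simp
    exact (Asymptotics.isLittleO_of_tendsto (fun t ht => absurd ht (Real.exp_pos _).ne') h1).isBigO
  set C := ∫ t in Set.Ioi (-1 : ℝ), (t + 1) ^ (n + 1) * Real.exp (-t) with hC
  have hnn : ∀ t ∈ Set.Ioi (-1 : ℝ), 0 ≤ (t + 1) ^ (n + 1) * Real.exp (-t) := fun t ht => by
    have : 0 ≤ t + 1 := by linarith [Set.mem_Ioi.1 ht]
    positivity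
  refine ⟨C, setIntegral_nonneg measurableSet_Ioi hnn, fun L hL => ?_⟩
  set g : ℝ → ℝ := Set.indicator (Set.Ioi (-1)) 1 with hg
  have hgi : ∀ a b, IntervalIntegrable g volume a b := fun a b => by
    have h2 : IntervalIntegrable (1 : ℝ → ℝ) volume a b := intervalIntegrable_const (c := 1)
    exact ⟨h2.1.indicator measurableSet_Ioi, h2.2.indicator measurableSet_Ioi⟩
  have hw : IsPrim (fun t => ∫ s in (-1)..t, g s) g :=
    ⟨hgi, fun a b => intervalIntegral.integral_interval_sub_left (hgi _ _) (hgi _ _)⟩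
  have hr : ∀ t, -1 ≤ t → ∫ s in (-1)..t, g s = t + 1 := fun t ht => by
    rw [intervalIntegral.integral_congr_ae (g := fun _ => (1 : ℝ)) (ae_of_all _ fun s hs => by
      rw [Set.uIoc_of_le ht] at hs
      simp [hg, hs.1])]
    simp
  have hl : ∀ t, t ≤ -1 → ∫ s in (-1)..t, g s = 0 := fun t ht => by
    rw [intervalIntegral.integral_congr_ae (g := fun _ => (0 : ℝ)) (ae_of_all _ fun s hs => by
      rw [Set.uIoc_of_ge ht] at hs
      have : ¬ (-1 < s) := not_lt.2 hs.2
      simp [hg, this])]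
    simp
  refine ⟨_, g, hw, hr L (by linarith), ?_⟩
  have hC0 : 0 ≤ C := setIntegral_nonneg measurableSet_Ioi hnn
  rw [outE, ENNReal.ofReal_add (by linarith) hC0]
  refine add_le_add ?_ ?_
  · calc dirE n g (Set.Iio L) ≤ ∫⁻ t in Set.Iio L, (Set.Ioo (-1) L).indicator (fun _ => 1) t := by
          refine setLIntegral_mono' measurableSet_Iio fun t ht => ?_
          by_cases h : -1 < t
          · have : t ∈ Set.Ioo (-1) L := ⟨h, ht⟩
            simp [hg, h, this]
          · simp [hg, h]
      _ ≤ ∫⁻ t, (Set.Ioo (-1) L).indicator (fun _ => 1) t := setLIntegral_le_lintegral _ _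
      _ = _ := by
        rw [lintegral_indicator measurableSet_Ioo, setLIntegral_const, Real.volume_Ioo, one_mul]
        congr 1; ring
  · calc _ ≤ ∫⁻ t in Set.Iio L, (Set.Ioi (-1)).indicator
            (fun t => ENNReal.ofReal ((t + 1) ^ (n + 1) * Real.exp (-t))) t := by
          refine setLIntegral_mono' measurableSet_Iio fun t ht => ?_
          by_cases h : -1 < t
          · simp only [hr t h.le, Set.indicator_of_mem (Set.mem_Ioi.2 h)]
            rw [abs_of_nonneg (by linarith)]
          · simp [hl t (not_lt.1 h)]
      _ ≤ _ := setLIntegral_le_lintegral _ _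
      _ = _ := by
        rw [lintegral_indicator measurableSet_Ioi, hC, ofReal_integral_eq_lintegral_ofReal hfi]
        exact (ae_restrict_iff' measurableSet_Ioi).2 (ae_of_all _ hnn)

theorem exists_outerLevel_pow_ge {n : ℕ} (hn : 1 ≤ n) : ∃ C : ℝ, 0 ≤ C ∧ ∀ L : ℝ, 0 ≤ L →
    (L + 1) ^ (n + 1) ≤ (L + 1 + C) * outerLevel n L ^ n := by
  obtain ⟨C, hC, h⟩ := exists_outer_test n
  refine ⟨C, hC, fun L hL => ?_⟩
  obtain ⟨w, g, hw, h1, h2⟩ := h L hL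
  have := hw.abs_pow_le_outerLevel hn (by linarith) h2
  rwa [h1, abs_of_nonneg (by linarith)] at this

theorem outerLevel_pos {n : ℕ} (hn : 1 ≤ n) {L : ℝ} (hL : 0 ≤ L) : 0 < outerLevel n L := by
  obtain ⟨C, hC, h⟩ := exists_outerLevel_pow_ge hn
  rcases (outerLevel_nonneg n L).eq_or_lt with h0 | h0
  · have h1 := h L hL
    rw [← h0, zero_pow (by omega), mul_zero] at h1
    have : 0 < (L + 1) ^ (n + 1) := by positivity
    linarith
  · exact h0

theorem bddAbove_outerGap {n : ℕ} (hn : 1 ≤ n) :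
    BddAbove ((fun L => L - outerLevel n L) '' Set.Ici 0) := by
  obtain ⟨C, hC, h⟩ := exists_outerLevel_pow_ge hn
  refine ⟨C, ?_⟩
  rintro _ ⟨L, hL : 0 ≤ L, rfl⟩
  change L - outerLevel n L ≤ C
  have hl := outerLevel_nonneg n L
  by_contra! hlt
  have h1 := h L hL
  set l := outerLevel n L
  obtain ⟨k, rfl⟩ : ∃ k, n = k + 1 := ⟨n - 1, by omega⟩
  have h2 : l ^ (k + 1) ≤ l * (L + 1) ^ k := by
    rw [pow_succ']
    gcongr
    linarith
  have h3 : (L + 1 + C) * l ^ (k + 1) ≤ ((L + 1 + C) * (L - C)) * (L + 1) ^ k := by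
    rw [mul_assoc]
    refine mul_le_mul_of_nonneg_left (h2.trans ?_) (by linarith)
    gcongr
    linarith
  have h4 : (L + 1 + C) * (L - C) < (L + 1) ^ 2 := by nlinarith
  have h5 := mul_lt_mul_of_pos_right h4 (show 0 < (L + 1) ^ k by positivity)
  have h6 : (L + 1) ^ 2 * (L + 1) ^ k = (L + 1) ^ (k + 1 + 1) := by ring
  linarith

/-- The largest gap between `L` and the outer level. -/
noncomputable def outerGap (n : ℕ) : ℝ := sSup ((fun L => L - outerLevel n L) '' Set.Ici 0)

theorem le_outerGap {n : ℕ} (hn : 1 ≤ n) {L : ℝ} (hL : 0 ≤ L) :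
    L - outerLevel n L ≤ outerGap n :=
  le_csSup (bddAbove_outerGap hn) ⟨L, hL, rfl⟩

theorem IsPrim.ofReal_pow_div_le {w g : ℝ → ℝ} (hw : IsPrim w g) {n : ℕ} (hn : 1 ≤ n)
    {L : ℝ} (hL : 0 ≤ L) :
    ENNReal.ofReal (|w L| ^ (n + 1) / outerLevel n L ^ n) ≤ outE n w g L := by
  by_cases htop : outE n w g L = ⊤
  · rw [htop]; exact le_top
  have hp := pow_pos (outerLevel_pos hn hL) n
  rw [← ENNReal.ofReal_toReal htop]
  refine ENNReal.ofReal_le_ofReal ?_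
  rw [div_le_iff₀ hp]
  refine le_of_forall_pos_le_add fun ε hε => ?_
  have := hw.abs_pow_le_outerLevel hn (e := (outE n w g L).toReal + ε / outerLevel n L ^ n)
    (by positivity) (by
      rw [← ENNReal.ofReal_toReal htop]
      exact ENNReal.ofReal_le_ofReal (by
        rw [ENNReal.toReal_ofReal toReal_nonneg]
        linarith [show 0 < ε / outerLevel n L ^ n by positivity]))
  rwa [add_mul, div_mul_cancel₀ _ hp.ne'] at this

theorem dirE_Ico (n : ℕ) (g : ℝ → ℝ) (a b : ℝ) :
    dirE n g (Set.Ico a b) = dirE n g (Set.Ioc a b) :=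
  setLIntegral_congr Ico_ae_eq_Ioc

theorem outE_add_dirE (n : ℕ) (w g : ℝ → ℝ) {L R : ℝ} (h : L ≤ R) :
    outE n w g L + dirE n g (Set.Ioc L R) = dirE n g (Set.Iio R) + potE n w (Set.Iio L) := by
  have : dirE n g (Set.Iio R) = dirE n g (Set.Iio L) + dirE n g (Set.Ioc L R) := by
    rw [← dirE_Ico, ← Set.Iio_union_Ico_eq_Iio h]
    exact lintegral_union measurableSet_Ico
      (Set.disjoint_left.2 fun x hx hx' => not_le.2 hx hx'.1)
  rw [outE, this, add_right_comm]

theorem outerLevel_le {n : ℕ} (hn : 1 ≤ n) {L : ℝ} (hL : 0 ≤ L) :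
    outerLevel n L ≤ outerLevel n 0 + L := by
  have hl0 := outerLevel_pos hn le_rfl
  refine Real.sSup_le ?_ (by linarith)
  rintro _ ⟨w, g, hw, hE, rfl⟩
  refine rpow_cexp_le_of_pow_le hn (abs_nonneg _) (by linarith) ?_
  have h1 : outE n w g 0 + dirE n g (Set.Ioc 0 L) ≤ 1 := by
    rw [outE_add_dirE n w g hL]
    exact (add_le_add_right (potE_mono n w (Set.Iio_subset_Iio hL)) _).trans hE
  have hd : dirE n g (Set.Ioc 0 L) ≠ ⊤ := (le_add_self.trans h1).trans_lt one_lt_top |>.ne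
  have h2 := hw.abs_sub_pow_le n hL toReal_nonneg (ENNReal.ofReal_toReal hd).ge
  rw [sub_zero] at h2
  have h3 := add_pow_le_perspective n (abs_nonneg (w 0)) (abs_nonneg _) hl0 hL h2
    fun _ => toReal_nonneg
  have h4 : |w 0| ^ (n + 1) / outerLevel n 0 ^ n + (dirE n g (Set.Ioc 0 L)).toReal ≤ 1 := by
    rw [← ENNReal.ofReal_le_one, ENNReal.ofReal_add (by positivity) toReal_nonneg,
      ENNReal.ofReal_toReal hd]
    exact (add_le_add_left (hw.ofReal_pow_div_le hn le_rfl) _).trans h1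
  have h5 : |w L| ≤ |w 0| + |w L - w 0| := by
    have := abs_sub_abs_le_abs_sub (w L) (w 0); linarith
  calc |w L| ^ (n + 1) ≤ _ := pow_le_pow_left₀ (abs_nonneg _) h5 _
    _ ≤ _ := h3
    _ ≤ _ := mul_le_of_le_one_left (by positivity) h4

/-- Near-maximizers of the outer problem, normalized to have value `outerLevel n L` at `L`. -/
theorem exists_outer_near_max {n : ℕ} (hn : 1 ≤ n) {L η : ℝ} (hL : 0 ≤ L) (hη : 0 < η) :
    ∃ w g : ℝ → ℝ, IsPrim w g ∧ w L = outerLevel n L ∧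
      outE n w g L ≤ ENNReal.ofReal (outerLevel n L + η) := by
  have hl := outerLevel_pos hn hL
  set l := outerLevel n L with hld
  obtain ⟨y, hy0, hy⟩ := exists_root n (by omega) (show 0 ≤ l ^ (n + 1) / (l + η) by positivity)
  have hyl : y < l := by
    refine lt_of_pow_lt_pow_left₀ n hl.le ?_
    rw [hy, div_lt_iff₀ (by positivity), pow_succ]
    exact mul_lt_mul_of_pos_left (by linarith) (by positivity)
  have hne : (outerSet n L).Nonempty := by
    by_contra h
    rw [Set.not_nonempty_iff_eq_empty] at h
    rw [outerLevel, h, Real.sSup_empty] at hld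
    linarith
  obtain ⟨_, ⟨w, g, hw, hE, rfl⟩, hlt⟩ := exists_lt_of_lt_csSup hne hyl
  have h1 := pow_lt_pow_left₀ hlt hy0 (by omega : n ≠ 0)
  rw [rpow_cexp_pow hn (abs_nonneg _), hy, div_lt_iff₀ (by positivity)] at h1
  have hwL : w L ≠ 0 := by
    intro h0
    rw [h0, abs_zero, zero_pow (by omega), zero_mul] at h1
    have : 0 < l ^ (n + 1) := by positivity
    linarith
  refine ⟨_, _, hw.const_mul (l / w L), div_mul_cancel₀ _ hwL, ?_⟩
  rw [outE_const_mul]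
  refine (mul_le_mul_right hE _).trans ?_
  rw [mul_one, abs_div, abs_of_pos hl, div_pow]
  refine ENNReal.ofReal_le_ofReal ?_
  rw [div_le_iff₀ (by positivity)]
  linarith

/-- Admissible profiles for the transformed critical problem. -/
structure Adm (n : ℕ) (w g : ℝ → ℝ) : Prop where
  prim : IsPrim w g
  le_one : dirE n g Set.univ + potE n w Set.univ ≤ 1

/-- The supremum of the transformed critical problem. -/
noncomputable def admSup (n : ℕ) (β : ℝ) : ℝ≥0∞ :=
  ⨆ (w : ℝ → ℝ) (g : ℝ → ℝ) (_ : Adm n w g), mosF n β w Set.univ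

/-- The part of the functional beyond the leading power. -/
noncomputable def psiF (n : ℕ) (β : ℝ) (w : ℝ → ℝ) (S : Set ℝ) : ℝ≥0∞ :=
  ∫⁻ t in S, ENNReal.ofReal (expTail (n + 1) (β * |w t| ^ cexp n) * Real.exp (-t))

/-- The coefficient of the leading power. -/
noncomputable def vanLevel (n : ℕ) (β : ℝ) : ℝ := β ^ n / (n.factorial : ℝ)

theorem vanLevel_pos (n : ℕ) {β : ℝ} (hβ : 0 < β) : 0 < vanLevel n β := by
  unfold vanLevel; positivity

theorem psiF_mono (n : ℕ) (β : ℝ) (w : ℝ → ℝ) {S T : Set ℝ} (h : S ⊆ T) :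
    psiF n β w S ≤ psiF n β w T :=
  lintegral_mono_set h

theorem measurable_potE_integrand {w : ℝ → ℝ} (hw : Continuous w) (n : ℕ) :
    Measurable fun t => ENNReal.ofReal (|w t| ^ (n + 1) * Real.exp (-t)) :=
  ((((continuous_abs.comp hw).pow _).mul (by fun_prop)).measurable).ennreal_ofReal

theorem measurable_psiF_integrand {w : ℝ → ℝ} (hw : Continuous w) (n : ℕ) (β : ℝ) :
    Measurable fun t =>
      ENNReal.ofReal (expTail (n + 1) (β * |w t| ^ cexp n) * Real.exp (-t)) :=
  ((((continuous_expTail _).comp (continuous_const.mul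
    (continuous_abs_rpow_cexp hw n))).mul (by fun_prop)).measurable).ennreal_ofReal

theorem mosF_integrand_eq {n : ℕ} (hn : 1 ≤ n) {β : ℝ} (hβ : 0 ≤ β) (w : ℝ → ℝ) (t : ℝ) :
    ENNReal.ofReal (expTail n (β * |w t| ^ cexp n) * Real.exp (-t)) =
      ENNReal.ofReal (vanLevel n β) * ENNReal.ofReal (|w t| ^ (n + 1) * Real.exp (-t)) +
      ENNReal.ofReal (expTail (n + 1) (β * |w t| ^ cexp n) * Real.exp (-t)) := by
  have hx : 0 ≤ β * |w t| ^ cexp n := by positivity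
  have hv : 0 ≤ vanLevel n β := by unfold vanLevel; positivity
  rw [← ENNReal.ofReal_mul hv, ← ENNReal.ofReal_add (by positivity)
    (mul_nonneg (expTail_nonneg _ hx) (Real.exp_pos _).le), expTail_succ n, mul_pow,
    rpow_cexp_pow hn (abs_nonneg _)]
  congr 1; unfold vanLevel; ring

theorem mosF_eq {n : ℕ} (hn : 1 ≤ n) {β : ℝ} (hβ : 0 ≤ β) {w : ℝ → ℝ} (hw : Continuous w)
    (S : Set ℝ) :
    mosF n β w S = ENNReal.ofReal (vanLevel n β) * potE n w S + psiF n β w S := by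
  unfold mosF potE psiF
  simp_rw [mosF_integrand_eq hn hβ]
  rw [lintegral_add_right _ (measurable_psiF_integrand hw n β),
    lintegral_const_mul _ (measurable_potE_integrand hw n)]

namespace Adm
variable {n : ℕ} {w g : ℝ → ℝ}

theorem dirE_le (h : Adm n w g) (S : Set ℝ) : dirE n g S ≤ 1 :=
  (dirE_mono n g (Set.subset_univ S)).trans (le_self_add.trans h.le_one)

theorem potE_le (h : Adm n w g) (S : Set ℝ) : potE n w S ≤ 1 :=
  (potE_mono n w (Set.subset_univ S)).trans (le_add_self.trans h.le_one)

theorem outE_add_le (h : Adm n w g) (L : ℝ) : outE n w g L + dirE n g (Set.Ioi L) ≤ 1 := by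
  have hd : dirE n g (Set.Iio L) + dirE n g (Set.Ioi L) ≤ dirE n g Set.univ := by
    unfold dirE
    rw [← lintegral_union measurableSet_Ioi
      (Set.disjoint_left.2 fun x hx hy => lt_asymm (Set.mem_Iio.1 hx) (Set.mem_Ioi.1 hy))]
    exact lintegral_mono_set (Set.subset_univ _)
  calc outE n w g L + dirE n g (Set.Ioi L)
      = dirE n g (Set.Iio L) + dirE n g (Set.Ioi L) + potE n w (Set.Iio L) := by
        unfold outE; ring
    _ ≤ dirE n g Set.univ + potE n w Set.univ := add_le_add hd (potE_mono n w (Set.subset_univ _))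
    _ ≤ 1 := h.le_one

theorem mosF_Iic_le (h : Adm n w g) (hn : 1 ≤ n) {β : ℝ} (h0 : 0 ≤ β) (h1 : β ≤ 1) (B : ℝ) :
    mosF n β w (Set.Iic B) ≤
      ENNReal.ofReal (Real.exp ((2 + 2 * Real.exp B) ^ cexp n)) * potE n w (Set.Iic B) := by
  unfold mosF potE
  rw [← lintegral_const_mul _ (measurable_potE_integrand h.prim.continuous n)]
  refine setLIntegral_mono' measurableSet_Iic fun t ht => ?_
  rw [← ENNReal.ofReal_mul (Real.exp_pos _).le]
  refine ENNReal.ofReal_le_ofReal ?_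
  have hx : 0 ≤ |w t| ^ cexp n := by positivity
  have hw : |w t| ≤ 2 + 2 * Real.exp B :=
    (h.prim.abs_le_exp n (h.dirE_le _) (h.potE_le _)).trans
      (by have := Real.exp_le_exp.2 (Set.mem_Iic.1 ht); linarith)
  have hb : β * |w t| ^ cexp n ≤ |w t| ^ cexp n := mul_le_of_le_one_left hx h1
  have h2 : expTail n (β * |w t| ^ cexp n) ≤ |w t| ^ (n + 1) *
      Real.exp ((2 + 2 * Real.exp B) ^ cexp n) := by
    refine (expTail_mono n (by positivity) hb).trans ((expTail_le_pow_mul_exp n hx).trans ?_)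
    rw [rpow_cexp_pow hn (abs_nonneg _)]
    gcongr
    exact (cexp_pos n).le
  nlinarith [mul_le_mul_of_nonneg_right h2 (Real.exp_pos (-t)).le]

end Adm

theorem IsPrim.mosF_tail_le {w g : ℝ → ℝ} (hw : IsPrim w g) {n : ℕ} (hn : 1 ≤ n)
    {L B β e B₀ : ℝ} {C : ℝ≥0∞} (hL : 0 ≤ L) (hLB : L ≤ B) (he : 0 < e) (he1 : e ≤ 1)
    (hβ : 0 ≤ β) (hE : outE n w g L + dirE n g (Set.Ioi L) ≤ ENNReal.ofReal e)
    (hB : B₀ ≤ B - (L - outerLevel n L))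
    (hC : ∀ v r, UnitProfile n v r → mosF n β v (Set.Ioi B₀) ≤ C) :
    mosF n β w (Set.Ioi B) ≤
      ENNReal.ofReal e * (ENNReal.ofReal (Real.exp (-(L - outerLevel n L))) * C) := by
  obtain ⟨κ, hκ0, hκ⟩ := exists_root (n + 1) (Nat.succ_ne_zero n) he.le
  have hκp : 0 < κ := hκ0.lt_of_ne fun h => by rw [← h] at hκ; simp at hκ; linarith
  have hκ1 : κ ≤ 1 := by
    by_contra! h
    have : 1 < κ ^ (n + 1) := one_lt_pow₀ h (Nat.succ_ne_zero n)
    linarith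
  obtain ⟨v, r, hv, hm⟩ := hw.exists_mosF_tail_le hn (outerLevel_pos hn hL) hκp hκ1 hβ hLB
    (by rw [hκ]; exact (add_le_add_left (hw.ofReal_pow_div_le hn hL) _).trans hE)
  rw [hκ] at hm
  refine hm.trans ?_
  gcongr
  exact (mosF_mono n β v (Set.Ioi_subset_Ioi hB)).trans (hC v r hv)

theorem admSup_lt_top {n : ℕ} (hn : 1 ≤ n) {β K : ℝ} (h0 : 0 ≤ β) (h1 : β ≤ 1)
    (hc : ConcBound n β K) : admSup n β < ⊤ := by
  obtain ⟨B₀, hB₀, hC⟩ := hc 1 one_pos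
  set B := max B₀ 0 + |outerLevel n 0|
  have hB0 : 0 ≤ B := by positivity
  have key : ∀ w g, Adm n w g → mosF n β w Set.univ ≤
      ENNReal.ofReal (Real.exp ((2 + 2 * Real.exp B) ^ cexp n)) * 1 +
      ENNReal.ofReal 1 * (ENNReal.ofReal (Real.exp (-(0 - outerLevel n 0))) *
        ENNReal.ofReal (K + 1)) := by
    intro w g h
    have hs : mosF n β w Set.univ = mosF n β w (Set.Iic B) + mosF n β w (Set.Ioi B) := by
      unfold mosF
      rw [← lintegral_union measurableSet_Ioi (Set.Iic_disjoint_Ioi le_rfl), Set.Iic_union_Ioi]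
    rw [hs]
    refine add_le_add ((h.mosF_Iic_le hn h0 h1 B).trans ?_) ?_
    · gcongr; exact h.potE_le _
    · refine h.prim.mosF_tail_le hn le_rfl hB0 one_pos le_rfl h0
        (by simpa using h.outE_add_le 0) (B₀ := B₀) ?_ hC
      have := le_max_left B₀ 0
      have := outerLevel_nonneg n 0
      have := abs_nonneg (outerLevel n 0)
      simp only [B]; linarith
  refine (iSup_le fun w => iSup_le fun g => iSup_le fun h => key w g h).trans_lt ?_
  exact ENNReal.add_lt_top.2 ⟨by simp, by simp [ENNReal.mul_lt_top_iff]⟩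

theorem Adm.le_admSup {n : ℕ} {w g : ℝ → ℝ} (h : Adm n w g) (β : ℝ) :
    mosF n β w Set.univ ≤ admSup n β :=
  le_iSup_of_le w (le_iSup_of_le g (le_iSup_of_le h le_rfl))

theorem IsPrim.sum_abs_sub_le {w g : ℝ → ℝ} (hw : IsPrim w g) (n : ℕ)
    (hD : dirE n g Set.univ ≤ 1) {l : ℝ} (hl : 0 < l) (s : Finset ℕ) (E : ℕ → ℝ × ℝ)
    (hE : Set.PairwiseDisjoint (↑s) fun i => Set.uIoc (E i).1 (E i).2) :
    ∑ i ∈ s, dist (w (E i).1) (w (E i).2) ≤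
      (l ^ n)⁻¹ + l * ∑ i ∈ s, dist (E i).1 (E i).2 := by
  have hintg : IntegrableOn (fun t => |g t| ^ (n + 1)) Set.univ :=
    integrableOn_abs_pow n hw.aestronglyMeasurable.restrict (hD.trans_lt one_lt_top).ne
  have h1 : ∫ t in Set.univ, |g t| ^ (n + 1) ≤ 1 :=
    integral_abs_pow_le n zero_le_one (by simpa using hD)
  have hterm : ∀ i ∈ s, dist (w (E i).1) (w (E i).2) ≤
      (l ^ n)⁻¹ * (∫ t in Set.uIoc (E i).1 (E i).2, |g t| ^ (n + 1)) +
        l * dist (E i).1 (E i).2 := by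
    intro i _
    rw [dist_comm, Real.dist_eq, hw.ftc]
    have hi := hintg.mono_set (Set.subset_univ (Set.uIoc (E i).1 (E i).2))
    have hc : IntegrableOn (fun _ => l) (Set.uIoc (E i).1 (E i).2) :=
      integrableOn_const (by simp [Set.uIoc])
    calc |∫ t in (E i).1..(E i).2, g t| ≤ ∫ t in Set.uIoc (E i).1 (E i).2, |g t| :=
          intervalIntegral.norm_integral_le_integral_norm_uIoc (f := g)
      _ ≤ ∫ t in Set.uIoc (E i).1 (E i).2, ((l ^ n)⁻¹ * |g t| ^ (n + 1) + l) := by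
          refine integral_mono ((intervalIntegrable_iff.1 (hw.int _ _)).abs)
            ((hi.const_mul _).add hc) fun t => ?_
          dsimp only
          have hg := abs_nonneg (g t)
          rcases le_total |g t| l with h | h
          · have : 0 ≤ (l ^ n)⁻¹ * |g t| ^ (n + 1) := by positivity
            linarith
          · have h2 : |g t| ≤ (l ^ n)⁻¹ * |g t| ^ (n + 1) := by
              rw [inv_mul_eq_div, le_div_iff₀ (by positivity), pow_succ, mul_comm]
              gcongr
            linarith
      _ = _ := by
          rw [integral_add (hi.const_mul _) hc, integral_const_mul]
          congr 1
          rw [setIntegral_const, measureReal_def, Real.volume_uIoc, smul_eq_mul, mul_comm,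
            ENNReal.toReal_ofReal (abs_nonneg _), dist_comm, Real.dist_eq]
  have hsum : ∑ i ∈ s, ∫ t in Set.uIoc (E i).1 (E i).2, |g t| ^ (n + 1) ≤ 1 := by
    rw [← integral_biUnion_finset s (fun i _ => measurableSet_uIoc) hE
      fun i _ => hintg.mono_set (Set.subset_univ _)]
    refine le_trans (setIntegral_mono_set hintg (ae_of_all _ fun t => by positivity)
      (Set.subset_univ _).eventuallyLE) h1
  calc _ ≤ ∑ i ∈ s, ((l ^ n)⁻¹ * (∫ t in Set.uIoc (E i).1 (E i).2, |g t| ^ (n + 1)) +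
        l * dist (E i).1 (E i).2) := Finset.sum_le_sum hterm
    _ = (l ^ n)⁻¹ * (∑ i ∈ s, ∫ t in Set.uIoc (E i).1 (E i).2, |g t| ^ (n + 1)) +
        l * ∑ i ∈ s, dist (E i).1 (E i).2 := by
      rw [Finset.sum_add_distrib, Finset.mul_sum, Finset.mul_sum]
    _ ≤ _ := by
      have : 0 < (l ^ n)⁻¹ := by positivity
      nlinarith

/-- Bounded energy makes pointwise limits of primitives absolutely continuous. -/
theorem isPrim_of_tendsto {n : ℕ} (hn : 1 ≤ n) {w g : ℕ → ℝ → ℝ} {v : ℝ → ℝ}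
    (hw : ∀ k, IsPrim (w k) (g k)) (hD : ∀ k, dirE n (g k) Set.univ ≤ 1)
    (hv : ∀ t, Tendsto (fun k => w k t) atTop (nhds (v t))) : IsPrim v (deriv v) := by
  have hac : ∀ a b, AbsolutelyContinuousOnInterval v a b := by
    intro a b
    rw [absolutelyContinuousOnInterval_iff]
    intro ε hε
    set l := max 1 (4 / ε)
    have hl1 : 1 ≤ l := le_max_left _ _
    have hl : 0 < l := by linarith
    refine ⟨ε / (4 * l), by positivity, fun E hE hs => ?_⟩
    have hlim : Tendsto (fun k => ∑ i ∈ Finset.range E.1, dist (w k (E.2 i).1) (w k (E.2 i).2))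
        atTop (nhds (∑ i ∈ Finset.range E.1, dist (v (E.2 i).1) (v (E.2 i).2))) :=
      tendsto_finsetSum _ fun i _ => (hv _).dist (hv _)
    have hb := le_of_tendsto' hlim fun k =>
      (hw k).sum_abs_sub_le n (hD k) hl (Finset.range E.1) E.2 hE.2
    have h1 : (l ^ n)⁻¹ ≤ ε / 4 := by
      have h2 : 4 / ε ≤ l ^ n := (le_max_right _ _).trans (le_self_pow₀ hl1 (by omega))
      rw [← inv_div]
      exact inv_anti₀ (by positivity) h2
    have h3 : l * ∑ i ∈ Finset.range E.1, dist (E.2 i).1 (E.2 i).2 < ε / 4 := by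
      rw [lt_div_iff₀ (by positivity)] at hs
      linarith
    linarith
  exact ⟨fun a b => (hac a b).intervalIntegrable_deriv,
    fun a b => (hac a b).integral_deriv_eq_sub.symm⟩

theorem IsPrim.ae_eq_deriv {w g : ℝ → ℝ} (h : IsPrim w g) : g =ᵐ[volume] deriv w :=
  h.ae_hasDerivAt.mono fun _ ht => ht.deriv.symm

theorem IsPrim.dirE_eq_deriv {w g : ℝ → ℝ} (h : IsPrim w g) (n : ℕ) (S : Set ℝ) :
    dirE n g S = dirE n (deriv w) S := by
  unfold dirE
  refine lintegral_congr_ae ((ae_restrict_of_ae h.ae_eq_deriv).mono fun t ht => ?_)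
  simp only [ht]

theorem IsPrim.deriv {w g : ℝ → ℝ} (h : IsPrim w g) : IsPrim w (deriv w) where
  int a b := (h.int a b).congr_ae (ae_restrict_of_ae h.ae_eq_deriv)
  ftc a b := by
    rw [h.ftc]
    exact intervalIntegral.integral_congr_ae (h.ae_eq_deriv.mono fun t ht _ => ht)

/-- Backward difference quotients do not increase the energy on lower sets. -/
theorem IsPrim.lintegral_slope_le {w g : ℝ → ℝ} (hw : IsPrim w g) (n : ℕ) {S : Set ℝ}
    (hS : IsLowerSet S) {h : ℝ} (hh : 0 < h) :
    ∫⁻ t in S, ENNReal.ofReal (|(w t - w (t - h)) / h| ^ (n + 1)) ≤ dirE n g S := by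
  rw [hw.dirE_eq_deriv]
  replace hw := hw.deriv
  set G : ℝ → ℝ≥0∞ := fun t => ENNReal.ofReal (|_root_.deriv w t| ^ (n + 1))
  have hG : Measurable G :=
    ((measurable_deriv w).abs.pow_const _).ennreal_ofReal
  have hpt : ∀ t, ENNReal.ofReal (|(w t - w (t - h)) / h| ^ (n + 1)) ≤
      ENNReal.ofReal h⁻¹ * ∫⁻ s in Set.Ioc 0 h, G (t - s) := by
    intro t
    have hchange : ∫⁻ s in Set.Ioc 0 h, G (t - s) =
        dirE n (_root_.deriv w) (Set.Ico (t - h) t) := by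
      have := (Measure.measurePreserving_sub_left
        (volume : Measure ℝ) t).setLIntegral_comp_preimage_emb
        (MeasurableEquiv.subLeft t).measurableEmbedding G (Set.Ico (t - h) t)
      rw [show (fun x => t - x) ⁻¹' Set.Ico (t - h) t = Set.Ioc 0 h by
        ext x; simp only [Set.mem_preimage, Set.mem_Ico, Set.mem_Ioc]
        constructor <;> rintro ⟨_, _⟩ <;> constructor <;> linarith] at this
      exact this
    rw [hchange, dirE_Ico]
    by_cases htop : dirE n (_root_.deriv w) (Set.Ioc (t - h) t) = ⊤
    · rw [htop, ENNReal.mul_top (by simpa using hh)]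
      exact le_top
    · have hb := hw.abs_sub_pow_le n (by linarith : t - h ≤ t) ENNReal.toReal_nonneg
        (ENNReal.ofReal_toReal htop).ge
      rw [← ENNReal.ofReal_toReal htop, ← ENNReal.ofReal_mul (by positivity)]
      refine ENNReal.ofReal_le_ofReal ?_
      rw [abs_div, abs_of_pos hh, div_pow, div_le_iff₀ (by positivity)]
      rw [_root_.sub_sub_cancel] at hb
      calc _ ≤ _ := hb
        _ = _ := by field_simp; ring
  calc _ ≤ ∫⁻ t in S, ENNReal.ofReal h⁻¹ * ∫⁻ s in Set.Ioc 0 h, G (t - s) :=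
        lintegral_mono hpt
    _ = ENNReal.ofReal h⁻¹ * ∫⁻ t in S, ∫⁻ s in Set.Ioc 0 h, G (t - s) :=
        lintegral_const_mul' _ _ ENNReal.ofReal_ne_top
    _ = ENNReal.ofReal h⁻¹ * ∫⁻ s in Set.Ioc 0 h, ∫⁻ t in S, G (t - s) := by
        rw [lintegral_lintegral_swap]
        exact (hG.comp (measurable_fst.sub measurable_snd)).aemeasurable
    _ ≤ ENNReal.ofReal h⁻¹ * ∫⁻ s in Set.Ioc 0 h, dirE n (_root_.deriv w) S := by
        gcongr ENNReal.ofReal h⁻¹ * ?_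
        refine setLIntegral_mono' measurableSet_Ioc fun s hs => ?_
        have := (measurePreserving_sub_right (volume : Measure ℝ) s).setLIntegral_comp_preimage_emb
          (MeasurableEquiv.subRight s).measurableEmbedding G S
        rw [show dirE n (_root_.deriv w) S = ∫⁻ t in S, G t from rfl, ← this]
        refine lintegral_mono_set fun t ht => ?_
        exact hS (by linarith [hs.1] : t - s ≤ t) ht
    _ = _ := by
        rw [setLIntegral_const, Real.volume_Ioc, sub_zero, mul_comm (dirE _ _ _), ← mul_assoc,
          ← ENNReal.ofReal_mul (by positivity), inv_mul_cancel₀ hh.ne']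
        simp

/-- Lower semicontinuity of the energy on lower sets under pointwise convergence. -/
theorem dirE_le_liminf {n : ℕ} {w g : ℕ → ℝ → ℝ} {v r : ℝ → ℝ}
    (hw : ∀ k, IsPrim (w k) (g k)) (hr : IsPrim v r)
    (hv : ∀ t, Tendsto (fun k => w k t) atTop (nhds (v t))) {S : Set ℝ} (hS : IsLowerSet S) :
    dirE n r S ≤ liminf (fun k => dirE n (g k) S) atTop := by
  have hslope : ∀ h : ℝ, 0 < h → ∫⁻ t in S, ENNReal.ofReal (|(v t - v (t - h)) / h| ^ (n + 1)) ≤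
      liminf (fun k => dirE n (g k) S) atTop := by
    intro h hh
    calc ∫⁻ t in S, ENNReal.ofReal (|(v t - v (t - h)) / h| ^ (n + 1))
        = ∫⁻ t in S, liminf (fun k =>
            ENNReal.ofReal (|(w k t - w k (t - h)) / h| ^ (n + 1))) atTop := by
          congr 1; ext t
          refine (Tendsto.liminf_eq ?_).symm
          exact ENNReal.tendsto_ofReal (((((hv t).sub (hv (t - h))).div_const h).abs).pow _)
      _ ≤ liminf (fun k => ∫⁻ t in S,
            ENNReal.ofReal (|(w k t - w k (t - h)) / h| ^ (n + 1))) atTop := by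
          refine lintegral_liminf_le fun k => ?_
          have := (hw k).continuous
          exact (by fun_prop : Continuous fun t =>
            |(w k t - w k (t - h)) / h| ^ (n + 1)).measurable.ennreal_ofReal
      _ ≤ _ := liminf_le_liminf (Eventually.of_forall fun k => (hw k).lintegral_slope_le n hS hh)
  set h : ℕ → ℝ := fun j => ((j : ℝ) + 1)⁻¹
  have hh : ∀ j, 0 < h j := fun j => by positivity
  have hlim : Tendsto (fun j => -h j) atTop (nhdsWithin 0 {0}ᶜ) := by
    refine tendsto_nhdsWithin_iff.2 ⟨?_, Eventually.of_forall fun j => by simp [(hh j).ne']⟩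
    have := (tendsto_one_div_add_atTop_nhds_zero_nat (𝕜 := ℝ)).neg
    simpa [h] using this
  calc dirE n r S = ∫⁻ t in S, liminf (fun j =>
        ENNReal.ofReal (|(v t - v (t - h j)) / h j| ^ (n + 1))) atTop := by
        refine lintegral_congr_ae ((ae_restrict_of_ae hr.ae_hasDerivAt).mono fun t ht => ?_)
        refine (Tendsto.liminf_eq ?_).symm
        have h2 := (hasDerivAt_iff_tendsto_slope_zero.1 ht).comp hlim
        have h3 : Tendsto (fun j => (v t - v (t - h j)) / h j) atTop (nhds (r t)) := by
          refine h2.congr fun j => ?_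
          have := (hh j).ne'
          simp only [Function.comp_apply, smul_eq_mul, ← sub_eq_add_neg]
          field_simp
          ring
        exact ENNReal.tendsto_ofReal (h3.abs.pow _)
    _ ≤ liminf (fun j => ∫⁻ t in S,
          ENNReal.ofReal (|(v t - v (t - h j)) / h j| ^ (n + 1))) atTop := by
        refine lintegral_liminf_le fun j => ?_
        have := hr.continuous
        exact (by fun_prop : Continuous fun t =>
          |(v t - v (t - h j)) / h j| ^ (n + 1)).measurable.ennreal_ofReal
    _ ≤ liminf (fun _ => liminf (fun k => dirE n (g k) S) atTop) atTop :=
        liminf_le_liminf (Eventually.of_forall fun j => hslope _ (hh j))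
    _ = _ := by simp

theorem potE_le_liminf {n : ℕ} {w : ℕ → ℝ → ℝ} {v : ℝ → ℝ} (hw : ∀ k, Continuous (w k))
    (hv : ∀ t, Tendsto (fun k => w k t) atTop (nhds (v t))) (S : Set ℝ) :
    potE n v S ≤ liminf (fun k => potE n (w k) S) atTop := by
  calc potE n v S = ∫⁻ t in S, liminf (fun k =>
        ENNReal.ofReal (|w k t| ^ (n + 1) * Real.exp (-t))) atTop := by
        unfold potE
        congr 1; ext t
        exact (Tendsto.liminf_eq (ENNReal.tendsto_ofReal
          (((hv t).abs.pow _).mul_const _))).symm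
    _ ≤ _ := lintegral_liminf_le fun k => measurable_potE_integrand (hw k) n

theorem IsPrim.abs_sub_pow_le_dist {w g : ℝ → ℝ} (hw : IsPrim w g) (n : ℕ)
    (hD : dirE n g Set.univ ≤ 1) (s t : ℝ) : |w t - w s| ^ (n + 1) ≤ |t - s| ^ n := by
  have key : ∀ a b, a ≤ b → |w b - w a| ^ (n + 1) ≤ |b - a| ^ n := fun a b hab => by
    have := hw.abs_sub_pow_le n hab zero_le_one
      (by simpa using (dirE_mono n g (Set.subset_univ _)).trans hD)
    rwa [one_mul, ← abs_of_nonneg (sub_nonneg.2 hab)] at this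
  rcases le_total s t with h | h
  · exact key s t h
  · rw [abs_sub_comm, abs_sub_comm t s]; exact key t s h

theorem exists_subseq_tendsto {n : ℕ} (hn : 1 ≤ n) {w g : ℕ → ℝ → ℝ}
    (h : ∀ k, Adm n (w k) (g k)) : ∃ (φ : ℕ → ℕ) (v : ℝ → ℝ), StrictMono φ ∧
      ∀ t, Tendsto (fun k => w (φ k) t) atTop (nhds (v t)) := by
  have hcomp : IsCompact (Set.univ.pi fun q : ℚ =>
      Set.Icc (-(2 + 2 * Real.exp q)) (2 + 2 * Real.exp q)) :=
    isCompact_univ_pi fun _ => isCompact_Icc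
  obtain ⟨f, _, φ, hφ, hf⟩ := hcomp.tendsto_subseq (x := fun k (q : ℚ) => w k q)
    fun k q _ => abs_le.1 ((h k).prim.abs_le_exp n ((h k).dirE_le _) ((h k).potE_le _))
  rw [tendsto_pi_nhds] at hf
  have hcau : ∀ t, CauchySeq fun k => w (φ k) t := by
    intro t
    rw [Metric.cauchySeq_iff']
    intro ε hε
    obtain ⟨q, hq1, hq2⟩ := exists_rat_btwn
      (lt_add_of_pos_right t (by positivity : 0 < min 1 ((ε / 4) ^ (n + 1))))
    have hq : ∀ k, |w k t - w k q| < ε / 4 := fun k => by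
      have h1 := (h k).prim.abs_sub_pow_le_dist n ((h k).dirE_le _) q t
      have h2 : |t - q| < min 1 ((ε / 4) ^ (n + 1)) := by rw [abs_lt]; constructor <;> linarith
      refine lt_of_pow_lt_pow_left₀ (n + 1) (by positivity) (h1.trans_lt ?_)
      exact (pow_le_of_le_one (abs_nonneg _) (h2.trans_le (min_le_left _ _)).le (by omega)).trans_lt
        (h2.trans_le (min_le_right _ _))
    obtain ⟨N, hN⟩ := Metric.cauchySeq_iff'.1 (hf q).cauchySeq (ε / 4) (by positivity)
    refine ⟨N, fun k hk => ?_⟩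
    have h3 := hN k hk
    have h4 := abs_lt.1 (hq (φ k))
    have h5 := abs_lt.1 (hq (φ N))
    simp only [Function.comp_apply, Real.dist_eq] at h3 ⊢
    rw [abs_lt] at h3 ⊢
    constructor <;> linarith
  choose v hv using fun t => cauchySeq_tendsto_of_complete (hcau t)
  exact ⟨φ, v, hφ, hv⟩

theorem Adm.psiF_Iic_le {n : ℕ} {w g : ℝ → ℝ} (h : Adm n w g) (hn : 1 ≤ n) {β δ a : ℝ}
    (h0 : 0 ≤ β) (h1 : β ≤ 1) (hδ : 0 < δ) (hδ1 : 2 * δ ≤ 1) (ha : Real.exp a < δ ^ (n + 3)) :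
    psiF n β w (Set.Iic a) ≤ ENNReal.ofReal (2 * δ * Real.exp 1) := by
  calc psiF n β w (Set.Iic a)
      ≤ ∫⁻ t in Set.Iic a, ENNReal.ofReal (2 * δ * Real.exp 1) *
          ENNReal.ofReal (|w t| ^ (n + 1) * Real.exp (-t)) := by
        refine setLIntegral_mono' measurableSet_Iic fun t ht => ?_
        rw [← ENNReal.ofReal_mul (by positivity)]
        refine ENNReal.ofReal_le_ofReal ?_
        have hw : |w t| ≤ 2 * δ := h.prim.abs_le_of_exp_lt hn (h.dirE_le _) (h.potE_le _) hδ
          (by linarith) ((Real.exp_le_exp.2 ht).trans_lt ha)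
        have hx : 0 ≤ |w t| ^ cexp n := by positivity
        have hx1 : |w t| ^ cexp n ≤ |w t| :=
          Real.rpow_le_self_of_le_one (abs_nonneg _) (hw.trans hδ1) (one_le_cexp n)
        have h2 : expTail (n + 1) (β * |w t| ^ cexp n) ≤
            |w t| ^ (n + 1) * (2 * δ * Real.exp 1) := by
          refine (expTail_mono _ (by positivity) (mul_le_of_le_one_left hx h1)).trans
            ((expTail_le_pow_mul_exp _ hx).trans ?_)
          rw [pow_succ, rpow_cexp_pow hn (abs_nonneg _), mul_assoc]
          gcongr
          · exact hx1.trans hw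
          · exact hx1.trans (hw.trans hδ1)
        nlinarith [mul_le_mul_of_nonneg_right h2 (Real.exp_pos (-t)).le]
    _ = ENNReal.ofReal (2 * δ * Real.exp 1) * potE n w (Set.Iic a) :=
        lintegral_const_mul _ (measurable_potE_integrand h.prim.continuous n)
    _ ≤ _ := mul_le_of_le_one_right' (h.potE_le _)

theorem tendsto_psiF_integrand {n : ℕ} {β : ℝ} {w : ℕ → ℝ → ℝ} {v : ℝ → ℝ} {t : ℝ}
    (hv : Tendsto (fun k => w k t) atTop (nhds (v t))) :
    Tendsto (fun k => ENNReal.ofReal (expTail (n + 1) (β * |w k t| ^ cexp n) * Real.exp (-t)))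
      atTop (nhds (ENNReal.ofReal (expTail (n + 1) (β * |v t| ^ cexp n) * Real.exp (-t)))) := by
  refine ENNReal.tendsto_ofReal (Tendsto.mul_const _ ?_)
  exact ((continuous_expTail _).tendsto _).comp
    ((hv.abs.rpow_const (Or.inr (cexp_pos n).le)).const_mul β)

theorem eventually_le_add_of_tendsto {f : ℕ → ℝ≥0∞} {a ε : ℝ≥0∞}
    (h : Tendsto f atTop (nhds a)) (hε : ε ≠ 0) : ∀ᶠ k in atTop, f k ≤ a + ε := by
  by_cases ha : a = ⊤
  · simp [ha]
  · exact (h.eventually_lt_const (ENNReal.lt_add_right ha hε)).mono fun _ hk => hk.le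

theorem psiF_Iic_union_Ioi (n : ℕ) (β : ℝ) (w : ℝ → ℝ) (B : ℝ) :
    psiF n β w (Set.Iic B) + psiF n β w (Set.Ioi B) = psiF n β w Set.univ := by
  unfold psiF
  rw [← lintegral_union measurableSet_Ioi (Set.Iic_disjoint_Ioi le_rfl), Set.Iic_union_Ioi]

theorem psiF_Iic_union_Ioc (n : ℕ) (β : ℝ) (w : ℝ → ℝ) {a B : ℝ} (h : a ≤ B) :
    psiF n β w (Set.Iic a) + psiF n β w (Set.Ioc a B) = psiF n β w (Set.Iic B) := by
  unfold psiF
  rw [← lintegral_union measurableSet_Ioc (Set.Iic_disjoint_Ioc le_rfl),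
    Set.Iic_union_Ioc_eq_Iic h]

theorem eventually_psiF_Iic_le {n : ℕ} (hn : 1 ≤ n) {w g : ℕ → ℝ → ℝ} {v : ℝ → ℝ} {β : ℝ}
    (h0 : 0 ≤ β) (h1 : β ≤ 1) (h : ∀ k, Adm n (w k) (g k))
    (hv : ∀ t, Tendsto (fun k => w k t) atTop (nhds (v t))) (B : ℝ) {ε : ℝ} (hε : 0 < ε) :
    ∀ᶠ k in atTop, psiF n β (w k) (Set.Iic B) ≤ psiF n β v (Set.Iic B) + ENNReal.ofReal ε := by
  set δ := min (1 / 2) (ε / (4 * Real.exp 1))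
  have hδ : 0 < δ := by positivity
  have hδ1 : 2 * δ ≤ 1 := by linarith [min_le_left (1 / 2) (ε / (4 * Real.exp 1))]
  have hδ2 : 2 * δ * Real.exp 1 ≤ ε / 2 := by
    have := min_le_right (1 / 2) (ε / (4 * Real.exp 1))
    calc 2 * δ * Real.exp 1 ≤ 2 * (ε / (4 * Real.exp 1)) * Real.exp 1 := by gcongr
      _ = ε / 2 := by field_simp; norm_num
  obtain ⟨a, ha⟩ : ∃ a, Real.exp a < δ ^ (n + 3) ∧ a ≤ B :=
    ((Real.tendsto_exp_atBot.eventually_lt_const (by positivity)).and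
      (eventually_le_atBot B)).exists
  have hlim : Tendsto (fun k => psiF n β (w k) (Set.Ioc a B)) atTop
      (nhds (psiF n β v (Set.Ioc a B))) := by
    refine tendsto_lintegral_of_dominated_convergence
      (fun _ => ENNReal.ofReal (Real.exp ((2 + 2 * Real.exp B) ^ cexp n) * Real.exp (-a)))
      (fun k => measurable_psiF_integrand (h k).prim.continuous n β) (fun k => ?_) ?_
      (ae_of_all _ fun t => tendsto_psiF_integrand (hv t))
    · refine (ae_restrict_iff' measurableSet_Ioc).2 (ae_of_all _ fun t ht => ?_)
      refine ENNReal.ofReal_le_ofReal ?_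
      have hx : 0 ≤ |w k t| ^ cexp n := by positivity
      have hw : |w k t| ≤ 2 + 2 * Real.exp B :=
        ((h k).prim.abs_le_exp n ((h k).dirE_le _) ((h k).potE_le _)).trans
          (by have := Real.exp_le_exp.2 ht.2; linarith)
      refine mul_le_mul ((expTail_le_exp _ (by positivity)).trans (Real.exp_le_exp.2 ?_))
        (Real.exp_le_exp.2 (by linarith [ht.1])) (Real.exp_pos _).le (Real.exp_pos _).le
      exact (mul_le_of_le_one_left hx h1).trans
        (Real.rpow_le_rpow (abs_nonneg _) hw (cexp_pos n).le)
    · rw [setLIntegral_const]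
      exact ENNReal.mul_ne_top ENNReal.ofReal_ne_top (by simp)
  filter_upwards [eventually_le_add_of_tendsto hlim
    (by simpa using half_pos hε : ENNReal.ofReal (ε / 2) ≠ 0)] with k hk
  rw [← psiF_Iic_union_Ioc n β (w k) ha.2]
  calc _ ≤ ENNReal.ofReal (ε / 2) + (psiF n β v (Set.Ioc a B) + ENNReal.ofReal (ε / 2)) :=
        add_le_add (((h k).psiF_Iic_le hn h0 h1 hδ hδ1 ha.1).trans
          (ENNReal.ofReal_le_ofReal hδ2)) hk
    _ = psiF n β v (Set.Ioc a B) + ENNReal.ofReal ε := by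
        rw [show ε = ε / 2 + ε / 2 by ring, ENNReal.ofReal_add (by linarith) (by linarith)]
        simp only [add_halves]; ring
    _ ≤ _ := by gcongr; exact psiF_mono n β v Set.Ioc_subset_Iic_self

theorem dirE_Iio_add_Ioi_le (n : ℕ) (g : ℝ → ℝ) (B : ℝ) :
    dirE n g (Set.Iio B) + dirE n g (Set.Ioi B) ≤ dirE n g Set.univ := by
  unfold dirE
  rw [← lintegral_union measurableSet_Ioi
    (Set.disjoint_left.2 fun x hx hy => lt_asymm (Set.mem_Iio.1 hx) (Set.mem_Ioi.1 hy))]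
  exact lintegral_mono_set (Set.subset_univ _)

/-- If part of the energy stays in a bounded region, the growth is uniformly subcritical. -/
theorem Adm.exists_subcritical {n : ℕ} (hn : 1 ≤ n) (B : ℝ) {δ : ℝ} (hδ : 0 < δ) (hδ1 : δ ≤ 1) :
    ∃ κ a : ℝ, 0 ≤ κ ∧ κ < 1 ∧ ∀ w g, Adm n w g → ENNReal.ofReal δ ≤ dirE n g (Set.Iio B) →
      ∀ t, B ≤ t → |w t| ^ cexp n ≤ κ * (a + (t - B)) := by
  obtain ⟨κ, hκ0, hκ⟩ := exists_root n (by omega) (by linarith : 0 ≤ 1 - δ / 2)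
  have hκ1 : κ < 1 := by
    by_contra! hc
    have := one_le_pow₀ hc (n := n)
    linarith
  set X := 2 + 2 * Real.exp B
  have hX : 0 < X := by positivity
  set a := max 1 (X ^ (n + 1) / (δ / 2))
  have ha1 : 1 ≤ a := le_max_left _ _
  have ha : X ^ (n + 1) / a ^ n ≤ δ / 2 := by
    have h1 : X ^ (n + 1) / (δ / 2) ≤ a ^ n :=
      (le_max_right _ _).trans (le_self_pow₀ ha1 (by omega))
    rw [div_le_iff₀ (by positivity)] at h1 ⊢
    linarith
  refine ⟨κ, a, hκ0, hκ1, fun w g h hd t ht => ?_⟩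
  have hd2 : dirE n g (Set.Ioi B) ≤ ENNReal.ofReal (1 - δ) := by
    rw [ENNReal.ofReal_sub _ hδ.le, ENNReal.ofReal_one]
    refine ENNReal.le_sub_of_add_le_left ENNReal.ofReal_ne_top ?_
    exact (add_le_add_left hd _).trans ((dirE_Iio_add_Ioi_le n g B).trans (h.dirE_le _))
  have hy := h.prim.abs_sub_pow_le n ht (by linarith : 0 ≤ 1 - δ)
    ((dirE_mono n g Set.Ioc_subset_Ioi_self).trans hd2)
  have hx : |w B| ≤ X := h.prim.abs_le_exp n (h.dirE_le _) (h.potE_le _)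
  have hp := add_pow_le_perspective n (abs_nonneg (w B)) (abs_nonneg (w t - w B))
    (by linarith : 0 < a) (by linarith : 0 ≤ t - B) hy (fun _ => by linarith)
  refine rpow_cexp_le_of_pow_le hn (abs_nonneg _) (by have : 0 ≤ t - B := by linarith
                                                      positivity) ?_
  calc |w t| ^ (n + 1) ≤ (|w B| + |w t - w B|) ^ (n + 1) := by
        gcongr
        calc |w t| = |w B + (w t - w B)| := by ring_nf
          _ ≤ _ := abs_add_le _ _
    _ ≤ _ := hp
    _ ≤ (δ / 2 + (1 - δ)) * (a + (t - B)) ^ n := by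
        have : 0 ≤ t - B := by linarith
        have h2 : |w B| ^ (n + 1) / a ^ n ≤ δ / 2 := le_trans (by gcongr) ha
        exact mul_le_mul_of_nonneg_right (by linarith) (by positivity)
    _ = (κ * (a + (t - B))) ^ n := by rw [mul_pow, hκ]; ring

theorem dirE_comp_add (n : ℕ) (g : ℝ → ℝ) (c : ℝ) :
    dirE n (fun t => g (t + c)) Set.univ = dirE n g Set.univ := by
  unfold dirE
  simp only [Measure.restrict_univ]
  exact lintegral_add_right_eq_self (fun t => ENNReal.ofReal (|g t| ^ (n + 1))) c

theorem lintegral_comp_add_mul_exp (F : ℝ → ℝ) (c : ℝ) :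
    ∫⁻ t in Set.univ, ENNReal.ofReal (F (t + c) * Real.exp (-t)) =
      ENNReal.ofReal (Real.exp c) * ∫⁻ t in Set.univ, ENNReal.ofReal (F t * Real.exp (-t)) := by
  rw [← lintegral_const_mul' _ _ ENNReal.ofReal_ne_top]
  simp only [Measure.restrict_univ]
  rw [← lintegral_add_right_eq_self (fun t =>
    ENNReal.ofReal (Real.exp c) * ENNReal.ofReal (F t * Real.exp (-t))) c]
  congr 1; ext t
  rw [← ENNReal.ofReal_mul (Real.exp_pos _).le, show -t = c + -(t + c) by ring, Real.exp_add]
  congr 1; ring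

theorem potE_comp_add (n : ℕ) (w : ℝ → ℝ) (c : ℝ) :
    potE n (fun t => w (t + c)) Set.univ =
      ENNReal.ofReal (Real.exp c) * potE n w Set.univ :=
  lintegral_comp_add_mul_exp (fun t => |w t| ^ (n + 1)) c

theorem psiF_comp_add (n : ℕ) (β : ℝ) (w : ℝ → ℝ) (c : ℝ) :
    psiF n β (fun t => w (t + c)) Set.univ =
      ENNReal.ofReal (Real.exp c) * psiF n β w Set.univ :=
  lintegral_comp_add_mul_exp (fun t => expTail (n + 1) (β * |w t| ^ cexp n)) c

theorem potE_pos {w : ℝ → ℝ} (hw : Continuous w) (n : ℕ) (h0 : w ≠ 0) :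
    0 < potE n w Set.univ := by
  refine pos_iff_ne_zero.2 fun h => h0 ?_
  unfold potE at h
  rw [lintegral_eq_zero_iff (measurable_potE_integrand hw n), Measure.restrict_univ] at h
  refine (Continuous.ae_eq_iff_eq volume hw continuous_zero).1 (h.mono fun t ht => ?_)
  have h1 := ENNReal.ofReal_eq_zero.1 ht
  have h2 : |w t| ^ (n + 1) ≤ 0 := by
    by_contra! hc
    have := mul_pos hc (Real.exp_pos (-t))
    linarith
  have := pow_eq_zero_iff (n.succ_ne_zero) |>.1 (le_antisymm h2 (by positivity))
  simpa using this

theorem Adm.exists_dirE_pos {n : ℕ} (hn : 1 ≤ n) {w g : ℝ → ℝ} (h : Adm n w g) (h0 : w ≠ 0) :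
    ∃ B, 0 < dirE n g (Set.Iio B) := by
  by_contra! hc
  have hconst : ∀ a b, a ≤ b → w b = w a := by
    intro a b hab
    have h1 : dirE n g (Set.Ioc a b) ≤ ENNReal.ofReal 0 := by
      rw [ENNReal.ofReal_zero]
      exact (dirE_mono n g fun t ht => Set.mem_Iio.2 (ht.2.trans_lt (lt_add_one b))).trans
        (hc (b + 1))
    have h2 := h.prim.abs_sub_pow_le n hab le_rfl h1
    rw [zero_mul] at h2
    have := pow_eq_zero_iff (n.succ_ne_zero) |>.1 (le_antisymm h2 (by positivity))
    exact sub_eq_zero.1 (abs_eq_zero.1 this)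
  refine h0 (funext fun b => ?_)
  rw [Pi.zero_apply, ← abs_nonpos_iff]
  refine le_of_forall_pos_le_add fun ε hε => ?_
  set δ := min 1 (ε / 2)
  have hδ : 0 < δ := by positivity
  obtain ⟨a, ha⟩ : ∃ a, Real.exp a < δ ^ (n + 3) ∧ a ≤ b :=
    ((Real.tendsto_exp_atBot.eventually_lt_const (by positivity)).and
      (eventually_le_atBot b)).exists
  have := h.prim.abs_le_of_exp_lt hn (h.dirE_le _) (h.potE_le _) hδ (min_le_left _ _) ha.1
  rw [hconst a b ha.2]
  linarith [min_le_right 1 (ε / 2)]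

theorem Adm.exists_seq {n : ℕ} (β : ℝ) : ∃ w g : ℕ → ℝ → ℝ, (∀ k, Adm n (w k) (g k)) ∧
    Tendsto (fun k => mosF n β (w k) Set.univ) atTop (nhds (admSup n β)) := by
  set S : Set ℝ≥0∞ := {m | ∃ w g, Adm n w g ∧ mosF n β w Set.univ = m}
  have hS : admSup n β = sSup S := by
    refine le_antisymm (iSup_le fun w => iSup_le fun g => iSup_le fun h =>
      le_sSup ⟨w, g, h, rfl⟩) (sSup_le ?_)
    rintro _ ⟨w, g, h, rfl⟩
    exact h.le_admSup β
  have hne : S.Nonempty := by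
    refine ⟨_, fun _ => 0, fun _ => 0, ⟨⟨fun a b => by simp, fun a b => by simp⟩, ?_⟩, rfl⟩
    simp [dirE, potE]
  obtain ⟨u, -, hu, hm⟩ := exists_seq_tendsto_sSup hne (OrderTop.bddAbove S)
  choose w g h he using hm
  exact ⟨w, g, h, by simp_rw [he, hS]; exact hu⟩

theorem eventually_psiF_le {n : ℕ} (hn : 1 ≤ n) {w g : ℕ → ℝ → ℝ} {v : ℝ → ℝ} {β : ℝ}
    (h0 : 0 ≤ β) (h1 : β ≤ 1) (h : ∀ k, Adm n (w k) (g k)) (hA : Adm n v (deriv v))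
    (hne : v ≠ 0) (hv : ∀ t, Tendsto (fun k => w k t) atTop (nhds (v t))) {ε : ℝ} (hε : 0 < ε) :
    ∀ᶠ k in atTop, psiF n β (w k) Set.univ ≤ psiF n β v Set.univ + ENNReal.ofReal ε := by
  obtain ⟨B, hB⟩ := hA.exists_dirE_pos hn hne
  have hfin : dirE n (deriv v) (Set.Iio B) ≠ ⊤ := ((hA.dirE_le _).trans_lt one_lt_top).ne
  set δ := (dirE n (deriv v) (Set.Iio B)).toReal / 2
  have hpos := ENNReal.toReal_pos hB.ne' hfin
  have hδ : 0 < δ := by positivity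
  have hδ1 : δ ≤ 1 := by
    have := ENNReal.toReal_mono one_ne_top (hA.dirE_le (Set.Iio B))
    rw [ENNReal.toReal_one] at this
    simp only [δ]; linarith
  have hlt : ENNReal.ofReal δ < dirE n (deriv v) (Set.Iio B) := by
    rw [ENNReal.ofReal_lt_iff_lt_toReal hδ.le hfin]
    simp only [δ]; linarith
  have hev : ∀ᶠ k in atTop, ENNReal.ofReal δ < dirE n (g k) (Set.Iio B) :=
    eventually_lt_of_lt_liminf (hlt.trans_le
      (dirE_le_liminf (fun k => (h k).prim) hA.prim hv (isLowerSet_Iio B)))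
  obtain ⟨κ, a, hκ0, hκ1, hκ⟩ := Adm.exists_subcritical hn B hδ hδ1
  have htail : Tendsto (fun k => psiF n β (w k) (Set.Ioi B)) atTop
      (nhds (psiF n β v (Set.Ioi B))) := by
    refine tendsto_lintegral_filter_of_dominated_convergence
      (fun t => ENNReal.ofReal (Real.exp (κ * (a - B)) * Real.exp (-(1 - κ) * t)))
      (Eventually.of_forall fun k => measurable_psiF_integrand (h k).prim.continuous n β) ?_ ?_
      (ae_of_all _ fun t => tendsto_psiF_integrand (hv t))
    · filter_upwards [hev] with k hk
      refine (ae_restrict_iff' measurableSet_Ioi).2 (ae_of_all _ fun t ht => ?_)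
      refine ENNReal.ofReal_le_ofReal ?_
      have hx : 0 ≤ |w k t| ^ cexp n := by positivity
      rw [← Real.exp_add]
      calc _ ≤ Real.exp (β * |w k t| ^ cexp n) * Real.exp (-t) := by
            gcongr; exact expTail_le_exp _ (by positivity)
        _ ≤ _ := by
            rw [← Real.exp_add, Real.exp_le_exp]
            have := hκ _ _ (h k) hk.le t (Set.mem_Ioi.1 ht).le
            have := mul_le_of_le_one_left hx h1
            linarith
    · exact (((exp_neg_integrableOn_Ioi B
        (by linarith : 0 < 1 - κ)).const_mul _).lintegral_lt_top).ne
  filter_upwards [eventually_psiF_Iic_le hn h0 h1 h hv B (half_pos hε),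
    eventually_le_add_of_tendsto htail
      (by simpa using half_pos hε : ENNReal.ofReal (ε / 2) ≠ 0)] with k h2 h3
  rw [← psiF_Iic_union_Ioi n β _ B, ← psiF_Iic_union_Ioi n β v B]
  refine (add_le_add h2 h3).trans (le_of_eq ?_)
  nth_rewrite 3 [show ε = ε / 2 + ε / 2 by ring]
  rw [ENNReal.ofReal_add (by linarith) (by linarith)]
  ring

theorem psiF_zero (n : ℕ) (β : ℝ) (S : Set ℝ) : psiF n β 0 S = 0 := by
  have h : expTail (n + 1) 0 = 0 := by
    have := (hasSum_expTail (n + 1) 0).tsum_eq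
    simpa using this.symm
  have h2 : (0 : ℝ) ^ cexp n = 0 := Real.zero_rpow (cexp_pos n).ne'
  simp [psiF, h, h2]

theorem psiF_le_mosF {n : ℕ} (hn : 1 ≤ n) {β : ℝ} (hβ : 0 ≤ β) {w : ℝ → ℝ} (hw : Continuous w)
    (S : Set ℝ) : psiF n β w S ≤ mosF n β w S := by
  rw [mosF_eq hn hβ hw]; exact le_add_self

/-- The level of sequences whose weak limit vanishes. -/
theorem admSup_le_of_tendsto_zero {n : ℕ} (hn : 1 ≤ n) {w g : ℕ → ℝ → ℝ} {β K L η : ℝ}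
    (h0 : 0 ≤ β) (h1 : β ≤ 1) (hc : ConcBound n β K) (hL : 0 ≤ L) (hη : 0 < η)
    (h : ∀ k, Adm n (w k) (g k)) (hv : ∀ t, Tendsto (fun k => w k t) atTop (nhds 0))
    (hm : Tendsto (fun k => mosF n β (w k) Set.univ) atTop (nhds (admSup n β))) :
    admSup n β ≤ ENNReal.ofReal
      (max (vanLevel n β) (Real.exp (-(L - outerLevel n L)) * (K + η))) := by
  obtain ⟨B₀, hB₀, hC⟩ := hc η hη
  have hl := outerLevel_pos hn hL
  set B := L + B₀
  set P := max (vanLevel n β) (Real.exp (-(L - outerLevel n L)) * (K + η))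
  have hP1 : ENNReal.ofReal (vanLevel n β) ≤ ENNReal.ofReal P :=
    ENNReal.ofReal_le_ofReal (le_max_left _ _)
  have hP2 : ENNReal.ofReal (Real.exp (-(L - outerLevel n L)) * (K + η)) ≤ ENNReal.ofReal P :=
    ENNReal.ofReal_le_ofReal (le_max_right _ _)
  have key : ∀ ε : ℝ, 0 < ε → admSup n β ≤
      ENNReal.ofReal P + (ENNReal.ofReal ε + ENNReal.ofReal P * ENNReal.ofReal (2 * ε)) := by
    intro ε hε
    have hsmall : ∀ᶠ k in atTop, |w k L| ^ (n + 1) / outerLevel n L ^ n < ε := by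
      have : Tendsto (fun k => |w k L| ^ (n + 1) / outerLevel n L ^ n) atTop (nhds 0) := by
        simpa using (((hv L).abs).pow (n + 1)).div_const (outerLevel n L ^ n)
      exact this.eventually_lt_const hε
    refine le_of_tendsto hm ?_
    filter_upwards [hsmall, eventually_psiF_Iic_le hn h0 h1 h (v := 0) hv B hε] with k hk hk2
    rw [psiF_zero, zero_add] at hk2
    set D := dirE n (g k) Set.univ
    have hD : D ≤ 1 := (h k).dirE_le _
    have hDt : D ≠ ⊤ := (hD.trans_lt one_lt_top).ne
    set e := min 1 (D.toReal + 2 * ε)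
    have he : 0 < e := lt_min one_pos (by positivity)
    have hE : ENNReal.ofReal (|w k L| ^ (n + 1) / outerLevel n L ^ n) +
        dirE n (g k) (Set.Ioi L) ≤ ENNReal.ofReal e := by
      rw [ENNReal.ofReal_min]
      refine le_min ?_ ?_
      · rw [ENNReal.ofReal_one]
        exact (add_le_add_left ((h k).prim.ofReal_pow_div_le hn hL) _).trans ((h k).outE_add_le L)
      · rw [ENNReal.ofReal_add ENNReal.toReal_nonneg (by positivity), ENNReal.ofReal_toReal hDt,
          add_comm]
        exact add_le_add (dirE_mono _ _ (Set.subset_univ _))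
          (ENNReal.ofReal_le_ofReal (by linarith))
    obtain ⟨κ, hκ0, hκ⟩ := exists_root (n + 1) (Nat.succ_ne_zero n) he.le
    have hκp : 0 < κ := hκ0.lt_of_ne fun h => by rw [← h] at hκ; simp at hκ; linarith
    have hκ1 : κ ≤ 1 := by
      by_contra! h
      have h2 : 1 < κ ^ (n + 1) := one_lt_pow₀ h (Nat.succ_ne_zero n)
      linarith [min_le_left 1 (D.toReal + 2 * ε)]
    obtain ⟨v, r, hvr, htail⟩ := (h k).prim.exists_mosF_tail_le hn hl hκp hκ1 h0
      (by simp only [B]; linarith : L ≤ B) (by rw [hκ]; exact hE)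
    have htail2 : mosF n β (w k) (Set.Ioi B) ≤ (D + ENNReal.ofReal (2 * ε)) * ENNReal.ofReal P := by
      refine htail.trans ?_
      rw [hκ]
      refine mul_le_mul' ?_ ?_
      · rw [← ENNReal.ofReal_toReal hDt, ← ENNReal.ofReal_add ENNReal.toReal_nonneg (by positivity)]
        exact ENNReal.ofReal_le_ofReal (min_le_right _ _)
      · refine le_trans ?_ hP2
        rw [ENNReal.ofReal_mul (Real.exp_pos _).le]
        gcongr
        refine (mosF_mono n β v (Set.Ioi_subset_Ioi ?_)).trans (hC v r hvr)
        simp only [B]; linarith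
    calc mosF n β (w k) Set.univ
        = ENNReal.ofReal (vanLevel n β) * potE n (w k) Set.univ +
          (psiF n β (w k) (Set.Iic B) + psiF n β (w k) (Set.Ioi B)) := by
          rw [mosF_eq hn h0 (h k).prim.continuous, psiF_Iic_union_Ioi]
      _ ≤ ENNReal.ofReal P * potE n (w k) Set.univ + (ENNReal.ofReal ε +
          (D + ENNReal.ofReal (2 * ε)) * ENNReal.ofReal P) := by
          gcongr
          exact (psiF_le_mosF hn h0 (h k).prim.continuous _).trans htail2
      _ = ENNReal.ofReal P * (D + potE n (w k) Set.univ) +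
          (ENNReal.ofReal ε + ENNReal.ofReal P * ENNReal.ofReal (2 * ε)) := by ring
      _ ≤ ENNReal.ofReal P * 1 +
          (ENNReal.ofReal ε + ENNReal.ofReal P * ENNReal.ofReal (2 * ε)) := by
          gcongr; exact (h k).le_one
      _ = _ := by rw [mul_one]
  have hlim : Tendsto (fun ε : ℝ => ENNReal.ofReal P +
      (ENNReal.ofReal ε + ENNReal.ofReal P * ENNReal.ofReal (2 * ε)))
      (nhdsWithin 0 (Set.Ioi 0))
        (nhds (ENNReal.ofReal P)) := by
    have hcont : Continuous fun ε : ℝ => ENNReal.ofReal P +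
        (ENNReal.ofReal ε + ENNReal.ofReal P * ENNReal.ofReal (2 * ε)) :=
      continuous_const.add (ENNReal.continuous_ofReal.add
        ((ENNReal.continuous_const_mul ENNReal.ofReal_ne_top).comp
          (ENNReal.continuous_ofReal.comp (by fun_prop))))
    simpa using (hcont.tendsto 0).mono_left nhdsWithin_le_nhds
  exact ge_of_tendsto hlim (eventually_nhdsWithin_of_forall fun ε hε => key ε hε)

theorem Adm.exists_translate {n : ℕ} (hn : 1 ≤ n) {w g : ℝ → ℝ} (h : Adm n w g) (h0 : w ≠ 0)
    {β : ℝ} (hβ : 0 ≤ β) : ∃ u r, Adm n u r ∧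
      ENNReal.ofReal (vanLevel n β) * (1 - dirE n g Set.univ) + psiF n β w Set.univ ≤
        mosF n β u Set.univ := by
  set D := dirE n g Set.univ
  set N := potE n w Set.univ
  have hN : 0 < N := potE_pos h.prim.continuous n h0
  have hNt : N ≠ ⊤ := ((h.potE_le _).trans_lt one_lt_top).ne
  have hNr := ENNReal.toReal_pos hN.ne' hNt
  have hD1 : D ≤ 1 := h.dirE_le _
  have hDt : D ≠ ⊤ := (hD1.trans_lt one_lt_top).ne
  have hle : N ≤ 1 - D := ENNReal.le_sub_of_add_le_left hDt h.le_one
  have h1t : 1 - D ≠ ⊤ := (tsub_le_self.trans_lt one_lt_top).ne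
  have hler := ENNReal.toReal_mono h1t hle
  set c := Real.log ((1 - D).toReal / N.toReal)
  have hc : Real.exp c = (1 - D).toReal / N.toReal := Real.exp_log (div_pos (hNr.trans_le hler) hNr)
  have hcN : ENNReal.ofReal (Real.exp c) * N = 1 - D := by
    rw [hc, ENNReal.ofReal_div_of_pos hNr, ENNReal.ofReal_toReal h1t, ENNReal.ofReal_toReal hNt,
      ENNReal.div_mul_cancel hN.ne' hNt]
  have hc1 : 1 ≤ ENNReal.ofReal (Real.exp c) := by
    rw [ENNReal.one_le_ofReal, hc, one_le_div hNr]; exact hler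
  refine ⟨fun t => w (t + c), fun t => g (t + c), ⟨h.prim.comp_add c, ?_⟩, ?_⟩
  · rw [dirE_comp_add, potE_comp_add, hcN, add_tsub_cancel_of_le hD1]
  · rw [mosF_eq hn hβ (h.prim.comp_add c).continuous, potE_comp_add, psiF_comp_add, hcN]
    gcongr
    exact le_mul_of_one_le_left' hc1

/-- Above the vanishing and the concentration level the supremum is attained. -/
theorem exists_adm_eq_admSup {n : ℕ} (hn : 1 ≤ n) {β K : ℝ} (hβ0 : 0 < β) (hβ1 : β ≤ 1)
    (hc : ConcBound n β K) (hvan : ENNReal.ofReal (vanLevel n β) < admSup n β)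
    (hcon : ∃ L, 0 ≤ L ∧
      ENNReal.ofReal (Real.exp (-(L - outerLevel n L)) * K) < admSup n β) :
    ∃ w g, Adm n w g ∧ mosF n β w Set.univ = admSup n β := by
  obtain ⟨w₀, g₀, hA₀, hm₀⟩ := Adm.exists_seq (n := n) β
  obtain ⟨φ, v, hφ, hv⟩ := exists_subseq_tendsto hn hA₀
  obtain ⟨⟨D, N⟩, -, ψ, hψ, hDN⟩ := isCompact_univ.tendsto_subseq
    (x := fun k => (dirE n (g₀ (φ k)) Set.univ, potE n (w₀ (φ k)) Set.univ))
    (fun _ => Set.mem_univ _)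
  set w := fun k => w₀ (φ (ψ k))
  set g := fun k => g₀ (φ (ψ k))
  have hA : ∀ k, Adm n (w k) (g k) := fun k => hA₀ _
  have hm : Tendsto (fun k => mosF n β (w k) Set.univ) atTop (nhds (admSup n β)) :=
    hm₀.comp (hφ.tendsto_atTop.comp hψ.tendsto_atTop)
  replace hv : ∀ t, Tendsto (fun k => w k t) atTop (nhds (v t)) :=
    fun t => (hv t).comp hψ.tendsto_atTop
  have hD : Tendsto (fun k => dirE n (g k) Set.univ) atTop (nhds D) :=
    ((continuous_fst.tendsto _).comp hDN)
  have hN : Tendsto (fun k => potE n (w k) Set.univ) atTop (nhds N) :=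
    ((continuous_snd.tendsto _).comp hDN)
  have hDN1 : D + N ≤ 1 := le_of_tendsto' (hD.add hN) fun k => (hA k).le_one
  have hvp : IsPrim v (deriv v) := isPrim_of_tendsto hn (fun k => (hA k).prim)
    (fun k => (hA k).dirE_le _) hv
  have hvD : dirE n (deriv v) Set.univ ≤ D := by
    rw [← hD.liminf_eq]
    exact dirE_le_liminf (fun k => (hA k).prim) hvp hv isLowerSet_univ
  have hvN : potE n v Set.univ ≤ N := by
    rw [← hN.liminf_eq]
    exact potE_le_liminf (fun k => (hA k).prim.continuous) hv _
  have hvA : Adm n v (deriv v) := ⟨hvp, (add_le_add hvD hvN).trans hDN1⟩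
  by_cases h0 : v = 0
  · exfalso
    obtain ⟨L, hL, hlt⟩ := hcon
    have hlim : Tendsto (fun η : ℝ => ENNReal.ofReal (Real.exp (-(L - outerLevel n L)) * (K + η)))
        (nhdsWithin 0 (Set.Ioi 0))
        (nhds (ENNReal.ofReal (Real.exp (-(L - outerLevel n L)) * K))) := by
      have hcont : Continuous fun η : ℝ =>
          ENNReal.ofReal (Real.exp (-(L - outerLevel n L)) * (K + η)) :=
        ENNReal.continuous_ofReal.comp (by fun_prop)
      simpa using (hcont.tendsto 0).mono_left nhdsWithin_le_nhds
    obtain ⟨η, hη1, hη⟩ := ((hlim.eventually_lt_const hlt).and self_mem_nhdsWithin).exists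
    have hle := admSup_le_of_tendsto_zero hn hβ0.le hβ1 hc hL (Set.mem_Ioi.1 hη) hA
      (by simpa [h0] using hv) hm
    rw [ENNReal.ofReal_max] at hle
    exact (max_lt hvan hη1).not_ge hle
  · obtain ⟨u, r, hu, hle⟩ := hvA.exists_translate hn h0 hβ0.le
    refine ⟨u, r, hu, le_antisymm (hu.le_admSup β) (le_trans ?_ hle)⟩
    have hND : N ≤ 1 - dirE n (deriv v) Set.univ :=
      ENNReal.le_sub_of_add_le_left ((hvA.dirE_le _).trans_lt one_lt_top).ne
        ((add_le_add_left hvD _).trans hDN1)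
    refine le_trans ?_ (add_le_add_left (mul_le_mul_right hND _) _)
    refine ENNReal.le_of_forall_pos_le_add fun ε hε _ => ?_
    have hlim : Tendsto (fun k => ENNReal.ofReal (vanLevel n β) * potE n (w k) Set.univ +
        (psiF n β v Set.univ + ε)) atTop
        (nhds (ENNReal.ofReal (vanLevel n β) * N + (psiF n β v Set.univ + ε))) :=
      (ENNReal.Tendsto.const_mul hN (Or.inr ENNReal.ofReal_ne_top)).add tendsto_const_nhds
    rw [add_assoc]
    refine le_of_tendsto_of_tendsto hm hlim ?_
    filter_upwards [eventually_psiF_le hn hβ0.le hβ1 hA hvA h0 hv (ε := ε) (by exact_mod_cast hε)]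
      with k hk
    rw [mosF_eq hn hβ0.le (hA k).prim.continuous]
    rw [ENNReal.ofReal_coe_nnreal] at hk
    exact add_le_add_right hk _

theorem mul_sub_le_pow_succ (n : ℕ) {x : ℝ} (hx : 0 ≤ x) : (n + 1) * x - n ≤ x ^ (n + 1) := by
  have := one_add_mul_le_pow (by linarith : (-2 : ℝ) ≤ x - 1) (n + 1)
  rw [add_sub_cancel] at this
  push_cast at this
  linarith

theorem IsPrim.le_dirE {w g : ℝ → ℝ} (hw : IsPrim w g) (n : ℕ) {a b : ℝ} (hab : a ≤ b) :
    ENNReal.ofReal ((n + 1) * |w b - w a| - n * (b - a)) ≤ dirE n g (Set.Ioc a b) := by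
  by_cases htop : dirE n g (Set.Ioc a b) = ⊤
  · rw [htop]; exact le_top
  have hintg := integrableOn_abs_pow n hw.aestronglyMeasurable.restrict htop
  have hg := (intervalIntegrable_iff_integrableOn_Ioc_of_le hab).1 (hw.int a b)
  have hd : dirE n g (Set.Ioc a b) = ENNReal.ofReal (∫ t in Set.Ioc a b, |g t| ^ (n + 1)) :=
    (ofReal_integral_eq_lintegral_ofReal hintg (ae_of_all _ fun t => by positivity)).symm
  rw [hd]
  refine ENNReal.ofReal_le_ofReal ?_
  have hc : IntegrableOn (fun _ => (n : ℝ)) (Set.Ioc a b) := integrableOn_const (by simp)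
  have h1 : ∫ t in Set.Ioc a b, ((n + 1) * |g t| - n) ≤ ∫ t in Set.Ioc a b, |g t| ^ (n + 1) :=
    integral_mono ((hg.abs.const_mul _).sub hc) hintg
      fun t => mul_sub_le_pow_succ n (abs_nonneg (g t))
  rw [integral_sub (hg.abs.const_mul _) hc, integral_const_mul, setIntegral_const,
    ← intervalIntegral.integral_of_le hab, measureReal_def, Real.volume_Ioc,
    ENNReal.toReal_ofReal (sub_nonneg.2 hab), smul_eq_mul] at h1
  have h2 := hw.abs_sub_le hab
  have : (0 : ℝ) ≤ n + 1 := by positivity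
  nlinarith [mul_le_mul_of_nonneg_left h2 this]

/-- Near-maximizers of the outer problem keep a fixed amount of mass in a fixed region. -/
theorem exists_potE_outer_lower {n : ℕ} (hn : 1 ≤ n) : ∃ L₀ c : ℝ, 0 ≤ L₀ ∧ 0 < c ∧
    ∀ L η : ℝ, L₀ ≤ L → η ≤ 1 → ∀ w g, IsPrim w g → w L = outerLevel n L →
      outE n w g L ≤ ENNReal.ofReal (outerLevel n L + η) →
      ENNReal.ofReal c ≤ potE n w (Set.Iio L₀) := by
  set L₀ := max 0 (outerGap n + 2)
  have hL0 : 0 ≤ L₀ := le_max_left _ _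
  set l := outerLevel n L₀
  have hl : 0 < l := outerLevel_pos hn hL0
  have hn1 : (1 : ℝ) ≤ n := by exact_mod_cast hn
  set X := 1 + (n + 2) * l ^ n
  have hX : 1 ≤ X := le_add_of_nonneg_right (by positivity)
  set K := (n + 1) * X + 1
  have hK : 0 < K := by positivity
  set d : ℝ := (1 / (2 * (n + 1))) ^ (n + 1)
  have hd : 0 < d := by positivity
  set h := min 1 (d / K)
  have hh : 0 < h := by positivity
  refine ⟨L₀, d * Real.exp (-L₀) * h, hL0, by positivity, fun L η hL hη w g hw hwL hE => ?_⟩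
  have hgap := le_outerGap hn (hL0.trans hL)
  have hL02 : outerGap n + 2 ≤ L₀ := le_max_right _ _
  set x := |w L₀|
  have hx0 : 0 ≤ x := abs_nonneg _
  have hout : outE n w g L₀ + ENNReal.ofReal ((n + 1) * |w L - w L₀| - n * (L - L₀)) ≤
      ENNReal.ofReal (outerLevel n L + η) := by
    refine le_trans (add_le_add_right (hw.le_dirE n hL) _) ?_
    rw [outE_add_dirE n w g hL]
    exact (add_le_add_right (potE_mono n w (Set.Iio_subset_Iio hL)) _).trans hE
  have hfin : outE n w g L₀ ≠ ⊤ := ((le_self_add.trans hout).trans_lt ofReal_lt_top).ne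
  have hdist : outerLevel n L - x ≤ |w L - w L₀| := by
    have := abs_sub_abs_le_abs_sub (w L) (w L₀)
    rw [hwL, abs_of_nonneg (outerLevel_nonneg n L)] at this
    rwa [hwL]
  set E := (outE n w g L₀).toReal
  have hE0 : 0 ≤ E := ENNReal.toReal_nonneg
  have hlev := outerLevel_nonneg n L
  have hsum : E + ((n + 1) * |w L - w L₀| - n * (L - L₀)) ≤ max 0 (outerLevel n L + η) := by
    rw [← ENNReal.ofReal_toReal hfin] at hout
    have h1 := ENNReal.toReal_mono ofReal_ne_top hout
    rw [ENNReal.toReal_add ofReal_ne_top ofReal_ne_top, ENNReal.toReal_ofReal hE0,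
      ENNReal.toReal_ofReal', ENNReal.toReal_ofReal', max_comm _ (0 : ℝ), max_comm _ (0 : ℝ)] at h1
    linarith [le_max_right 0 ((n + 1) * |w L - w L₀| - n * (L - L₀))]
  have hm : max 0 (outerLevel n L + η) ≤ outerLevel n L + 1 := max_le (by linarith) (by linarith)
  have hE1 : E ≤ (n + 1) * x + n * ((L - outerLevel n L) - L₀) + 1 := by
    have := mul_le_mul_of_nonneg_left hdist (by positivity : (0 : ℝ) ≤ n + 1)
    linarith
  have hE2 : E ≤ (n + 1) * x - 2 * n + 1 := by
    have := mul_le_mul_of_nonneg_left (by linarith : (L - outerLevel n L) - L₀ ≤ -2)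
      (by positivity : (0 : ℝ) ≤ n)
    linarith
  have hxlow : 1 / (n + 1) ≤ x := by
    rw [div_le_iff₀ (by positivity)]; linarith
  have hxhigh : x ≤ X := by
    by_contra! hc
    have hx1 : 1 < x := hX.trans_lt hc
    have h1 := hw.abs_pow_le_outerLevel hn (by positivity : 0 < (n + 2) * x)
      (L := L₀) (by
        rw [← ENNReal.ofReal_toReal hfin]
        exact ENNReal.ofReal_le_ofReal (by linarith))
    have h2 : x ^ n ≤ (n + 2) * l ^ n := by
      refine le_of_mul_le_mul_right ?_ (by linarith : 0 < x)
      calc x ^ n * x = x ^ (n + 1) := (pow_succ _ _).symm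
        _ ≤ (n + 2) * x * l ^ n := h1
        _ = _ := by ring
    have h3 : x ≤ x ^ n := le_self_pow₀ hx1.le (by omega)
    linarith
  have hEK : outE n w g L₀ ≤ ENNReal.ofReal K := by
    rw [← ENNReal.ofReal_toReal hfin]
    refine ENNReal.ofReal_le_ofReal ?_
    have := mul_le_mul_of_nonneg_left hxhigh (by positivity : (0 : ℝ) ≤ n + 1)
    simp only [K]
    linarith
  have hpow : d ≤ (|w L₀| / 2) ^ (n + 1) := by
    refine pow_le_pow_left₀ (by positivity) ?_ _
    calc (1 : ℝ) / (2 * (n + 1)) = 1 / (n + 1) / 2 := by field_simp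
      _ ≤ x / 2 := by linarith
  have hrad := hw.radial n hK.le (le_self_add.trans hEK) (le_refl (potE n w (Set.Iio L₀)))
    (h := h) (by
      refine le_trans ?_ hpow
      calc K * h ^ n ≤ K * h := by
            gcongr; exact pow_le_of_le_one hh.le (min_le_left _ _) (by omega)
        _ ≤ K * (d / K) := by gcongr; exact min_le_right _ _
        _ = d := by field_simp)
  refine le_trans (ENNReal.ofReal_le_ofReal ?_) hrad
  gcongr

theorem IsPrim.glue {w g v r : ℝ → ℝ} (hw : IsPrim w g) (hv : IsPrim v r) {L : ℝ}
    (h : w L = v L) :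
    IsPrim (fun t => if t ≤ L then w t else v t) (fun t => if t ≤ L then g t else r t) := by
  have hintg : ∀ a b, IntervalIntegrable (fun t => if t ≤ L then g t else r t) volume a b := by
    intro a b
    rw [intervalIntegrable_iff]
    have h1 := intervalIntegrable_iff.1 (hw.int a b)
    have h2 := intervalIntegrable_iff.1 (hv.int a b)
    exact Integrable.piecewise (s := Set.Iic L) measurableSet_Iic h1.integrableOn h2.integrableOn
  have key : ∀ t, (if t ≤ L then w t else v t) - w L =
      ∫ s in L..t, if s ≤ L then g s else r s := by
    intro t
    rcases le_or_gt t L with ht | ht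
    · rw [if_pos ht, hw.ftc]
      refine intervalIntegral.integral_congr fun s hs => ?_
      rw [Set.uIcc_of_ge ht] at hs
      simp only [if_pos hs.2]
    · rw [if_neg ht.not_ge, h, hv.ftc]
      refine intervalIntegral.integral_congr_ae (ae_of_all _ fun s hs => ?_)
      rw [Set.uIoc_of_le ht.le] at hs
      simp only [if_neg hs.1.not_ge]
  refine ⟨hintg, fun a b => ?_⟩
  rw [← intervalIntegral.integral_interval_sub_left (hintg L b) (hintg L a), ← key, ← key]
  ring

theorem pow_mul_exp_neg_le (m : ℕ) {s : ℝ} (hs : 0 ≤ s) :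
    s ^ m * Real.exp (-s) ≤ m.factorial * 2 ^ m * Real.exp (-(1 / 2) * s) := by
  have h1 := Real.pow_div_factorial_le_exp (s / 2) (by positivity) m
  rw [div_pow, div_div, div_le_iff₀ (by positivity)] at h1
  calc s ^ m * Real.exp (-s) ≤ Real.exp (s / 2) * (2 ^ m * m.factorial) * Real.exp (-s) := by gcongr
    _ = m.factorial * 2 ^ m * (Real.exp (s / 2) * Real.exp (-s)) := by ring
    _ = _ := by rw [← Real.exp_add]; congr 2; ring

theorem lintegral_pow_mul_exp_neg_le (m : ℕ) {l : ℝ} (hl : 0 ≤ l) :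
    ∫⁻ s in Set.Ioi l, ENNReal.ofReal (s ^ m * Real.exp (-s)) ≤
      ENNReal.ofReal (m.factorial * 2 ^ m * 2 * Real.exp (-(l / 2))) := by
  have hi := (exp_neg_integrableOn_Ioi l (by norm_num : (0 : ℝ) < 1 / 2)).const_mul
    ((m.factorial : ℝ) * 2 ^ m)
  calc _ ≤ ∫⁻ s in Set.Ioi l,
        ENNReal.ofReal (m.factorial * 2 ^ m * Real.exp (-(1 / 2) * s)) :=
        setLIntegral_mono' measurableSet_Ioi fun s hs => ENNReal.ofReal_le_ofReal
          (pow_mul_exp_neg_le m (hl.trans (Set.mem_Ioi.1 hs).le))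
    _ = ENNReal.ofReal (∫ s in Set.Ioi l, m.factorial * 2 ^ m * Real.exp (-(1 / 2) * s)) :=
        (ofReal_integral_eq_lintegral_ofReal hi (ae_of_all _ fun s => by positivity)).symm
    _ ≤ _ := by
        rw [integral_const_mul, integral_exp_mul_Ioi (by norm_num)]
        refine ENNReal.ofReal_le_ofReal (le_of_eq ?_)
        rw [show -(1 / 2) * l = -(l / 2) by ring]
        ring

theorem setLIntegral_Ioi_comp_sub (F : ℝ → ℝ≥0∞) (a B : ℝ) :
    ∫⁻ t in Set.Ioi B, F (t - a) = ∫⁻ s in Set.Ioi (B - a), F s := by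
  have := (measurePreserving_sub_right volume a).setLIntegral_comp_preimage_emb
    (MeasurableEquiv.subRight a).measurableEmbedding F (Set.Ioi (B - a))
  rw [← this]
  congr 2
  ext x; simp

theorem potE_Ioi_comp_sub (n : ℕ) (v : ℝ → ℝ) (a B : ℝ) :
    potE n (fun t => v (t - a)) (Set.Ioi B) =
      ENNReal.ofReal (Real.exp (-a)) * potE n v (Set.Ioi (B - a)) := by
  rw [potE, potE, ← lintegral_const_mul' _ _ ENNReal.ofReal_ne_top,
    ← setLIntegral_Ioi_comp_sub]
  refine lintegral_congr fun t => ?_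
  rw [← ENNReal.ofReal_mul (Real.exp_pos _).le]
  congr 1
  rw [show -t = -a + -(t - a) by ring, Real.exp_add]; ring

theorem exp_le_expTail_add (n : ℕ) {s x : ℝ} (hs : 1 ≤ s) (hx : 0 ≤ x) (hxs : x ≤ s ^ 2) :
    Real.exp x ≤ expTail n x + n * s ^ (2 * n) := by
  have h : ∑ j ∈ Finset.range n, x ^ j / (j.factorial : ℝ) ≤
      ∑ _j ∈ Finset.range n, s ^ (2 * n) := by
    refine Finset.sum_le_sum fun j hj => ?_
    calc x ^ j / (j.factorial : ℝ) ≤ x ^ j :=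
          div_le_self (by positivity) (by exact_mod_cast j.factorial_pos)
      _ ≤ (s ^ 2) ^ j := by gcongr
      _ = s ^ (2 * j) := (pow_mul _ _ _).symm
      _ ≤ _ := pow_le_pow_right₀ hs (by have := Finset.mem_range.1 hj; omega)
  rw [Finset.sum_const, Finset.card_range, nsmul_eq_mul] at h
  rw [expTail]; linarith

/-- The constant in the bound for the tails of `s ^ (2 * n) * exp (-s)`. -/
noncomputable def tailConst (n : ℕ) : ℝ := (2 * n).factorial * 2 ^ (2 * n) * 2

theorem tailConst_pos (n : ℕ) : 0 < tailConst n := by unfold tailConst; positivity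

theorem le_mosF_innerProfile {n : ℕ} (hn : 1 ≤ n) {l k : ℝ} (hl : 1 ≤ l) (hk : 0 < k)
    (hk1 : k ≤ 1) :
    ENNReal.ofReal (Real.exp ((k * (l + innerEnergy n l)) ^ cexp n - (l + innerEnergy n l) +
      hCC n - 4 * √(n * Real.exp (-l)))) ≤
    mosF n 1 (fun t => k * innerProfile n l t) (Set.Ioi l) +
      ENNReal.ofReal (n * tailConst n * Real.exp (-(l / 2))) := by
  refine (le_lintegral_innerProfile hn hl hk).trans ?_
  have h0 := lintegral_pow_mul_exp_neg_le (2 * n) (zero_le_one.trans hl)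
  have h1 : ENNReal.ofReal n * ∫⁻ s in Set.Ioi l, ENNReal.ofReal (s ^ (2 * n) * Real.exp (-s)) ≤
      ENNReal.ofReal (n * tailConst n * Real.exp (-(l / 2))) := by
    rw [mul_assoc, ENNReal.ofReal_mul (by positivity)]
    exact mul_le_mul_right h0 _
  refine le_trans ?_ (add_le_add_right h1 _)
  rw [← lintegral_const_mul' _ _ ENNReal.ofReal_ne_top, mosF, ← lintegral_add_right _ (by fun_prop)]
  refine setLIntegral_mono' measurableSet_Ioi fun t ht => ?_
  have ht' : l ≤ t := (Set.mem_Ioi.1 ht).le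
  obtain ⟨hp1, hp2⟩ := innerProfile_mem hn ht'
  have hp0 : 0 ≤ k * innerProfile n l t := by have : 0 ≤ innerProfile n l t := by linarith
                                              positivity
  have hpt : k * innerProfile n l t ≤ t :=
    (mul_le_of_le_one_left (by linarith) hk1).trans hp2
  have hx0 : 0 ≤ (k * innerProfile n l t) ^ cexp n := Real.rpow_nonneg hp0 _
  have hxt : (k * innerProfile n l t) ^ cexp n ≤ t ^ 2 := by
    have h1t : 1 ≤ t := hl.trans ht'
    calc (k * innerProfile n l t) ^ cexp n ≤ t ^ cexp n :=
          Real.rpow_le_rpow hp0 hpt (cexp_pos n).le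
      _ ≤ t ^ (2 : ℝ) := Real.rpow_le_rpow_of_exponent_le h1t (cexp_le_two hn)
      _ = t ^ 2 := by norm_cast
  have h2 := exp_le_expTail_add n (hl.trans ht') hx0 hxt
  rw [← ENNReal.ofReal_mul (by positivity), ← ENNReal.ofReal_add
    (mul_nonneg (expTail_nonneg n (by positivity)) (Real.exp_pos _).le)
    (by have : 0 ≤ t := by linarith
        positivity)]
  refine ENNReal.ofReal_le_ofReal ?_
  rw [one_mul, abs_of_nonneg hp0, sub_eq_add_neg, Real.exp_add]
  calc _ ≤ (expTail n ((k * innerProfile n l t) ^ cexp n) + n * t ^ (2 * n)) * Real.exp (-t) := by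
        gcongr
    _ = _ := by ring

theorem potE_innerProfile_le {n : ℕ} (hn : 1 ≤ n) {l : ℝ} (hl : 1 ≤ l) :
    potE n (innerProfile n l) (Set.Ioi l) ≤
      ENNReal.ofReal (tailConst n * Real.exp (-(l / 2))) := by
  refine le_trans ?_ (lintegral_pow_mul_exp_neg_le (2 * n) (zero_le_one.trans hl))
  refine setLIntegral_mono' measurableSet_Ioi fun t ht => ENNReal.ofReal_le_ofReal ?_
  have ht' : l ≤ t := (Set.mem_Ioi.1 ht).le
  obtain ⟨hp1, hp2⟩ := innerProfile_mem hn ht'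
  refine mul_le_mul_of_nonneg_right ?_ (Real.exp_pos _).le
  rw [abs_of_nonneg (by linarith)]
  exact (pow_le_pow_left₀ (by linarith) hp2 _).trans
    (pow_le_pow_right₀ (hl.trans ht') (by omega))

theorem sub_le_rpow_cexp {n : ℕ} (hn : 1 ≤ n) {k Q δ : ℝ} (hk : 0 ≤ k) (hQ : 0 ≤ Q) (hδ : 0 ≤ δ)
    (h : k ^ (n + 1) * (Q + δ) = 1) : Q - δ ≤ (k * Q) ^ cexp n := by
  rcases le_or_gt (Q - δ) 0 with h0 | h0
  · exact h0.trans (by positivity)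
  refine le_of_pow_le_pow_left₀ (by omega) (by positivity) (n := n) ?_
  rw [rpow_cexp_pow hn (by positivity), mul_pow]
  obtain ⟨m, rfl⟩ : ∃ m, n = m + 1 := ⟨n - 1, by omega⟩
  have hS : 0 < Q + δ := by linarith
  refine le_of_mul_le_mul_right ?_ hS
  calc (Q - δ) ^ (m + 1) * (Q + δ) = (Q - δ) ^ m * ((Q - δ) * (Q + δ)) := by ring
    _ ≤ Q ^ m * (Q * Q) := by
        refine mul_le_mul (pow_le_pow_left₀ h0.le (by linarith) _) ?_ (by positivity)
          (by positivity)
        nlinarith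
    _ = 1 * Q ^ (m + 1 + 1) := by ring
    _ = _ := by rw [← h]; ring

theorem exists_adm_glue {n : ℕ} (hn : 1 ≤ n) {L l η k : ℝ} (hl : 1 ≤ l) (hη : 0 ≤ η)
    (hk : 0 < k) {w g : ℝ → ℝ} (hw : IsPrim w g) (hwL : w L = l)
    (hE : outE n w g L ≤ ENNReal.ofReal (l + η))
    (hkS : k ^ (n + 1) * (l + innerEnergy n l +
      (η + Real.exp (-(L - l)) * (tailConst n * Real.exp (-(l / 2))))) = 1) :
    ∃ u r, Adm n u r ∧ (∀ t ≤ L, u t = k * w t) ∧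
      mosF n 1 u (Set.Ioi L) = ENNReal.ofReal (Real.exp (-(L - l))) *
        mosF n 1 (fun t => k * innerProfile n l t) (Set.Ioi l) := by
  set a := L - l with ha
  have hLa : L - a = l := by rw [ha]; ring
  have hv : IsPrim (fun t => innerProfile n l (t - a)) (fun t => innerSlope n l (t - a)) := by
    simpa only [sub_eq_add_neg] using (isPrim_innerProfile hn l).comp_add (-a)
  have hglue := hw.glue hv (L := L) (by rw [hwL, hLa, innerProfile_self])
  set W : ℝ → ℝ := fun t => if t ≤ L then w t else innerProfile n l (t - a) with hW
  set G : ℝ → ℝ := fun t => if t ≤ L then g t else innerSlope n l (t - a) with hG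
  have hWr : ∀ t ∈ Set.Ioi L, W t = innerProfile n l (t - a) :=
    fun t ht => if_neg (Set.mem_Ioi.1 ht).not_ge
  have hGr : ∀ t ∈ Set.Ioi L, G t = innerSlope n l (t - a) :=
    fun t ht => if_neg (Set.mem_Ioi.1 ht).not_ge
  have hsplit : ∀ F : ℝ → ℝ≥0∞, ∫⁻ t in Set.univ, F t =
      (∫⁻ t in Set.Iio L, F t) + ∫⁻ t in Set.Ioi L, F t := by
    intro F
    rw [Measure.restrict_univ, ← lintegral_add_compl F measurableSet_Iic (A := Set.Iic L),
      Set.compl_Iic, setLIntegral_congr Iio_ae_eq_Iic.symm]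
  have hD : dirE n G Set.univ = dirE n g (Set.Iio L) + ENNReal.ofReal (innerEnergy n l) := by
    rw [dirE, hsplit]
    congr 1
    · exact setLIntegral_congr_fun measurableSet_Iio fun t ht => by
        simp only [hG, if_pos (Set.mem_Iio.1 ht).le]
    · rw [← dirE_innerSlope hn l, dirE, ← hLa,
        ← setLIntegral_Ioi_comp_sub (fun t => ENNReal.ofReal (|innerSlope n (L - a) t| ^ (n + 1)))]
      exact setLIntegral_congr_fun measurableSet_Ioi fun t ht => by
        simp only [hGr t ht, hLa]
  have hN : potE n W Set.univ ≤ potE n w (Set.Iio L) +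
      ENNReal.ofReal (Real.exp (-a) * (tailConst n * Real.exp (-(l / 2)))) := by
    rw [potE, hsplit]
    refine add_le_add (le_of_eq ?_) ?_
    · exact setLIntegral_congr_fun measurableSet_Iio fun t ht => by
        simp only [hW, if_pos (Set.mem_Iio.1 ht).le]
    · have h1 := potE_Ioi_comp_sub n (innerProfile n l) a L
      rw [hLa] at h1
      rw [ENNReal.ofReal_mul (Real.exp_pos _).le]
      refine le_trans (le_of_eq ?_) (h1.le.trans (mul_le_mul_right (potE_innerProfile_le hn hl) _))
      exact setLIntegral_congr_fun measurableSet_Ioi fun t ht => by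
        simp only [hWr t ht]
  have htc := tailConst_pos n
  have hIE := innerEnergy_nonneg n l
  refine ⟨fun t => k * W t, fun t => k * G t, ⟨hglue.const_mul k, ?_⟩, fun t ht => ?_, ?_⟩
  · rw [dirE_const_mul, potE_const_mul, ← mul_add, abs_of_pos hk]
    calc _ ≤ ENNReal.ofReal (k ^ (n + 1)) * (ENNReal.ofReal (l + η) +
          ENNReal.ofReal (innerEnergy n l) +
          ENNReal.ofReal (Real.exp (-a) * (tailConst n * Real.exp (-(l / 2))))) := by
          refine mul_le_mul_right ?_ _
          calc _ ≤ dirE n g (Set.Iio L) + ENNReal.ofReal (innerEnergy n l) +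
                (potE n w (Set.Iio L) +
                ENNReal.ofReal (Real.exp (-a) * (tailConst n * Real.exp (-(l / 2))))) := by
                rw [hD]; exact add_le_add_right hN _
            _ = outE n w g L + ENNReal.ofReal (innerEnergy n l) +
                ENNReal.ofReal (Real.exp (-a) * (tailConst n * Real.exp (-(l / 2)))) := by
                rw [outE]; ring
            _ ≤ _ := by gcongr
      _ = 1 := by
          rw [← ENNReal.ofReal_add (by positivity) hIE, ← ENNReal.ofReal_add (by positivity)
            (by positivity), ← ENNReal.ofReal_mul (by positivity), ← ENNReal.ofReal_one, ← hkS]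
          congr 2
          ring
  · simp only [hW, if_pos ht]
  · rw [← hLa, ← mosF_comp_sub n 1 (fun t => k * innerProfile n (L - a) t)]
    refine setLIntegral_congr_fun measurableSet_Ioi fun t ht => ?_
    simp only [hWr t ht, hLa]

theorem ofReal_div_le_mosF_Iic {n : ℕ} (hn : 1 ≤ n) {L₀ L k c : ℝ} (hL : L₀ ≤ L) (hk : 0 < k)
    {w u : ℝ → ℝ} (hu : Continuous u) (huw : ∀ t ≤ L, u t = k * w t)
    (hc : ENNReal.ofReal c ≤ potE n w (Set.Iio L₀)) :
    ENNReal.ofReal (k ^ (n + 1) * c / n.factorial) ≤ mosF n 1 u (Set.Iic L) := by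
  rw [mosF_eq hn zero_le_one hu]
  refine le_trans ?_ le_self_add
  have h1 : potE n (fun t => k * w t) (Set.Iio L₀) ≤ potE n u (Set.Iic L) := by
    refine le_trans (le_of_eq ?_)
      (potE_mono n u ((Set.Iio_subset_Iic_self).trans (Set.Iic_subset_Iic.2 hL)))
    exact setLIntegral_congr_fun measurableSet_Iio fun t ht => by
      simp only [huw t ((Set.mem_Iio.1 ht).le.trans hL)]
  rw [potE_const_mul, abs_of_pos hk] at h1
  refine le_trans ?_ (mul_le_mul_right ((mul_le_mul_right hc _).trans h1) _)
  rw [← ENNReal.ofReal_mul (by positivity), ← ENNReal.ofReal_mul (by unfold vanLevel; positivity)]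
  refine ENNReal.ofReal_le_ofReal (le_of_eq ?_)
  rw [vanLevel]
  simp; ring

theorem mul_exp_neg_half_le {l : ℝ} (hl : 0 < l) : l * Real.exp (-(l / 2)) ≤ 8 / l := by
  have h := Real.pow_div_factorial_le_exp (l / 2) (by positivity) 2
  rw [Real.exp_neg, ← div_eq_mul_inv, div_le_div_iff₀ (Real.exp_pos _) hl]
  norm_num [Nat.factorial] at h
  nlinarith

/-- The concentration level is strictly exceeded by an admissible test function. -/
theorem exists_concentration_lt_admSup {n : ℕ} (hn : 1 ≤ n) : ∃ L : ℝ, 0 ≤ L ∧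
    ENNReal.ofReal (Real.exp (-(L - outerLevel n L)) * Real.exp (hCC n)) < admSup n 1 := by
  obtain ⟨L₀, c, hL0, hc, hmass⟩ := exists_potE_outer_lower hn
  have hT := tailConst_pos n
  set o := Real.exp (outerLevel n 0)
  have ho : 0 < o := Real.exp_pos _
  set T := tailConst n
  set M₁ := 1 + o * T
  set M₂ := M₁ + 4 * √n
  set M₃ := 4 * n + 1 + M₁
  set H := Real.exp (hCC n)
  have hH : 0 < H := Real.exp_pos _
  have hM1 : 0 < M₁ := by positivity
  have hM2 : 0 < M₂ := by positivity
  have hM3 : 0 < M₃ := by positivity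
  set M := o * (H * M₂ + n * T) * n.factorial * M₃
  have hM : 0 < M := by positivity
  set l₀ := max 1 (8 * M / c + 1)
  set L := max L₀ (l₀ + outerGap n)
  have hLL0 : L₀ ≤ L := le_max_left _ _
  have hLp : 0 ≤ L := hL0.trans hLL0
  refine ⟨L, hLp, ?_⟩
  set l := outerLevel n L with hl_def
  have hgap := le_outerGap hn hLp
  have hll : l₀ ≤ l := by
    have : l₀ + outerGap n ≤ L := le_max_right _ _
    linarith
  have hl1 : 1 ≤ l := (le_max_left _ _).trans hll
  have hl2 : 8 * M / c < l := by
    have : 8 * M / c + 1 ≤ l₀ := le_max_right _ _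
    linarith
  set e := Real.exp (-(l / 2)) with he_def
  have he : 0 < e := Real.exp_pos _
  have he1 : e ≤ 1 := by rw [he_def]; exact Real.exp_le_one_iff.2 (by linarith)
  obtain ⟨w, g, hw, hwL, hE⟩ := exists_outer_near_max hn hLp he
  set A := Real.exp (-(L - l)) with hA_def
  have hA : 0 < A := Real.exp_pos _
  have hAo : A ≤ o := Real.exp_le_exp.2 (by linarith [outerLevel_le hn hLp])
  have hIE := innerEnergy_nonneg n l
  set δ := e + A * (T * e) with hδ_def
  have hδ : 0 < δ := by positivity
  have hδM : δ ≤ M₁ * e := by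
    have : A * (T * e) ≤ o * (T * e) := by gcongr
    simp only [hδ_def, M₁]; linarith
  set Q := l + innerEnergy n l with hQ_def
  have hS : 0 < Q + δ := by positivity
  obtain ⟨k, hk0, hk⟩ := exists_root (n + 1) (by omega) (inv_pos.2 hS).le
  have hkS : k ^ (n + 1) * (Q + δ) = 1 := by rw [hk]; exact inv_mul_cancel₀ hS.ne'
  have hkpos : 0 < k := by
    rcases hk0.lt_or_eq with h | h
    · exact h
    · rw [← h, zero_pow (by omega), zero_mul] at hkS; norm_num at hkS
  have hk1 : k ≤ 1 := by
    by_contra! h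
    have h1 : 1 < k ^ (n + 1) := one_lt_pow₀ h (by omega)
    nlinarith
  obtain ⟨u, r, hu, huw, hur⟩ := exists_adm_glue hn hl1 he.le hkpos hw hwL hE hkS
  have hleft := ofReal_div_le_mosF_Iic hn hLL0 hkpos hu.prim.continuous huw
    (hmass L e hLL0 he1 w g hw hwL hE)
  have hright := le_mosF_innerProfile hn hl1 hkpos hk1
  have htot : mosF n 1 u (Set.Iic L) + mosF n 1 u (Set.Ioi L) ≤ admSup n 1 := by
    refine le_trans (le_of_eq ?_) (hu.le_admSup 1)
    rw [mosF, mosF, mosF, Measure.restrict_univ, ← Set.compl_Iic,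
      lintegral_add_compl _ measurableSet_Iic]
  have hsqrt : √(n * Real.exp (-l)) = √n * e := by
    rw [Real.sqrt_mul (by positivity), he_def, show -l = -(l / 2) + -(l / 2) by ring, Real.exp_add,
      Real.sqrt_mul_self (Real.exp_pos _).le]
  have hexp : H * Real.exp (-(M₂ * e)) ≤
      Real.exp ((k * Q) ^ cexp n - Q + hCC n - 4 * √(n * Real.exp (-l))) := by
    have h1 := sub_le_rpow_cexp hn hkpos.le (by positivity : 0 ≤ Q) hδ.le hkS
    calc H * Real.exp (-(M₂ * e)) = Real.exp (hCC n + -(M₂ * e)) := (Real.exp_add _ _).symm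
      _ ≤ _ := by
          refine Real.exp_le_exp.2 ?_
          rw [hsqrt]
          have : M₂ * e = M₁ * e + 4 * (√n * e) := by simp only [M₂]; ring
          linarith
  by_contra! hle
  have hfin : ENNReal.ofReal A * ENNReal.ofReal (H * Real.exp (-(M₂ * e))) +
      ENNReal.ofReal (k ^ (n + 1) * c / n.factorial) ≤
      ENNReal.ofReal (A * H) + ENNReal.ofReal (A * (n * T * e)) := by
    calc _ ≤ ENNReal.ofReal A * (mosF n 1 (fun t => k * innerProfile n l t) (Set.Ioi l) +
          ENNReal.ofReal (n * T * e)) + mosF n 1 u (Set.Iic L) :=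
          add_le_add (mul_le_mul_right ((ENNReal.ofReal_le_ofReal hexp).trans hright) _) hleft
      _ = (mosF n 1 u (Set.Iic L) + mosF n 1 u (Set.Ioi L)) + ENNReal.ofReal (A * (n * T * e)) := by
          rw [hur, ENNReal.ofReal_mul hA.le]; ring
      _ ≤ _ := by gcongr; exact htot.trans hle
  rw [← ENNReal.ofReal_mul hA.le, ← ENNReal.ofReal_add (by positivity) (by positivity)] at hfin
  have hreal : A * (H * (1 - M₂ * e)) + k ^ (n + 1) * c / n.factorial ≤
      A * H + A * (n * T * e) := by
    rw [← ENNReal.ofReal_add (by positivity) (by positivity),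
      ENNReal.ofReal_le_ofReal_iff (by positivity)] at hfin
    have h2 : A * (H * (1 - M₂ * e)) ≤ A * (H * Real.exp (-(M₂ * e))) := by
      gcongr; linarith [Real.add_one_le_exp (-(M₂ * e))]
    linarith
  have hQS : Q + δ ≤ M₃ * l := by
    have h1 := innerEnergy_le hn (zero_le_one.trans hl1)
    have h2 : M₁ * e ≤ M₁ * l := by gcongr; linarith
    have h3 : (2 : ℝ) * n * (l + 1) ≤ 4 * n * l := by
      have : (0 : ℝ) ≤ n * (l - 1) := mul_nonneg (by positivity) (by linarith)
      linarith
    simp only [M₃, hQ_def]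
    linarith
  have hcS : c ≤ A * (H * M₂ + n * T) * e * n.factorial * (Q + δ) := by
    have h1 : k ^ (n + 1) * c / n.factorial ≤ A * (H * M₂ + n * T) * e := by linarith
    rw [div_le_iff₀ (by positivity)] at h1
    calc c = k ^ (n + 1) * c * (Q + δ) := by linear_combination (-c) * hkS
      _ ≤ _ := by gcongr
  have hfinal : c ≤ M * (l * e) := by
    calc c ≤ A * (H * M₂ + n * T) * e * n.factorial * (Q + δ) := hcS
      _ ≤ o * (H * M₂ + n * T) * e * n.factorial * (M₃ * l) := by gcongr
      _ = _ := by simp only [M]; ring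
  have h8 := mul_le_mul_of_nonneg_left (mul_exp_neg_half_le (zero_lt_one.trans_le hl1)) hM.le
  rw [div_lt_iff₀ hc] at hl2
  have h9 : M * (8 / l) < c := by
    rw [← mul_div_assoc, div_lt_iff₀ (by linarith)]; linarith
  linarith

theorem exists_adm_ne_zero {n : ℕ} (hn : 1 ≤ n) : ∃ w g, Adm n w g ∧ w ≠ 0 := by
  obtain ⟨L, -, hL⟩ := exists_concentration_lt_admSup hn
  by_contra! h
  refine (zero_le.trans_lt hL).not_ge (iSup_le fun w => iSup_le fun g => iSup_le fun hw => ?_)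
  have h0 := h w g hw
  subst h0
  rw [mosF_eq hn zero_le_one hw.prim.continuous, psiF_zero, potE]
  simp

theorem vanLevel_le_admSup {n : ℕ} (hn : 1 ≤ n) {β : ℝ} (hβ : 0 < β) :
    ENNReal.ofReal (vanLevel n β) ≤ admSup n β := by
  obtain ⟨w, g, hw, hw0⟩ := exists_adm_ne_zero hn
  have key : ∀ ε ∈ Set.Ioc (0 : ℝ) 1,
      ENNReal.ofReal (vanLevel n β * (1 - ε ^ (n + 1))) ≤ admSup n β := by
    rintro ε ⟨hε, hε1⟩
    have hp : ENNReal.ofReal (|ε| ^ (n + 1)) ≤ 1 := by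
      rw [abs_of_pos hε]
      exact ENNReal.ofReal_le_one.2 (pow_le_one₀ hε.le hε1)
    have hA : Adm n (fun t => ε * w t) (fun t => ε * g t) := by
      refine ⟨hw.prim.const_mul ε, ?_⟩
      rw [dirE_const_mul, potE_const_mul, ← mul_add]
      exact mul_le_one' hp hw.le_one
    have hne : (fun t => ε * w t) ≠ 0 := by
      obtain ⟨t, ht⟩ := Function.ne_iff.1 hw0
      exact Function.ne_iff.2 ⟨t, mul_ne_zero hε.ne' ht⟩
    obtain ⟨u, r, hu, hle⟩ := hA.exists_translate hn hne hβ.le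
    refine le_trans ?_ (le_self_add.trans (hle.trans (hu.le_admSup β)))
    rw [ENNReal.ofReal_mul (vanLevel_pos n hβ).le, ENNReal.ofReal_sub _ (by positivity),
      ENNReal.ofReal_one, dirE_const_mul, abs_of_pos hε]
    refine mul_le_mul_right (tsub_le_tsub_left ?_ _) _
    exact mul_le_of_le_one_right' (hw.dirE_le _)
  have ht : Tendsto (fun ε : ℝ => ENNReal.ofReal (vanLevel n β * (1 - ε ^ (n + 1))))
      (nhdsWithin 0 (Set.Ioi 0))
        (nhds (ENNReal.ofReal (vanLevel n β * (1 - 0 ^ (n + 1))))) :=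
    tendsto_nhdsWithin_of_tendsto_nhds
      (Continuous.tendsto (ENNReal.continuous_ofReal.comp (by fun_prop)) 0)
  rw [zero_pow (by omega), sub_zero, mul_one] at ht
  refine le_of_tendsto ht ?_
  filter_upwards [Ioc_mem_nhdsGT (zero_lt_one (α := ℝ))] with ε hε using key ε hε

theorem mosF_div_pow_lt {n : ℕ} {β₁ β₂ : ℝ} (h1 : 0 < β₁) (h12 : β₁ < β₂)
    {w : ℝ → ℝ} (hw : Continuous w) (h0 : w ≠ 0) (hfin : mosF n β₁ w Set.univ ≠ ⊤) :
    ENNReal.ofReal (β₁ ^ n)⁻¹ * mosF n β₁ w Set.univ <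
      ENNReal.ofReal (β₂ ^ n)⁻¹ * mosF n β₂ w Set.univ := by
  have h2 : 0 < β₂ := h1.trans h12
  rw [mosF, mosF, ← lintegral_const_mul' _ _ ENNReal.ofReal_ne_top,
    ← lintegral_const_mul' _ _ ENNReal.ofReal_ne_top, Measure.restrict_univ]
  have hlt : ∀ x : ℝ, 0 < x →
      (β₁ ^ n)⁻¹ * expTail n (β₁ * x) < (β₂ ^ n)⁻¹ * expTail n (β₂ * x) := by
    intro x hx
    have h3 := expTail_mul_lt n (div_pos h1 h2) ((div_lt_one h2).2 h12) (mul_pos h2 hx)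
    rw [show β₁ / β₂ * (β₂ * x) = β₁ * x by field_simp, div_pow] at h3
    rw [inv_mul_lt_iff₀ (by positivity)]
    calc _ < _ := h3
      _ = _ := by field_simp
  obtain ⟨t₀, ht₀⟩ := Function.ne_iff.1 h0
  have hopen : IsOpen {t | w t ≠ 0} := isOpen_ne_fun hw continuous_const
  have hpos : ∀ t, w t ≠ 0 → ENNReal.ofReal (β₁ ^ n)⁻¹ *
      ENNReal.ofReal (expTail n (β₁ * |w t| ^ cexp n) * Real.exp (-t)) <
      ENNReal.ofReal (β₂ ^ n)⁻¹ *
      ENNReal.ofReal (expTail n (β₂ * |w t| ^ cexp n) * Real.exp (-t)) := by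
    intro t ht
    have hx : 0 < |w t| ^ cexp n := Real.rpow_pos_of_pos (abs_pos.2 ht) _
    have h4 := expTail_pos n (mul_pos h2 hx)
    rw [← ENNReal.ofReal_mul (by positivity), ← ENNReal.ofReal_mul (by positivity),
      ENNReal.ofReal_lt_ofReal_iff (by positivity), ← mul_assoc, ← mul_assoc]
    exact mul_lt_mul_of_pos_right (hlt _ hx) (Real.exp_pos _)
  refine lintegral_strict_mono_of_ae_le_of_ae_lt_on
    (((ENNReal.continuous_ofReal.comp
      (continuous_mosF_integrand hw n β₂)).measurable.const_mul _).aemeasurable)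
    ?_ (ae_of_all _ fun t => ?_) (hopen.measure_ne_zero volume ⟨t₀, ht₀⟩)
    (ae_of_all _ fun t ht => hpos t ht)
  · rw [lintegral_const_mul' _ _ ENNReal.ofReal_ne_top]
    rw [mosF, Measure.restrict_univ] at hfin
    exact ENNReal.mul_ne_top ENNReal.ofReal_ne_top hfin
  · by_cases ht : w t = 0
    · rcases n.eq_zero_or_pos with rfl | hn
      · simp [ht, (cexp_pos 0).ne']
      · have : expTail n 0 = 0 := by
          refine le_antisymm ((expTail_le_pow_mul_exp n le_rfl).trans ?_) (expTail_nonneg n le_rfl)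
          rw [zero_pow (by omega), zero_mul]
        simp [ht, (cexp_pos n).ne', this]
    · exact (hpos t ht).le

theorem exists_concBound {n : ℕ} {β : ℝ} (h0 : 0 < β) (h1 : β ≤ 1) : ∃ K, ConcBound n β K := by
  rcases h1.lt_or_eq with h | rfl
  · exact ⟨0, concBound_zero h0 h⟩
  · exact ⟨_, concBound_one⟩

/-- Monotonicity of the normalized suprema and attainability, in logarithmic coordinates. -/
theorem admSup_div_pow_lt_and_attained {n : ℕ} (hn : 1 ≤ n) {β₁ β₂ : ℝ} (h1 : 0 < β₁)
    (h12 : β₁ < β₂) (h2 : β₂ ≤ 1) {w g : ℝ → ℝ} (hw : Adm n w g)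
    (hatt : mosF n β₁ w Set.univ = admSup n β₁) :
    ENNReal.ofReal (β₁ ^ n)⁻¹ * admSup n β₁ < ENNReal.ofReal (β₂ ^ n)⁻¹ * admSup n β₂ ∧
      ∃ u r, Adm n u r ∧ mosF n β₂ u Set.univ = admSup n β₂ := by
  have h2' : 0 < β₂ := h1.trans h12
  have hv1 := vanLevel_le_admSup hn h1
  obtain ⟨K, hK⟩ := exists_concBound (n := n) h1 (h12.le.trans h2)
  have hfin := admSup_lt_top hn h1.le (h12.le.trans h2) hK
  have h0 : w ≠ 0 := by
    rintro rfl
    rw [mosF_eq hn h1.le hw.prim.continuous, psiF_zero, potE] at hatt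
    have := (ENNReal.ofReal_pos.2 (vanLevel_pos n h1)).trans_le hv1
    rw [← hatt] at this
    simp at this
  have hlt : ENNReal.ofReal (β₁ ^ n)⁻¹ * admSup n β₁ <
      ENNReal.ofReal (β₂ ^ n)⁻¹ * admSup n β₂ := by
    rw [← hatt]
    exact (mosF_div_pow_lt h1 h12 hw.prim.continuous h0 (hatt ▸ hfin.ne)).trans_le
      (mul_le_mul_right (hw.le_admSup β₂) _)
  have hvan : ENNReal.ofReal (vanLevel n β₂) < admSup n β₂ := by
    have h3 := (mul_le_mul_right hv1 (ENNReal.ofReal (β₁ ^ n)⁻¹)).trans_lt hlt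
    rw [← ENNReal.ofReal_mul (by positivity), vanLevel,
      inv_mul_eq_div, div_div_cancel_left' (by positivity)] at h3
    have h4 : ENNReal.ofReal (vanLevel n β₂) =
        ENNReal.ofReal (β₂ ^ n) * ENNReal.ofReal (n.factorial : ℝ)⁻¹ := by
      rw [← ENNReal.ofReal_mul (by positivity), vanLevel, div_eq_mul_inv]
    have h5 : admSup n β₂ =
        ENNReal.ofReal (β₂ ^ n) * (ENNReal.ofReal (β₂ ^ n)⁻¹ * admSup n β₂) := by
      rw [← mul_assoc, ← ENNReal.ofReal_mul (by positivity), mul_inv_cancel₀ (by positivity),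
        ENNReal.ofReal_one, one_mul]
    rw [h4, h5]
    exact ENNReal.mul_lt_mul_right (ENNReal.ofReal_pos.2 (by positivity)).ne'
      ENNReal.ofReal_ne_top h3
  refine ⟨hlt, ?_⟩
  rcases h2.lt_or_eq with h | rfl
  · refine exists_adm_eq_admSup hn h2' h2 (concBound_zero h2' h) hvan ⟨0, le_rfl, ?_⟩
    rw [mul_zero, ENNReal.ofReal_zero]
    exact zero_le.trans_lt hvan
  · exact exists_adm_eq_admSup hn h2' h2 concBound_one hvan (exists_concentration_lt_admSup hn)

/-- The radius with logarithmic coordinate `t`. -/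
noncomputable def rad (ρ N t : ℝ) : ℝ := ρ * Real.exp (-(t / N))

/-- The logarithmic coordinate of the radius `r`. -/
noncomputable def lrad (ρ N r : ℝ) : ℝ := -(N * Real.log (r / ρ))

section Radius

variable {ρ N : ℝ}

theorem rad_pos (hρ : 0 < ρ) (t : ℝ) : 0 < rad ρ N t := by unfold rad; positivity

theorem rad_lrad (hρ : 0 < ρ) (hN : 0 < N) {r : ℝ} (hr : 0 < r) : rad ρ N (lrad ρ N r) = r := by
  rw [rad, lrad, neg_div, neg_neg, mul_div_cancel_left₀ _ hN.ne', Real.exp_log (by positivity)]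
  field_simp

theorem lrad_rad (hρ : 0 < ρ) (hN : 0 < N) (t : ℝ) : lrad ρ N (rad ρ N t) = t := by
  rw [rad, lrad, mul_div_cancel_left₀ _ hρ.ne', Real.log_exp]
  field_simp

theorem hasDerivAt_rad (t : ℝ) : HasDerivAt (rad ρ N) (-(rad ρ N t / N)) t := by
  have h : HasDerivAt (fun t => -(t / N)) (-(1 / N)) t := ((hasDerivAt_id t).div_const N).neg
  exact (h.exp.const_mul ρ).congr_deriv (by simp only [rad]; ring)

theorem strictAnti_rad (hρ : 0 < ρ) (hN : 0 < N) : StrictAnti (rad ρ N) := fun s t h => by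
  unfold rad
  gcongr

theorem rad_image_univ (hρ : 0 < ρ) (hN : 0 < N) : rad ρ N '' Set.univ = Set.Ioi 0 := by
  ext r
  exact ⟨fun ⟨t, _, h⟩ => h ▸ rad_pos hρ t, fun h => ⟨lrad ρ N r, trivial, rad_lrad hρ hN h⟩⟩

theorem rad_image_Icc (hρ : 0 < ρ) (hN : 0 < N) (a b : ℝ) :
    rad ρ N '' Set.Icc a b = Set.Icc (rad ρ N b) (rad ρ N a) := by
  have hs := strictAnti_rad hρ hN
  ext r
  refine ⟨fun ⟨t, ht, h⟩ => h ▸ ⟨hs.antitone ht.2, hs.antitone ht.1⟩, fun h => ?_⟩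
  have hr : rad ρ N (lrad ρ N r) = r := rad_lrad hρ hN ((rad_pos hρ b).trans_le h.1)
  refine ⟨lrad ρ N r, ⟨hs.le_iff_ge.1 ?_, hs.le_iff_ge.1 ?_⟩, hr⟩
  · rw [hr]; exact h.2
  · rw [hr]; exact h.1

theorem lintegral_rad (hρ : 0 < ρ) (hN : 0 < N) (F : ℝ → ℝ≥0∞) :
    ∫⁻ r in Set.Ioi (0 : ℝ), F r =
      ∫⁻ t in Set.univ, ENNReal.ofReal (rad ρ N t / N) * F (rad ρ N t) := by
  rw [← rad_image_univ hρ hN, lintegral_image_eq_lintegral_abs_deriv_mul MeasurableSet.univ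
    (fun t _ => (hasDerivAt_rad t).hasDerivWithinAt) (strictAnti_rad hρ hN).injective.injOn]
  refine lintegral_congr fun t => ?_
  rw [abs_neg, abs_of_pos (div_pos (rad_pos hρ t) hN)]

theorem intervalIntegrable_rad (hρ : 0 < ρ) (hN : 0 < N) (F : ℝ → ℝ) {a b : ℝ} (hab : a ≤ b) :
    IntervalIntegrable F volume (rad ρ N b) (rad ρ N a) ↔
      IntervalIntegrable (fun t => -(rad ρ N t / N) * F (rad ρ N t)) volume a b := by
  have hs := (strictAnti_rad hρ hN).antitone
  rw [intervalIntegrable_iff_integrableOn_Icc_of_le (hs hab),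
    intervalIntegrable_iff_integrableOn_Icc_of_le hab, ← rad_image_Icc hρ hN,
    integrableOn_image_iff_integrableOn_deriv_smul_of_antitoneOn measurableSet_Icc
      (fun t _ => (hasDerivAt_rad t).hasDerivWithinAt) (hs.antitoneOn _),
    IntegrableOn, ← integrable_neg_iff]
  refine iff_of_eq (congrArg (fun f => Integrable f _) (funext fun t => ?_))
  simp

theorem intervalIntegral_rad (hρ : 0 < ρ) (hN : 0 < N) (F : ℝ → ℝ) {a b : ℝ} (hab : a ≤ b) :
    ∫ t in a..b, -(rad ρ N t / N) * F (rad ρ N t) =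
      -∫ r in rad ρ N b..rad ρ N a, F r := by
  have hs := (strictAnti_rad hρ hN).antitone
  rw [intervalIntegral.integral_of_le hab, intervalIntegral.integral_of_le (hs hab),
    ← integral_Icc_eq_integral_Ioc, ← integral_Icc_eq_integral_Ioc, ← rad_image_Icc hρ hN,
    integral_image_eq_integral_deriv_smul_of_antitoneOn measurableSet_Icc
      (fun t _ => (hasDerivAt_rad t).hasDerivWithinAt) (hs.antitoneOn _), ← integral_neg]
  simp

end Radius

/-- The function `u` in logarithmic coordinates, with amplitude `K`. -/
noncomputable def logFun (ρ N K : ℝ) (u : ℝ → ℝ) (t : ℝ) : ℝ := K * u (rad ρ N t)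

/-- The derivative of `logFun ρ N K u` when `v` is the derivative of `u`. -/
noncomputable def logSlope (ρ N K : ℝ) (v : ℝ → ℝ) (t : ℝ) : ℝ :=
  K * (-(rad ρ N t / N) * v (rad ρ N t))

section Transfer

variable {ρ N K : ℝ}

theorem isPrim_logFun (hρ : 0 < ρ) (hN : 0 < N) {u v : ℝ → ℝ}
    (hintg : ∀ a b : ℝ, 0 < a → a ≤ b → IntervalIntegrable v volume a b)
    (hftc : ∀ a b : ℝ, 0 < a → a ≤ b → u b - u a = ∫ t in a..b, v t) :
    IsPrim (logFun ρ N K u) (logSlope ρ N K v) := by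
  have hs := (strictAnti_rad hρ hN).antitone
  have h1 : ∀ a b, a ≤ b → IntervalIntegrable (logSlope ρ N K v) volume a b := fun a b hab =>
    ((intervalIntegrable_rad hρ hN v hab).1 (hintg _ _ (rad_pos hρ b) (hs hab))).const_mul K
  have h2 : ∀ a b, a ≤ b → logFun ρ N K u b - logFun ρ N K u a =
      ∫ t in a..b, logSlope ρ N K v t := by
    intro a b hab
    simp only [logSlope, logFun]
    rw [intervalIntegral.integral_const_mul, intervalIntegral_rad hρ hN v hab,
      ← hftc _ _ (rad_pos hρ b) (hs hab)]
    ring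
  refine ⟨fun a b => ?_, fun a b => ?_⟩
  · rcases le_total a b with h | h
    · exact h1 a b h
    · exact (h1 b a h).symm
  · rcases le_total a b with h | h
    · exact h2 a b h
    · rw [intervalIntegral.integral_symm, ← h2 b a h]; ring

theorem exists_logFun_eq (hρ : 0 < ρ) (hN : 0 < N) (hK : 0 < K) (w g : ℝ → ℝ) :
    ∃ u v, logFun ρ N K u = w ∧ logSlope ρ N K v = g := by
  refine ⟨fun r => w (lrad ρ N r) / K, fun r => -(g (lrad ρ N r) / (K * (r / N))),
    funext fun t => ?_, funext fun t => ?_⟩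
  · rw [logFun, lrad_rad hρ hN, mul_div_cancel₀ _ hK.ne']
  · have := rad_pos (N := N) hρ t
    rw [logSlope, lrad_rad hρ hN]
    field_simp

theorem ftc_of_isPrim_logFun (hρ : 0 < ρ) (hN : 0 < N) (hK : 0 < K) {u v : ℝ → ℝ}
    (h : IsPrim (logFun ρ N K u) (logSlope ρ N K v)) {a b : ℝ} (ha : 0 < a) (hab : a ≤ b) :
    IntervalIntegrable v volume a b ∧ u b - u a = ∫ t in a..b, v t := by
  have hb := ha.trans_le hab
  have hle : lrad ρ N b ≤ lrad ρ N a := by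
    rw [← (strictAnti_rad hρ hN).le_iff_ge, rad_lrad hρ hN ha, rad_lrad hρ hN hb]
    exact hab
  have h1 := (h.int (lrad ρ N b) (lrad ρ N a)).const_mul K⁻¹
  have h2 := h.ftc (lrad ρ N b) (lrad ρ N a)
  simp only [logSlope, logFun, ← mul_assoc, inv_mul_cancel₀ hK.ne', one_mul] at h1 h2
  refine ⟨?_, ?_⟩
  · have := (intervalIntegrable_rad hρ hN v hle).2 h1
    rwa [rad_lrad hρ hN ha, rad_lrad hρ hN hb] at this
  · simp only [mul_assoc] at h2
    rw [intervalIntegral.integral_const_mul, intervalIntegral_rad hρ hN v hle,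
      rad_lrad hρ hN ha, rad_lrad hρ hN hb, ← mul_sub] at h2
    have := mul_left_cancel₀ hK.ne' h2
    linarith

end Transfer

theorem omegaW_pos {θ : ℝ} (hθ : 0 ≤ θ) : 0 < omegaW θ := by
  have := Real.Gamma_pos_of_pos (by positivity : 0 < (θ + 1) / 2)
  unfold omegaW
  positivity

theorem muC_pos {α θ : ℝ} (hα : 0 ≤ α) (hθ : 0 ≤ θ) : 0 < muC α θ := by
  have := omegaW_pos hα
  unfold muC
  positivity

theorem muC_pow {n : ℕ} (hn : 1 ≤ n) {θ : ℝ} : muC n θ ^ n = (θ + 1) ^ n * omegaW n := by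
  have h : (0 : ℝ) < n := by exact_mod_cast hn
  rw [muC, mul_pow, ← Real.rpow_mul_natCast (omegaW_pos h.le).le, one_div_mul_cancel h.ne',
    Real.rpow_one]

/-- The scaling under which the weighted functionals become the logarithmic ones. -/
structure IsLogScaling (n : ℕ) (θ ρ K : ℝ) : Prop where
  radius_pos : 0 < ρ
  amp_pos : 0 < K
  radius_eq : omegaW θ * ρ ^ (θ + 1) = (θ + 1) * muC n θ ^ n
  amp_eq : K ^ (n + 1) = muC n θ ^ n

theorem exists_isLogScaling (n : ℕ) {θ : ℝ} (hθ : 0 ≤ θ) : ∃ ρ K, IsLogScaling n θ ρ K := by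
  have hω := omegaW_pos hθ
  have hμ := muC_pos (n.cast_nonneg (α := ℝ)) hθ
  have hN : 0 < θ + 1 := by linarith
  obtain ⟨K, hK0, hK⟩ := exists_root (n + 1) (by omega) (pow_pos hμ n).le
  have hKp : 0 < K := by
    refine hK0.lt_of_ne fun h => ?_
    rw [← h, zero_pow (by omega)] at hK
    exact (pow_pos hμ n).ne hK
  refine ⟨((θ + 1) * muC n θ ^ n / omegaW θ) ^ (θ + 1)⁻¹, K, by positivity, hKp, ?_, hK⟩
  rw [← Real.rpow_mul (by positivity), inv_mul_cancel₀ hN.ne', Real.rpow_one]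
  field_simp

namespace IsLogScaling

variable {n : ℕ} {θ ρ K : ℝ}

theorem wInt_eq (h : IsLogScaling n θ ρ K) (hθ : 0 ≤ θ) (f : ℝ → ℝ) :
    wInt θ f = ENNReal.ofReal (muC n θ ^ n) *
      ∫⁻ t in Set.univ, ENNReal.ofReal (f (rad ρ (θ + 1) t)) * ENNReal.ofReal (Real.exp (-t)) := by
  have hN : 0 < θ + 1 := by linarith
  have hω := omegaW_pos hθ
  have hμ := muC_pos (n.cast_nonneg (α := ℝ)) hθ
  rw [wInt, lintegral_rad h.radius_pos hN, ← lintegral_const_mul' _ _ ofReal_ne_top,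
    ← lintegral_const_mul' _ _ ofReal_ne_top]
  refine lintegral_congr fun t => ?_
  have hr := rad_pos (N := θ + 1) h.radius_pos t
  have key : omegaW θ * (rad ρ (θ + 1) t / (θ + 1) * rad ρ (θ + 1) t ^ θ) =
      muC n θ ^ n * Real.exp (-t) := by
    have h1 : rad ρ (θ + 1) t * rad ρ (θ + 1) t ^ θ = ρ ^ (θ + 1) * Real.exp (-t) := by
      rw [mul_comm, ← Real.rpow_add_one hr.ne', rad,
        Real.mul_rpow h.radius_pos.le (Real.exp_pos _).le, ← Real.exp_mul]
      congr 2
      field_simp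
    calc _ = omegaW θ * (rad ρ (θ + 1) t * rad ρ (θ + 1) t ^ θ) / (θ + 1) := by ring
      _ = omegaW θ * ρ ^ (θ + 1) * Real.exp (-t) / (θ + 1) := by rw [h1]; ring
      _ = _ := by rw [h.radius_eq]; field_simp
  calc _ = ENNReal.ofReal (f (rad ρ (θ + 1) t)) * (ENNReal.ofReal (omegaW θ) *
        (ENNReal.ofReal (rad ρ (θ + 1) t / (θ + 1)) * ENNReal.ofReal (rad ρ (θ + 1) t ^ θ))) := by
        ring
    _ = ENNReal.ofReal (f (rad ρ (θ + 1) t)) *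
        (ENNReal.ofReal (muC n θ ^ n) * ENNReal.ofReal (Real.exp (-t))) := by
        rw [← ENNReal.ofReal_mul (by positivity), ← ENNReal.ofReal_mul hω.le, key,
          ENNReal.ofReal_mul (by positivity)]
    _ = _ := by ring

theorem wInt_pow_eq (h : IsLogScaling n θ ρ K) (hθ : 0 ≤ θ) (u : ℝ → ℝ) :
    wInt θ (fun r => |u r| ^ ((n : ℝ) + 1)) = potE n (logFun ρ (θ + 1) K u) Set.univ := by
  have hμ := muC_pos (n.cast_nonneg (α := ℝ)) hθ
  rw [h.wInt_eq hθ, potE, ← lintegral_const_mul' _ _ ofReal_ne_top]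
  refine lintegral_congr fun t => ?_
  have e : ((n : ℝ) + 1) = ((n + 1 : ℕ) : ℝ) := by push_cast; rfl
  rw [e, Real.rpow_natCast, ← ENNReal.ofReal_mul (by positivity),
    ← ENNReal.ofReal_mul (by positivity), logFun, abs_mul, mul_pow, abs_of_pos h.amp_pos, h.amp_eq,
    mul_assoc]

theorem wInt_deriv_pow_eq (h : IsLogScaling n θ ρ K) (hn : 1 ≤ n) (hθ : 0 ≤ θ) (v : ℝ → ℝ) :
    wInt n (fun r => |v r| ^ ((n : ℝ) + 1)) = dirE n (logSlope ρ (θ + 1) K v) Set.univ := by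
  have hN : 0 < θ + 1 := by linarith
  have hω := omegaW_pos (n.cast_nonneg (α := ℝ))
  rw [wInt, lintegral_rad h.radius_pos hN, dirE, ← lintegral_const_mul' _ _ ofReal_ne_top]
  refine lintegral_congr fun t => ?_
  have hr := rad_pos (N := θ + 1) h.radius_pos t
  have e : ((n : ℝ) + 1) = ((n + 1 : ℕ) : ℝ) := by push_cast; rfl
  rw [e, Real.rpow_natCast, Real.rpow_natCast, ← ENNReal.ofReal_mul (by positivity),
    ← ENNReal.ofReal_mul (by positivity), ← ENNReal.ofReal_mul hω.le, logSlope, abs_mul, mul_pow,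
    abs_of_pos h.amp_pos, h.amp_eq, muC_pow hn, abs_mul, abs_neg, abs_of_pos (div_pos hr hN),
    mul_pow (rad ρ (θ + 1) t / (θ + 1)), div_pow]
  congr 1
  field_simp
  ring

theorem amp_rpow_cexp (h : IsLogScaling n θ ρ K) (hn : 1 ≤ n) (hθ : 0 ≤ θ) :
    K ^ cexp n = muC n θ := by
  have hμ := muC_pos (n.cast_nonneg (α := ℝ)) hθ
  have hK := h.amp_pos
  refine (pow_left_inj₀ (by positivity) hμ.le (by omega : n ≠ 0)).1 ?_
  rw [rpow_cexp_pow hn hK.le, h.amp_eq]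

theorem TMfunc_eq (h : IsLogScaling n θ ρ K) (hn : 1 ≤ n) (hθ : 0 ≤ θ) {σ : ℝ} (hσ : 0 ≤ σ)
    (u : ℝ → ℝ) : TMfunc ((n : ℝ) + 1) θ σ u = ENNReal.ofReal (muC n θ ^ n) *
      mosF n (σ / muC n θ) (logFun ρ (θ + 1) K u) Set.univ := by
  have hμ := muC_pos (n.cast_nonneg (α := ℝ)) hθ
  have hn' : (0 : ℝ) < n := by exact_mod_cast hn
  rw [TMfunc, h.wInt_eq hθ, mosF]
  congr 1
  refine lintegral_congr fun t => ?_
  have e : ((n : ℝ) + 1) / ((n : ℝ) + 1 - 1) = cexp n := by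
    rw [add_sub_cancel_right, cexp, add_div, div_self hn'.ne', one_div]
  rw [e, phiP_eq_expTail, logFun, abs_mul, Real.mul_rpow (abs_nonneg _) (abs_nonneg _),
    abs_of_pos h.amp_pos, h.amp_rpow_cexp hn hθ, ← mul_assoc, div_mul_cancel₀ _ hμ.ne',
    ENNReal.ofReal_mul (expTail_nonneg n (by positivity))]

end IsLogScaling

theorem wNorm_rpow {θ q : ℝ} (hq : q ≠ 0) (u : ℝ → ℝ) :
    wNorm θ q u ^ q = wInt θ fun r => |u r| ^ q := by
  rw [wNorm, ← ENNReal.rpow_mul, one_div_mul_cancel hq, ENNReal.rpow_one]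

theorem Xnorm_le_one_iff {p α θ : ℝ} (hp : 0 < p) (u v : ℝ → ℝ) :
    Xnorm p α θ u v ≤ 1 ↔
      wInt θ (fun r => |u r| ^ p) + wInt α (fun r => |v r| ^ p) ≤ 1 := by
  rw [Xnorm, wNorm_rpow hp.ne', wNorm_rpow hp.ne']
  refine ⟨fun h => ?_, fun h => ENNReal.rpow_le_one h (by positivity)⟩
  have := ENNReal.rpow_le_one h hp.le
  rwa [← ENNReal.rpow_mul, one_div_mul_cancel hp.ne', ENNReal.rpow_one] at this

theorem tendsto_lrad {ρ N : ℝ} (hρ : 0 < ρ) (hN : 0 < N) : Tendsto (lrad ρ N) atTop atBot := by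
  unfold lrad
  refine tendsto_neg_atTop_atBot.comp (Tendsto.const_mul_atTop hN ?_)
  exact Real.tendsto_log_atTop.comp (tendsto_id.atTop_div_const hρ)

theorem Adm.tendsto_atBot {n : ℕ} (hn : 1 ≤ n) {w g : ℝ → ℝ} (h : Adm n w g) :
    Tendsto w atBot (nhds 0) := by
  rw [Metric.tendsto_nhds]
  intro ε hε
  set δ := min 1 (ε / 3)
  have hδ : 0 < δ := by positivity
  have hδε : δ ≤ ε / 3 := min_le_right _ _
  filter_upwards [Real.tendsto_exp_atBot.eventually_lt_const (pow_pos hδ (n + 3))] with t ht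
  have := h.prim.abs_le_of_exp_lt hn (h.dirE_le _) (h.potE_le _) hδ (min_le_left _ _) ht
  rw [Real.dist_eq, sub_zero]
  linarith

namespace IsLogScaling

variable {n : ℕ} {θ ρ K : ℝ}

theorem adm_iff (h : IsLogScaling n θ ρ K) (hn : 1 ≤ n) (hθ : 0 ≤ θ) (u v : ℝ → ℝ) :
    MemX ((n : ℝ) + 1) n θ u v ∧ Xnorm ((n : ℝ) + 1) n θ u v ≤ 1 ↔
      Adm n (logFun ρ (θ + 1) K u) (logSlope ρ (θ + 1) K v) := by
  have hN : 0 < θ + 1 := by linarith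
  have hp : (0 : ℝ) < n + 1 := by positivity
  rw [Xnorm_le_one_iff hp, h.wInt_pow_eq hθ, h.wInt_deriv_pow_eq hn hθ,
    add_comm (potE n _ _)]
  refine ⟨fun ⟨hu, h1⟩ => ⟨isPrim_logFun h.radius_pos hN hu.ftc_int hu.ftc, h1⟩,
    fun hA => ⟨⟨fun a b ha hab => ?_, fun a b ha hab => ?_, ?_, ?_, ?_⟩, hA.le_one⟩⟩
  · exact (ftc_of_isPrim_logFun h.radius_pos hN h.amp_pos hA.prim ha hab).1
  · exact (ftc_of_isPrim_logFun h.radius_pos hN h.amp_pos hA.prim ha hab).2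
  · have h1 := ((hA.tendsto_atBot hn).comp (tendsto_lrad h.radius_pos hN)).const_mul K⁻¹
    rw [mul_zero] at h1
    refine h1.congr' ?_
    filter_upwards [eventually_gt_atTop 0] with r hr
    rw [Function.comp, logFun, rad_lrad h.radius_pos hN hr, inv_mul_cancel_left₀ h.amp_pos.ne']
  · rw [wNorm, h.wInt_pow_eq hθ]
    exact ENNReal.rpow_lt_top_of_nonneg (by positivity)
      ((hA.potE_le _).trans_lt one_lt_top).ne
  · rw [wNorm, h.wInt_deriv_pow_eq hn hθ]
    exact ENNReal.rpow_lt_top_of_nonneg (by positivity)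
      ((hA.dirE_le _).trans_lt one_lt_top).ne

theorem TMC_eq (h : IsLogScaling n θ ρ K) (hn : 1 ≤ n) (hθ : 0 ≤ θ) {σ : ℝ} (hσ : 0 ≤ σ) :
    TMC ((n : ℝ) + 1) n θ σ =
      ENNReal.ofReal (muC n θ ^ n) * admSup n (σ / muC n θ) := by
  have hN : 0 < θ + 1 := by linarith
  rw [TMC, admSup]
  simp only [ENNReal.mul_iSup]
  refine le_antisymm ?_ ?_
  · refine iSup_le fun u => iSup_le fun v => iSup_le fun hu => iSup_le fun hx => ?_
    rw [h.TMfunc_eq hn hθ hσ]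
    exact le_iSup_of_le _ (le_iSup_of_le _
      (le_iSup_of_le ((h.adm_iff hn hθ u v).1 ⟨hu, hx⟩) le_rfl))
  · refine iSup_le fun w => iSup_le fun g => iSup_le fun hA => ?_
    obtain ⟨u, v, rfl, rfl⟩ := exists_logFun_eq h.radius_pos hN h.amp_pos w g
    obtain ⟨hu, hx⟩ := (h.adm_iff hn hθ u v).2 hA
    rw [← h.TMfunc_eq hn hθ hσ]
    exact le_iSup_of_le u (le_iSup_of_le v (le_iSup_of_le hu (le_iSup_of_le hx le_rfl)))

theorem TMCAttained_iff (h : IsLogScaling n θ ρ K) (hn : 1 ≤ n) (hθ : 0 ≤ θ) {σ : ℝ}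
    (hσ : 0 ≤ σ) : TMCAttained ((n : ℝ) + 1) n θ σ ↔
      ∃ w g, Adm n w g ∧ mosF n (σ / muC n θ) w Set.univ = admSup n (σ / muC n θ) := by
  have hN : 0 < θ + 1 := by linarith
  have hμ := ENNReal.ofReal_pos.2 (pow_pos (muC_pos (n.cast_nonneg (α := ℝ)) hθ) n)
  rw [TMCAttained, h.TMC_eq hn hθ hσ]
  constructor
  · rintro ⟨u, v, hu, hx, he⟩
    rw [h.TMfunc_eq hn hθ hσ] at he
    exact ⟨_, _, (h.adm_iff hn hθ u v).1 ⟨hu, hx⟩,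
      ((ENNReal.mul_right_inj hμ.ne' ofReal_ne_top).1 he).symm⟩
  · rintro ⟨w, g, hA, he⟩
    obtain ⟨u, v, rfl, rfl⟩ := exists_logFun_eq h.radius_pos hN h.amp_pos w g
    obtain ⟨hu, hx⟩ := (h.adm_iff hn hθ u v).2 hA
    exact ⟨u, v, hu, hx, by rw [h.TMfunc_eq hn hθ hσ, he]⟩

end IsLogScaling

theorem stmt_19 (p α θ σ₁ σ₂ : ℝ) (hp : 2 ≤ p) (hα : α = p - 1) (hθ : 0 ≤ θ)
    (hk : (k0 p : ℝ) = p - 1) (h1 : 0 < σ₁) (h12 : σ₁ < σ₂) (h2 : σ₂ ≤ muC α θ)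
    (hatt : TMCAttained p α θ σ₁) :
    ENNReal.ofReal ((Nat.factorial (k0 p) : ℝ) / σ₁ ^ (p - 1)) * TMC p α θ σ₁ <
      ENNReal.ofReal ((Nat.factorial (k0 p) : ℝ) / σ₂ ^ (p - 1)) * TMC p α θ σ₂ ∧
    TMCAttained p α θ σ₂ := by
  generalize k0 p = n at hk ⊢
  obtain rfl : p = (n : ℝ) + 1 := by linarith
  obtain rfl : α = n := by linarith
  have hn : 1 ≤ n := by
    have : (1 : ℝ) ≤ n := by linarith
    exact_mod_cast this
  have hσ2 : 0 < σ₂ := h1.trans h12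
  have hμ := muC_pos (n.cast_nonneg (α := ℝ)) hθ
  obtain ⟨ρ, K, hs⟩ := exists_isLogScaling n hθ
  rw [hs.TMCAttained_iff hn hθ h1.le] at hatt
  obtain ⟨w, g, hA, he⟩ := hatt
  obtain ⟨hlt, hex⟩ := admSup_div_pow_lt_and_attained hn (div_pos h1 hμ)
    (div_lt_div_of_pos_right h12 hμ) ((div_le_one hμ).2 h2) hA he
  refine ⟨?_, (hs.TMCAttained_iff hn hθ hσ2.le).2 hex⟩
  have hconst : ∀ σ : ℝ, 0 < σ → ENNReal.ofReal ((n.factorial : ℝ) / σ ^ ((n : ℝ) + 1 - 1)) *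
      TMC ((n : ℝ) + 1) n θ σ = ENNReal.ofReal n.factorial *
      (ENNReal.ofReal ((σ / muC n θ) ^ n)⁻¹ * admSup n (σ / muC n θ)) := by
    intro σ hσ
    rw [hs.TMC_eq hn hθ hσ.le, add_sub_cancel_right, Real.rpow_natCast, ← mul_assoc, ← mul_assoc,
      ← ENNReal.ofReal_mul (by positivity), ← ENNReal.ofReal_mul (by positivity)]
    congr 2
    rw [div_pow]
    field_simp
  rw [hconst σ₁ h1, hconst σ₂ hσ2]
  exact ENNReal.mul_lt_mul_right (ENNReal.ofReal_pos.2 (by positivity)).ne'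
    ENNReal.ofReal_ne_top hlt
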